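/- Suppose there exists ρ ∈ h* with α_i^∨(ρ) = a_{ii}/2 for all i ∈ I, and let λ ∈ P^+. Then the character of ℙ_λ is given by the Weyl–Kac–Borcherds formula: for every μ ∈ P, the set S(μ) = {(w, F, π) ∈ W × 𝒫(Π_im) × ℙ_λ : w(ρ − s(F)) + π(1) = μ} and the set S'(μ) = {(w, F) ∈ W × 𝒫(Π_im)^λ : w(λ + ρ − s(F)) = μ} are finite, and Σ_{(w,F,π)∈S(μ)} (−1)^{ℓ(w)+|F|} = Σ_{(w,F)∈S'(μ)} (−1)^{ℓ(w)+|F|}. Equivalently, as formal sums, (Σ_{π∈ℙ_λ} e^{π(1)}) · (Σ_{w∈W} Σ_{F∈𝒫(Π_im)} (−1)^{ℓ(w)+|F|} e^{w(ρ−s(F))}) = Σ_{w∈W} Σ_{F∈𝒫(Π_im)^λ} (−1)^{ℓ(w)+|F|} e^{w(λ+ρ−s(F))}. (No symmetrizability assumption on A is made.) -/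

import Mathlib

namespace GKM

variable {I V : Type*} [AddCommGroup V] [Module ℚ V]

/-- The simple "reflection" `r_i : x ↦ x - α_i^∨(x) • α_i` (an endomorphism of `h*`). -/
def srefl (α : I → V) (coroot : I → (V →ₗ[ℚ] ℚ)) (i : I) : Module.End ℚ V :=
  LinearMap.id - (coroot i).smulRight (α i)

/-- The dual map `h ↦ h - h(α_i) • α_i^∨` on linear functionals; for a real index `i`
this is `r_i^∨ : h ↦ h ∘ r_i⁻¹ = h ∘ r_i`. -/
def crefl (α : I → V) (coroot : I → (V →ₗ[ℚ] ℚ)) (i : I) :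
    Module.End ℚ (V →ₗ[ℚ] ℚ) :=
  LinearMap.id - (LinearMap.applyₗ (α i)).smulRight (coroot i)

/-- The monoid `T` generated by all the `r_i`, `i ∈ I`. -/
def Tmon (α : I → V) (coroot : I → (V →ₗ[ℚ] ℚ)) : Submonoid (Module.End ℚ V) :=
  Submonoid.closure (Set.range (srefl α coroot))

/-- The Weyl group `W` generated by the `r_i` with `i` real; since each generator is an
involution, the submonoid it generates coincides with the group it generates. -/
def Wmon (A : I → I → ℤ) (α : I → V) (coroot : I → (V →ₗ[ℚ] ℚ)) :
    Submonoid (Module.End ℚ V) :=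
  Submonoid.closure (srefl α coroot '' {i | A i i = 2})

/-- `Q^+`, the set of `ℕ`-linear combinations of simple roots. -/
def Qplus (α : I → V) : Set V :=
  {x | ∃ c : I →₀ ℕ, x = c.sum fun i n => (n : ℚ) • α i}

/-- The weight lattice `P`. -/
def Pint (coroot : I → (V →ₗ[ℚ] ℚ)) : Set V :=
  {x | ∀ i, ∃ n : ℤ, coroot i x = (n : ℚ)}

/-- The dominant integral weights `P^+`. -/
def Pplus (coroot : I → (V →ₗ[ℚ] ℚ)) : Set V :=
  {x | (∀ i, ∃ n : ℤ, coroot i x = (n : ℚ)) ∧ ∀ i, 0 ≤ coroot i x}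

/-- The orbit `Tλ`. -/
def Torbit (α : I → V) (coroot : I → (V →ₗ[ℚ] ℚ)) (lam : V) : Set V :=
  {x | ∃ τ, τ ∈ Tmon α coroot ∧ τ lam = x}

/-- The reduced length of `τ ∈ T` with respect to all generators `r_i`, `i ∈ I`. -/
noncomputable def lenT (α : I → V) (coroot : I → (V →ₗ[ℚ] ℚ))
    (τ : Module.End ℚ V) : ℕ :=
  sInf {n | ∃ l : List I, l.length = n ∧ (l.map (srefl α coroot)).prod = τ}

/-- The reduced length of `w ∈ W` with respect to the real generators. -/
noncomputable def lenW (A : I → I → ℤ) (α : I → V) (coroot : I → (V →ₗ[ℚ] ℚ))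
    (w : Module.End ℚ V) : ℕ :=
  sInf {n | ∃ l : List I, (∀ m ∈ l, A m m = 2) ∧ l.length = n ∧
    (l.map (srefl α coroot)).prod = w}

/-- The reflection `r_β : x ↦ x - β^∨(x) • β` attached to a root/coroot pair. -/
def reflRoot (β : V) (βv : V →ₗ[ℚ] ℚ) : Module.End ℚ V :=
  LinearMap.id - βv.smulRight β

/-- A presentation of `β = w α_k ∈ WΠ` together with its coroot `β^∨ = w^∨ α_k^∨`,
via a word `l` (with real entries) for `w`. -/
def IsWRootPres (A : I → I → ℤ) (α : I → V) (coroot : I → (V →ₗ[ℚ] ℚ))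
    (l : List I) (k : I) (β : V) (βv : V →ₗ[ℚ] ℚ) : Prop :=
  (∀ m ∈ l, A m m = 2) ∧
  β = (l.map (srefl α coroot)).prod (α k) ∧
  βv = (l.map (crefl α coroot)).prod (coroot k)

/-- `β ∈ WΠ` with coroot `β^∨`. -/
def IsWRootPair (A : I → I → ℤ) (α : I → V) (coroot : I → (V →ₗ[ℚ] ℚ))
    (β : V) (βv : V →ₗ[ℚ] ℚ) : Prop :=
  ∃ l k, IsWRootPres A α coroot l k β βv

/-- A chain `ν =: c s ← ⋯ ← c 0 := μ` of length `s` inside `Tλ`: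
`c k = r_{β k} (c (k+1))` with `β k ∈ WΠ ∩ Q^+` and `(β k)^∨(c (k+1)) > 0`. -/
def IsChain (A : I → I → ℤ) (α : I → V) (coroot : I → (V →ₗ[ℚ] ℚ))
    (lam μ ν : V) (s : ℕ) (c : ℕ → V) (β : ℕ → V)
    (βv : ℕ → (V →ₗ[ℚ] ℚ)) : Prop :=
  c 0 = μ ∧ c s = ν ∧ (∀ k ≤ s, c k ∈ Torbit α coroot lam) ∧
  ∀ k < s, IsWRootPair A α coroot (β k) (βv k) ∧ β k ∈ Qplus α ∧
    0 < βv k (c (k+1)) ∧ c k = c (k+1) - βv k (c (k+1)) • β k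

/-- `μ > ν` in `Tλ`. -/
def ChainGT (A : I → I → ℤ) (α : I → V) (coroot : I → (V →ₗ[ℚ] ℚ))
    (lam μ ν : V) : Prop :=
  ∃ s, 1 ≤ s ∧ ∃ c β βv, IsChain A α coroot lam μ ν s c β βv

/-- `dist(μ, ν) = n`: there is a chain of length `n` from `μ` to `ν` and every chain
has length at most `n`. -/
def distEq (A : I → I → ℤ) (α : I → V) (coroot : I → (V →ₗ[ℚ] ℚ))
    (lam μ ν : V) (n : ℕ) : Prop :=
  (∃ c β βv, IsChain A α coroot lam μ ν n c β βv) ∧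
  ∀ m c β βv, IsChain A α coroot lam μ ν m c β βv → m ≤ n

/-- An `a`-chain for `(μ, ν)`: a chain in which each step is a covering
(`dist = 1`), `a·β_k^∨(ν_k)` is a positive integer for steps along `WΠ_re`,
and `a·β_k^∨(ν_k) = 1` for steps along `WΠ_im`.  The index `ks k` records the simple
root of which `β k` is a `W`-translate. -/
def IsAChain (A : I → I → ℤ) (α : I → V) (coroot : I → (V →ₗ[ℚ] ℚ))
    (lam : V) (a : ℚ) (μ ν : V) (s : ℕ) (c : ℕ → V)
    (β : ℕ → V) (βv : ℕ → (V →ₗ[ℚ] ℚ)) (ks : ℕ → I) : Prop :=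
  1 ≤ s ∧ IsChain A α coroot lam μ ν s c β βv ∧
  ∀ k < s,
    (∃ l, IsWRootPres A α coroot l (ks k) (β k) (βv k)) ∧
    distEq A α coroot lam (c k) (c (k+1)) 1 ∧
    (A (ks k) (ks k) = 2 → ∃ n : ℕ, 0 < n ∧ a * βv k (c (k+1)) = (n : ℚ)) ∧
    (A (ks k) (ks k) ≠ 2 → a * βv k (c (k+1)) = 1)

/-- Existence of an `a`-chain for `(μ, ν)`. -/
def HasAChain (A : I → I → ℤ) (α : I → V) (coroot : I → (V →ₗ[ℚ] ℚ))
    (lam : V) (a : ℚ) (μ ν : V) : Prop :=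
  ∃ s c β βv ks, IsAChain A α coroot lam a μ ν s c β βv ks

/-- The piecewise-linear path attached to GLS data `(λ_1, …, λ_s ; a_0, …, a_s)`
(weights indexed `1, …, s`, breakpoints indexed `0, …, s`):
on `[a_{j-1}, a_j]` it equals `Σ_{k<j} (a_k - a_{k-1}) • λ_k + (t - a_{j-1}) • λ_j`. -/
def glsPath (lamseq : ℕ → V) (a : ℕ → ℚ) (s : ℕ) (t : ℚ) : V :=
  ∑ k ∈ Finset.range s, (max (min t (a (k+1)) - a k) 0) • lamseq (k+1)

/-- The data of a Generalized Lakshmibai–Seshadri path of shape `lam`. -/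
def IsGLS (A : I → I → ℤ) (α : I → V) (coroot : I → (V →ₗ[ℚ] ℚ))
    (lam : V) (s : ℕ) (lamseq : ℕ → V) (a : ℕ → ℚ) : Prop :=
  1 ≤ s ∧ a 0 = 0 ∧ a s = 1 ∧ (∀ k < s, a k < a (k+1)) ∧
  (∀ k, 1 ≤ k → k ≤ s → lamseq k ∈ Torbit α coroot lam) ∧
  (∀ k, 1 ≤ k → k < s →
    HasAChain A α coroot lam (a k) (lamseq k) (lamseq (k+1))) ∧
  (lamseq s = lam ∨ HasAChain A α coroot lam 1 (lamseq s) lam)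

/-- The set `ℙ_λ` of Generalized Lakshmibai–Seshadri paths of shape `lam`,
realized as functions `ℚ → V` via `glsPath`. -/
def GLSset (A : I → I → ℤ) (α : I → V) (coroot : I → (V →ₗ[ℚ] ℚ))
    (lam : V) : Set (ℚ → V) :=
  {π | ∃ s lamseq a, IsGLS A α coroot lam s lamseq a ∧ π = glsPath lamseq a s}

/-- `h_i^π(t) = α_i^∨(π(t))`. -/
def hFun (coroot : I → (V →ₗ[ℚ] ℚ)) (i : I) (π : ℚ → V) (t : ℚ) : ℚ :=
  coroot i (π t)

/-- `m_i^π`, the minimal integer value attained by `h_i^π` on `[0,1]`. -/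
noncomputable def mOf (coroot : I → (V →ₗ[ℚ] ℚ)) (i : I) (π : ℚ → V) : ℤ :=
  sInf {n : ℤ | ∃ t, 0 ≤ t ∧ t ≤ 1 ∧ hFun coroot i π t = (n : ℚ)}

/-- Two paths agree on `[0,1]`. -/
def pathEq (π π' : ℚ → V) : Prop := ∀ t, 0 ≤ t → t ≤ 1 → π t = π' t

/-- `tp = f_+^i(π)`: the largest point of `[0,1]` where `h_i^π` equals `m_i^π`. -/
def IsFPlus (coroot : I → (V →ₗ[ℚ] ℚ)) (i : I) (π : ℚ → V) (tp : ℚ) : Prop :=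
  0 ≤ tp ∧ tp ≤ 1 ∧ hFun coroot i π tp = (mOf coroot i π : ℚ) ∧
  ∀ t, 0 ≤ t → t ≤ 1 → hFun coroot i π t = (mOf coroot i π : ℚ) → t ≤ tp

/-- `tm = f_-^i(π)`: the smallest point of `[tp,1]` where `h_i^π` equals `m_i^π + 1`. -/
def IsFMinus (coroot : I → (V →ₗ[ℚ] ℚ)) (i : I) (π : ℚ → V) (tp tm : ℚ) : Prop :=
  tp ≤ tm ∧ tm ≤ 1 ∧ hFun coroot i π tm = (mOf coroot i π : ℚ) + 1 ∧
  ∀ t, tp ≤ t → t ≤ 1 → hFun coroot i π t = (mOf coroot i π : ℚ) + 1 → tm ≤ t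

/-- The path `f_i π` (for cutting data `tp = f_+^i(π)`, `tm = f_-^i(π)`). -/
def fPath (α : I → V) (coroot : I → (V →ₗ[ℚ] ℚ)) (i : I) (tp tm : ℚ)
    (π : ℚ → V) (t : ℚ) : V :=
  if t ≤ tp then π t
  else if t ≤ tm then π tp + srefl α coroot i (π t - π tp)
  else π t - α i

/-- `π' = f_i π ≠ 0` (equality of paths on `[0,1]`). -/
def FRel (α : I → V) (coroot : I → (V →ₗ[ℚ] ℚ)) (i : I) (π π' : ℚ → V) : Prop :=
  ∃ tp tm, IsFPlus coroot i π tp ∧ tp < 1 ∧ IsFMinus coroot i π tp tm ∧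
    pathEq π' (fPath α coroot i tp tm π)

/-- `tp = e_+^i(π)` (`i` real): smallest point of `[0,1]` where `h_i^π = m_i^π`. -/
def IsEPlusRe (coroot : I → (V →ₗ[ℚ] ℚ)) (i : I) (π : ℚ → V) (tp : ℚ) : Prop :=
  0 ≤ tp ∧ tp ≤ 1 ∧ hFun coroot i π tp = (mOf coroot i π : ℚ) ∧
  ∀ t, 0 ≤ t → t ≤ 1 → hFun coroot i π t = (mOf coroot i π : ℚ) → tp ≤ t

/-- `tm = e_-^i(π)` (`i` real): largest point of `[0,tp]` where `h_i^π = m_i^π + 1`. -/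
def IsEMinusRe (coroot : I → (V →ₗ[ℚ] ℚ)) (i : I) (π : ℚ → V) (tp tm : ℚ) : Prop :=
  0 ≤ tm ∧ tm ≤ tp ∧ hFun coroot i π tm = (mOf coroot i π : ℚ) + 1 ∧
  ∀ t, 0 ≤ t → t ≤ tp → hFun coroot i π t = (mOf coroot i π : ℚ) + 1 → t ≤ tm

/-- The path `e_i π` for `i` real. -/
def ePathRe (α : I → V) (coroot : I → (V →ₗ[ℚ] ℚ)) (i : I) (tm tp : ℚ)
    (π : ℚ → V) (t : ℚ) : V :=
  if t ≤ tm then π t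
  else if t ≤ tp then π tm + srefl α coroot i (π t - π tm)
  else π t + α i

/-- `π' = e_i π ≠ 0` for a real index `i`. -/
def ERelRe (α : I → V) (coroot : I → (V →ₗ[ℚ] ℚ)) (i : I) (π π' : ℚ → V) : Prop :=
  ∃ tp tm, IsEPlusRe coroot i π tp ∧ 0 < tp ∧ IsEMinusRe coroot i π tp tm ∧
    pathEq π' (ePathRe α coroot i tm tp π)

/-- The "inverse reflection" `r_i^{-1} : x ↦ x + (1/(1-a_{ii})) α_i^∨(x) α_i`
for an imaginary index `i`. -/
def rinv (A : I → I → ℤ) (α : I → V) (coroot : I → (V →ₗ[ℚ] ℚ)) (i : I) :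
    Module.End ℚ V :=
  LinearMap.id + (1 / (1 - (A i i : ℚ))) • (coroot i).smulRight (α i)

/-- `tp = e_+^i(π)` (`i` imaginary): smallest point of `[tm,1]` where
`h_i^π = m_i^π + 1 - a_{ii}` (here `tm = e_-^i(π) = f_+^i(π)`). -/
def IsEPlusIm (A : I → I → ℤ) (coroot : I → (V →ₗ[ℚ] ℚ)) (i : I) (π : ℚ → V)
    (tm tp : ℚ) : Prop :=
  tm ≤ tp ∧ tp ≤ 1 ∧
  hFun coroot i π tp = (mOf coroot i π : ℚ) + 1 - (A i i : ℚ) ∧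
  ∀ t, tm ≤ t → t ≤ 1 →
    hFun coroot i π t = (mOf coroot i π : ℚ) + 1 - (A i i : ℚ) → tp ≤ t

/-- The path `e_i π` for `i` imaginary. -/
def ePathIm (A : I → I → ℤ) (α : I → V) (coroot : I → (V →ₗ[ℚ] ℚ)) (i : I)
    (tm tp : ℚ) (π : ℚ → V) (t : ℚ) : V :=
  if t ≤ tm then π t
  else if t ≤ tp then π tm + rinv A α coroot i (π t - π tm)
  else π t + α i

/-- `π' = e_i π ≠ 0` for an imaginary index `i`:  `e_-^i(π) = f_+^i(π) < 1`, the point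
`e_+^i(π)` exists, and `h_i^π` never drops to `m_i^π - a_{ii}` on `[e_+^i(π), 1]`. -/
def ERelIm (A : I → I → ℤ) (α : I → V) (coroot : I → (V →ₗ[ℚ] ℚ)) (i : I)
    (π π' : ℚ → V) : Prop :=
  ∃ tm tp, IsFPlus coroot i π tm ∧ tm < 1 ∧ IsEPlusIm A coroot i π tm tp ∧
    (∀ t, tp ≤ t → t ≤ 1 →
      (mOf coroot i π : ℚ) - (A i i : ℚ) < hFun coroot i π t) ∧
    pathEq π' (ePathIm A α coroot i tm tp π)

/-- `π' = e_i π ≠ 0`. -/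
def ERel (A : I → I → ℤ) (α : I → V) (coroot : I → (V →ₗ[ℚ] ℚ)) (i : I)
    (π π' : ℚ → V) : Prop :=
  (A i i = 2 ∧ ERelRe α coroot i π π') ∨ (A i i ≠ 2 ∧ ERelIm A α coroot i π π')

/-- `π' = f_{i_1} ⋯ f_{i_k} π ≠ 0` for a list `[i_1, …, i_k]` (rightmost acts first). -/
def FMonRel (α : I → V) (coroot : I → (V →ₗ[ℚ] ℚ)) :
    List I → (ℚ → V) → (ℚ → V) → Prop
  | [], π, π' => pathEq π π'
  | i :: l, π, π' => ∃ πm, FMonRel α coroot l π πm ∧ FRel α coroot i πm π'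

/-- A generalized crystal for the Borcherds–Cartan datum `(A, α, coroot)`. -/
structure GenCrystal (A : I → I → ℤ) (α : I → V)
    (coroot : I → (V →ₗ[ℚ] ℚ)) where
  B : Type*
  wt : B → V
  wt_int : ∀ (i : I) (b : B), ∃ n : ℤ, coroot i (wt b) = (n : ℚ)
  eps : I → B → WithBot ℤ
  phi : I → B → WithBot ℤ
  e : I → B → Option B
  f : I → B → Option B
  phi_eq : ∀ (i : I) (b : B) (n : ℤ), (n : ℚ) = coroot i (wt b) →
    phi i b = eps i b + (n : WithBot ℤ)
  wt_e : ∀ (i : I) (b b' : B), e i b = some b' → wt b' = wt b + α i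
  eps_e_re : ∀ (i : I) (b b' : B), A i i = 2 → e i b = some b' →
    eps i b' = eps i b + ((-1 : ℤ) : WithBot ℤ)
  eps_e_im : ∀ (i : I) (b b' : B), A i i ≠ 2 → e i b = some b' →
    eps i b' = eps i b
  e_iff_f : ∀ (i : I) (b b' : B), e i b = some b' ↔ f i b' = some b
  phi_bot : ∀ (i : I) (b : B), phi i b = ⊥ → e i b = none ∧ f i b = none
  eps_im : ∀ (i : I) (b : B), A i i ≠ 2 → eps i b ≤ 0
  phi_im : ∀ (i : I) (b : B), A i i ≠ 2 → phi i b = ⊥ ∨ 0 ≤ phi i b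

/-- Finite "orthogonal" subsets of the imaginary simple roots, encoded by their
index sets: `F ∈ 𝒫(Π_im)`. -/
def PImSet (A : I → I → ℤ) (F : Finset I) : Prop :=
  (∀ i ∈ F, A i i ≠ 2) ∧ ∀ i ∈ F, ∀ j ∈ F, i ≠ j → A i j = 0

end GKM

namespace GKM

/-- A Borcherds–Cartan datum with linearly independent simple roots. -/
structure Datum (I V : Type*) [AddCommGroup V] [Module ℚ V] where
  A : I → I → ℤ
  α : I → V
  cr : I → (V →ₗ[ℚ] ℚ)
  hind : LinearIndependent ℚ α
  hpair : ∀ i j, cr i (α j) = (A i j : ℚ)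
  hdiag : ∀ i, A i i = 2 ∨ A i i ≤ 0
  hoff : ∀ i j, i ≠ j → A i j ≤ 0
  hzero : ∀ i j, A i j = 0 ↔ A j i = 0

namespace Datum

variable {I V : Type*} [AddCommGroup V] [Module ℚ V] (D : Datum I V)

/-- The simple reflection `r_i`. -/
abbrev r (i : I) : Module.End ℚ V := srefl D.α D.cr i

/-- The endomorphism attached to a word. -/
def wd (l : List I) : Module.End ℚ V := (l.map (srefl D.α D.cr)).prod

/-- The dual endomorphism attached to a word. -/
def cw (l : List I) : Module.End ℚ (V →ₗ[ℚ] ℚ) := (l.map (crefl D.α D.cr)).prod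

/-- All letters of the word are real. -/
def RW (l : List I) : Prop := ∀ m ∈ l, D.A m m = 2

lemma r_apply (i : I) (x : V) : D.r i x = x - D.cr i x • D.α i := by
  simp [r, srefl]

lemma crefl_apply (i : I) (h : V →ₗ[ℚ] ℚ) :
    crefl D.α D.cr i h = h - h (D.α i) • D.cr i := by
  simp [crefl]

lemma crefl_apply_apply (i : I) (h : V →ₗ[ℚ] ℚ) (x : V) :
    crefl D.α D.cr i h x = h (D.r i x) := by
  simp [crefl_apply, r_apply, mul_comm]

@[simp] lemma wd_nil : D.wd [] = 1 := rfl
lemma wd_cons (i : I) (l : List I) : D.wd (i :: l) = D.r i * D.wd l := by simp [wd]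
lemma cw_cons (i : I) (l : List I) : D.cw (i :: l) = crefl D.α D.cr i * D.cw l := by simp [cw]
lemma wd_append (l l' : List I) : D.wd (l ++ l') = D.wd l * D.wd l' := by simp [wd]
lemma cw_append (l l' : List I) : D.cw (l ++ l') = D.cw l * D.cw l' := by simp [cw]
lemma wd_singleton (i : I) : D.wd [i] = D.r i := by simp [wd]

lemma cw_apply (l : List I) (h : V →ₗ[ℚ] ℚ) (x : V) :
    D.cw l h x = h (D.wd l.reverse x) := by
  induction l generalizing x with
  | nil => simp [cw]
  | cons i l ih =>
    rw [cw_cons, Module.End.mul_apply, crefl_apply_apply, ih, List.reverse_cons, wd_append,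
      wd_singleton]
    rfl

lemma r_r {i : I} (hi : D.A i i = 2) (x : V) : D.r i (D.r i x) = x := by
  simp only [r_apply, map_sub, map_smul, D.hpair, hi]
  module

lemma r_mul_r {i : I} (hi : D.A i i = 2) : D.r i * D.r i = 1 := by
  ext x; exact D.r_r hi x

lemma cr_r {i : I} (hi : D.A i i = 2) (x : V) : D.cr i (D.r i x) = - D.cr i x := by
  simp only [r_apply, map_sub, map_smul, D.hpair, hi]
  simp; ring

lemma r_α {i : I} (hi : D.A i i = 2) : D.r i (D.α i) = - D.α i := by
  simp only [r_apply, D.hpair, hi]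
  push_cast; module

lemma RW.append {D : Datum I V} {l l' : List I} (h : D.RW l) (h' : D.RW l') : D.RW (l ++ l') := by
  intro m hm
  rcases List.mem_append.1 hm with hm | hm
  exacts [h m hm, h' m hm]

lemma RW.left {D : Datum I V} {l l' : List I} (h : D.RW (l ++ l')) : D.RW l :=
  fun m hm => h m (List.mem_append_left _ hm)

lemma RW.right {D : Datum I V} {l l' : List I} (h : D.RW (l ++ l')) : D.RW l' :=
  fun m hm => h m (List.mem_append_right _ hm)

lemma RW.cons {D : Datum I V} {i : I} {l : List I} (hi : D.A i i = 2) (h : D.RW l) :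
    D.RW (i :: l) := by
  intro m hm
  rcases List.mem_cons.1 hm with rfl | hm
  exacts [hi, h m hm]

lemma RW.head {D : Datum I V} {i : I} {l : List I} (h : D.RW (i :: l)) : D.A i i = 2 :=
  h i (by simp)

lemma RW.tail {D : Datum I V} {i : I} {l : List I} (h : D.RW (i :: l)) : D.RW l :=
  fun m hm => h m (List.mem_cons_of_mem _ hm)

lemma RW.reverse {D : Datum I V} {l : List I} (h : D.RW l) : D.RW l.reverse :=
  fun m hm => h m (List.mem_reverse.1 hm)

lemma RW.nil {D : Datum I V} : D.RW [] := by intro m hm; simp at hm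

lemma RW.singleton {D : Datum I V} {i : I} (hi : D.A i i = 2) : D.RW [i] :=
  RW.cons hi RW.nil

lemma wd_reverse_mul {l : List I} (h : D.RW l) : D.wd l.reverse * D.wd l = 1 := by
  induction l with
  | nil => simp
  | cons i l ih =>
    rw [List.reverse_cons, wd_append, wd_singleton, wd_cons, mul_assoc, ← mul_assoc (D.r i),
      D.r_mul_r h.head, one_mul, ih h.tail]

lemma wd_mul_reverse {l : List I} (h : D.RW l) : D.wd l * D.wd l.reverse = 1 := by
  simpa using D.wd_reverse_mul h.reverse

lemma wd_reverse_apply {l : List I} (h : D.RW l) (x : V) : D.wd l.reverse (D.wd l x) = x :=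
  congrArg (fun f : Module.End ℚ V => f x) (D.wd_reverse_mul h)

lemma wd_apply_reverse {l : List I} (h : D.RW l) (x : V) : D.wd l (D.wd l.reverse x) = x :=
  congrArg (fun f : Module.End ℚ V => f x) (D.wd_mul_reverse h)

lemma wd_injective {l : List I} (h : D.RW l) : Function.Injective (D.wd l) :=
  Function.LeftInverse.injective (D.wd_reverse_apply h)

lemma cw_eq_of_wd_eq {l l' : List I} (h : D.RW l) (h' : D.RW l') (e : D.wd l = D.wd l') :
    D.cw l = D.cw l' := by
  have : D.wd l.reverse = D.wd l'.reverse := by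
    calc D.wd l.reverse = D.wd l.reverse * (D.wd l' * D.wd l'.reverse) := by
          rw [D.wd_mul_reverse h', mul_one]
      _ = D.wd l'.reverse := by rw [← mul_assoc, ← e, D.wd_reverse_mul h, one_mul]
  ext f x
  simp [cw_apply, this]

/-- `ℕ`-combination of simple roots. -/
noncomputable def rs (c : I →₀ ℕ) : V := c.sum fun i n => (n : ℚ) • D.α i

/-- `ℕ`-combination of simple coroots. -/
noncomputable def cs (c : I →₀ ℕ) : V →ₗ[ℚ] ℚ := c.sum fun i n => (n : ℚ) • D.cr i

lemma rs_add (c d : I →₀ ℕ) : D.rs (c + d) = D.rs c + D.rs d := by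
  classical
  unfold rs
  rw [Finsupp.sum_add_index'] <;> intros <;> simp [add_smul]

lemma cs_add (c d : I →₀ ℕ) : D.cs (c + d) = D.cs c + D.cs d := by
  classical
  unfold cs
  rw [Finsupp.sum_add_index'] <;> intros <;> simp [add_smul]

@[simp] lemma rs_zero : D.rs 0 = 0 := by simp [rs]
@[simp] lemma cs_zero : D.cs 0 = 0 := by simp [cs]
@[simp] lemma rs_single (i : I) (n : ℕ) : D.rs (Finsupp.single i n) = (n : ℚ) • D.α i := by
  simp [rs]
@[simp] lemma cs_single (i : I) (n : ℕ) : D.cs (Finsupp.single i n) = (n : ℚ) • D.cr i := by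
  simp [cs]

lemma rs_nsmul (n : ℕ) (c : I →₀ ℕ) : D.rs (n • c) = (n : ℚ) • D.rs c := by
  induction n with
  | zero => simp
  | succ n ih => rw [add_smul, one_smul, rs_add, ih]; push_cast; rw [add_smul, one_smul]

lemma cs_nsmul (n : ℕ) (c : I →₀ ℕ) : D.cs (n • c) = (n : ℚ) • D.cs c := by
  induction n with
  | zero => simp
  | succ n ih => rw [add_smul, one_smul, cs_add, ih]; push_cast; rw [add_smul, one_smul]

/-- A linear coordinate map for the simple roots. -/
lemma exists_crd : ∃ f : V →ₗ[ℚ] (I →₀ ℚ), ∀ i, f (D.α i) = Finsupp.single i 1 := by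
  obtain ⟨g, hg⟩ := LinearMap.exists_leftInverse_of_injective
    (Finsupp.linearCombination ℚ D.α) (LinearMap.ker_eq_bot.2 D.hind)
  refine ⟨g, fun i => ?_⟩
  have := congrArg (fun f => f (Finsupp.single i 1)) hg
  simpa using this

/-- Coordinates with respect to the simple roots (extended arbitrarily to `V`). -/
noncomputable def crd : V →ₗ[ℚ] (I →₀ ℚ) := D.exists_crd.choose

open Classical in
@[simp] lemma crd_α (i l : I) : D.crd (D.α i) l = if i = l then 1 else 0 := by
  rw [crd, D.exists_crd.choose_spec i, Finsupp.single_apply]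

open Classical in
lemma crd_α_self (i : I) : D.crd (D.α i) i = 1 := by simp

lemma crd_α_ne {i l : I} (h : i ≠ l) : D.crd (D.α i) l = 0 := by simp [h]

@[simp] lemma crd_rs (c : I →₀ ℕ) (l : I) : D.crd (D.rs c) l = c l := by
  classical
  induction c using Finsupp.induction_linear with
  | zero => simp
  | add f g hf hg => rw [rs_add, map_add, Finsupp.add_apply, hf, hg]; simp
  | single i n => by_cases h : i = l <;> simp [h]

lemma rs_injective : Function.Injective D.rs := by
  intro c d h
  ext l
  have := D.crd_rs c l
  rw [h, crd_rs] at this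
  exact_mod_cast this.symm

/-- `β` and `β^∨` are nonnegative integral combinations with the same support. -/
def Pos (β : V) (βv : V →ₗ[ℚ] ℚ) : Prop :=
  ∃ c c' : I →₀ ℕ, β = D.rs c ∧ βv = D.cs c' ∧ ∀ l, c l = 0 ↔ c' l = 0

lemma Pos.add {D : Datum I V} {β γ : V} {βv γv : V →ₗ[ℚ] ℚ} (h : D.Pos β βv) (h' : D.Pos γ γv) :
    D.Pos (β + γ) (βv + γv) := by
  obtain ⟨c, c', rfl, rfl, hc⟩ := h
  obtain ⟨d, d', rfl, rfl, hd⟩ := h'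
  refine ⟨c + d, c' + d', (D.rs_add _ _).symm, (D.cs_add _ _).symm, fun l => ?_⟩
  simp [hc, hd]

lemma Pos.smul {D : Datum I V} {β : V} {βv : V →ₗ[ℚ] ℚ} (h : D.Pos β βv) {x x' : ℕ}
    (hx : x = 0 ↔ x' = 0) : D.Pos ((x : ℚ) • β) ((x' : ℚ) • βv) := by
  obtain ⟨c, c', rfl, rfl, hc⟩ := h
  refine ⟨x • c, x' • c', (D.rs_nsmul _ _).symm, (D.cs_nsmul _ _).symm, fun l => ?_⟩
  simp [hc, hx]

lemma pos_simple (i : I) : D.Pos (D.α i) (D.cr i) :=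
  ⟨Finsupp.single i 1, Finsupp.single i 1, by simp, by simp, fun l => Iff.rfl⟩

end Datum
end GKM

namespace GKM
namespace Datum

variable {I V : Type*} [AddCommGroup V] [Module ℚ V] (D : Datum I V)

/-- The alternating word of length `k` in `i, j` whose last letter is `j`. -/
def alt (i j : I) : ℕ → List I
  | 0 => []
  | k + 1 => (if k % 2 = 0 then j else i) :: alt i j k

lemma alt_length (i j : I) (k : ℕ) : (alt i j k).length = k := by
  induction k with
  | zero => rfl
  | succ k ih => simp [alt, ih]

lemma alt_append (i j : I) (k m : ℕ) :
    ∃ l, alt i j (m + k) = l ++ alt i j m := by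
  induction k with
  | zero => exact ⟨[], rfl⟩
  | succ k ih =>
    obtain ⟨l, hl⟩ := ih
    exact ⟨(if (m + k) % 2 = 0 then j else i) :: l, by
      rw [← add_assoc, alt, hl, List.cons_append]⟩

/-- Normalised coefficients of the images of `α_i` under alternating words. -/
def xs (c : ℤ) : ℕ → ℤ × ℤ
  | 0 => (1, 0)
  | k + 1 => if k % 2 = 0 then ((xs c k).1, (xs c k).1 - (xs c k).2)
    else (c * (xs c k).2 - (xs c k).1, (xs c k).2)

lemma xs_large {c : ℤ} (hc : 4 ≤ c) (k : ℕ) :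
    0 ≤ (xs c k).1 ∧ 0 ≤ (xs c k).2 ∧ (k % 2 = 0 → 2 * (xs c k).2 ≤ (xs c k).1) ∧
      (k % 2 = 1 → (xs c k).1 ≤ 2 * (xs c k).2) := by
  induction k with
  | zero => simp [xs]
  | succ k ih =>
    obtain ⟨h1, h2, h3, h4⟩ := ih
    rcases Nat.mod_two_eq_zero_or_one k with hk | hk
    · have := h3 hk
      simp only [xs, hk, if_true]
      refine ⟨h1, by linarith, fun h => by omega, fun _ => by linarith⟩
    · have := h4 hk
      simp only [xs, hk]
      simp only [one_ne_zero, if_false]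
      have : 4 * (xs c k).2 ≤ c * (xs c k).2 := mul_le_mul_of_nonneg_right hc h2
      refine ⟨by linarith, h2, fun _ => by linarith, fun h => by omega⟩

/-- The order of the rotation `r_i r_j` when `a_ij a_ji = c < 4`. -/
def braidOrder (c : ℤ) : ℕ := if c = 0 then 2 else if c = 1 then 3 else if c = 2 then 4 else 6

lemma xs_small {c : ℤ} (h0 : 0 ≤ c) (hc : c < 4) {k : ℕ} (hk : k < braidOrder c) :
    0 ≤ (xs c k).1 ∧ 0 ≤ (xs c k).2 := by
  interval_cases c <;> simp [braidOrder] at hk <;> interval_cases k <;> simp [xs]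

variable {i j : I}

lemma wd_alt_α (hi : D.A i i = 2) (hj : D.A j j = 2) (k : ℕ) :
    D.wd (alt i j k) (D.α i) = ((xs (D.A i j * D.A j i) k).1 : ℚ) • D.α i +
      (-(D.A j i : ℚ) * (xs (D.A i j * D.A j i) k).2) • D.α j := by
  induction k with
  | zero => simp [alt, xs]
  | succ k ih =>
    rw [alt, wd_cons, Module.End.mul_apply, ih]
    rcases Nat.mod_two_eq_zero_or_one k with hk | hk
    · simp only [xs, hk, if_true, r_apply, map_add, map_smul, D.hpair, hj]
      push_cast; module
    · simp only [xs, hk, one_ne_zero, if_false, r_apply, map_add, map_smul, D.hpair, hi]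
      push_cast; module

lemma cw_alt_cr (hi : D.A i i = 2) (hj : D.A j j = 2) (k : ℕ) :
    D.cw (alt i j k) (D.cr i) = ((xs (D.A i j * D.A j i) k).1 : ℚ) • D.cr i +
      (-(D.A i j : ℚ) * (xs (D.A i j * D.A j i) k).2) • D.cr j := by
  induction k with
  | zero => simp [alt, xs, cw]
  | succ k ih =>
    rw [alt, cw_cons, Module.End.mul_apply, ih]
    rcases Nat.mod_two_eq_zero_or_one k with hk | hk
    · simp only [xs, hk, if_true, crefl_apply, LinearMap.add_apply, LinearMap.smul_apply, D.hpair,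
        hj, smul_eq_mul]
      push_cast; module
    · simp only [xs, hk, one_ne_zero, if_false, crefl_apply, LinearMap.add_apply,
        LinearMap.smul_apply, D.hpair, hi, smul_eq_mul]
      push_cast; module

lemma braid_cases {a b : ℤ} (ha : a ≤ 0) (hb : b ≤ 0) (hab : a = 0 ↔ b = 0) (h : a * b < 4) :
    (a = 0 ∧ b = 0) ∨ (a = -1 ∧ b = -1) ∨ (a = -1 ∧ b = -2) ∨ (a = -2 ∧ b = -1) ∨
      (a = -1 ∧ b = -3) ∨ (a = -3 ∧ b = -1) := by
  by_cases h0 : a = 0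
  · exact Or.inl ⟨h0, hab.1 h0⟩
  have hb0 : b ≠ 0 := fun h => h0 (hab.2 h)
  have ha1 : a ≤ -1 := by omega
  have hb1 : b ≤ -1 := by omega
  have ha3 : -3 ≤ a := by nlinarith
  have hb3 : -3 ≤ b := by nlinarith
  interval_cases a <;> interval_cases b <;> simp_all

lemma braid (hij : i ≠ j) (hi : D.A i i = 2) (hj : D.A j j = 2) (hc : D.A i j * D.A j i < 4) :
    D.wd (alt i j (braidOrder (D.A i j * D.A j i))) =
      D.wd (alt j i (braidOrder (D.A i j * D.A j i))) := by
  ext x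
  rcases braid_cases (D.hoff i j hij) (D.hoff j i hij.symm) (D.hzero i j) hc with
    ⟨h1, h2⟩ | ⟨h1, h2⟩ | ⟨h1, h2⟩ | ⟨h1, h2⟩ | ⟨h1, h2⟩ | ⟨h1, h2⟩
  all_goals
    simp only [h1, h2]
    norm_num [braidOrder, alt, wd_cons]
    simp only [r_apply, map_sub, map_smul, D.hpair, hi, hj, h1, h2]
    push_cast
    module

end Datum
end GKM

namespace GKM
namespace Datum

variable {I V : Type*} [AddCommGroup V] [Module ℚ V] (D : Datum I V) {i j : I}

/-- The word only uses the letters `i` and `j`. -/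
def Two (i j : I) (l : List I) : Prop := ∀ m ∈ l, m = i ∨ m = j

lemma Two.rw {D : Datum I V} (hi : D.A i i = 2) (hj : D.A j j = 2) {l : List I} (h : Two i j l) :
    D.RW l := by
  intro m hm
  rcases h m hm with rfl | rfl <;> assumption

lemma two_alt (i j : I) (k : ℕ) : Two i j (alt i j k) := by
  induction k with
  | zero => intro m hm; simp [alt] at hm
  | succ k ih =>
    intro m hm
    rcases List.mem_cons.1 hm with rfl | hm
    · split_ifs <;> simp
    · exact ih m hm

lemma two_alt' (i j : I) (k : ℕ) : Two i j (alt j i k) := fun m hm => (two_alt j i k m hm).symm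

lemma Two.append {l l' : List I} (h : Two i j l) (h' : Two i j l') : Two i j (l ++ l') := by
  intro m hm
  rcases List.mem_append.1 hm with hm | hm
  exacts [h m hm, h' m hm]

lemma eq_alt (hi : D.A i i = 2) (hj : D.A j j = 2) (u : List I) (hu : Two i j u)
    (h1 : ∀ u', Two i j u' → D.wd u' = D.wd u → u.length ≤ u'.length)
    (h2 : ∀ u', Two i j u' → D.wd u' = D.wd (u ++ [i]) → u.length ≤ u'.length) :
    u = alt i j u.length := by
  induction u with
  | nil => rfl
  | cons x t ih =>
    have hx := hu x (by simp)
    have ht : Two i j t := fun m hm => hu m (List.mem_cons_of_mem _ hm)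
    have hxx : Two i j [x] := by intro m hm; simp at hm; rw [hm]; exact hx
    have hxr : D.A x x = 2 := by rcases hx with rfl | rfl <;> assumption
    have iht := ih ht
      (fun u' hu' e => by
        have := h1 (x :: u') (hxx.append hu') (by rw [wd_cons, wd_cons, e])
        simpa using this)
      (fun u' hu' e => by
        have := h2 (x :: u') (hxx.append hu') (by rw [wd_cons, List.cons_append, wd_cons, e])
        simpa using this)
    rw [List.length_cons, alt, ← iht]
    congr 1
    cases t with
    | nil =>
      rcases hx with rfl | rfl
      · have := h2 [] (by intro m hm; simp at hm) (by simp [wd_cons, D.r_mul_r hi])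
        simp at this
      · simp
    | cons y t =>
      have hy : x ≠ y := by
        rintro rfl
        have := h1 t (fun m hm => ht m (List.mem_cons_of_mem _ hm))
          (by rw [wd_cons, wd_cons, ← mul_assoc, D.r_mul_r hxr, one_mul])
        simp at this
      rw [List.length_cons, alt] at iht
      have hy' := (List.cons.inj iht).1
      rw [List.length_cons]
      rcases Nat.mod_two_eq_zero_or_one t.length with h | h
      · rw [h] at hy'
        have : (t.length + 1) % 2 = 1 := by omega
        simp only [this, one_ne_zero, if_false, if_true] at hy' ⊢
        rcases hx with hx | hx
        · exact hx
        · exact absurd (hx.trans hy'.symm) hy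
      · rw [h] at hy'
        have : (t.length + 1) % 2 = 0 := by omega
        simp only [this, one_ne_zero, if_false, if_true] at hy' ⊢
        rcases hx with hx | hx
        · exact absurd (hx.trans hy'.symm) hy
        · exact hx

lemma rank_two (hij : i ≠ j) (hi : D.A i i = 2) (hj : D.A j j = 2) (u : List I) (hu : Two i j u)
    (h1 : ∀ u', Two i j u' → D.wd u' = D.wd u → u.length ≤ u'.length)
    (h2 : ∀ u', Two i j u' → D.wd u' = D.wd (u ++ [i]) → u.length ≤ u'.length) :
    ∃ x y x' y' : ℕ, D.wd u (D.α i) = (x : ℚ) • D.α i + (y : ℚ) • D.α j ∧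
      D.cw u (D.cr i) = (x' : ℚ) • D.cr i + (y' : ℚ) • D.cr j ∧
      (x = 0 ↔ x' = 0) ∧ (y = 0 ↔ y' = 0) := by
  have hu' := D.eq_alt hi hj u hu h1 h2
  set k := u.length with hk
  set c := D.A i j * D.A j i with hc
  have ha := D.hoff i j hij
  have hb := D.hoff j i hij.symm
  have hc0 : 0 ≤ c := mul_nonneg_of_nonpos_of_nonpos ha hb
  have key : 0 ≤ (xs c k).1 ∧ 0 ≤ (xs c k).2 := by
    rcases lt_or_ge c 4 with h4 | h4
    · refine xs_small hc0 h4 ?_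
      by_contra! hm
      obtain ⟨p, hp⟩ := alt_append i j (k - braidOrder c) (braidOrder c)
      rw [Nat.add_sub_cancel' hm] at hp
      have hpos : 0 < braidOrder c := by unfold braidOrder; split_ifs <;> norm_num
      obtain ⟨m, hm'⟩ : ∃ m, braidOrder c = m + 1 := ⟨_, (Nat.succ_pred_eq_of_pos hpos).symm⟩
      have hlast : ∃ q, alt j i (m + 1) = q ++ [i] ∧ q.length = m := by
        obtain ⟨q, hq⟩ := alt_append j i m 1
        refine ⟨q, ?_, ?_⟩
        · rw [add_comm m 1, hq]; rfl
        · have := congrArg List.length hq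
          rw [List.length_append, alt_length, alt_length] at this
          omega
      obtain ⟨q, hq, hql⟩ := hlast
      have hpT : Two i j p := fun m hm => hu m (by rw [hu', hp]; exact List.mem_append_left _ hm)
      have hqT : Two i j q := fun x hx =>
        two_alt' i j (m + 1) x (by rw [hq]; exact List.mem_append_left _ hx)
      have := h2 (p ++ q) (hpT.append hqT) (by
        rw [hu', hp, wd_append, wd_append, wd_append, D.braid hij hi hj h4, hm', hq, wd_append,
          wd_singleton, mul_assoc, mul_assoc, D.r_mul_r hi, mul_one])
      have e := congrArg List.length hp
      rw [alt_length, List.length_append, alt_length] at e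
      rw [List.length_append] at this
      omega
    · exact ⟨(xs_large h4 k).1, (xs_large h4 k).2.1⟩
  obtain ⟨kx, ks⟩ := key
  obtain ⟨X, hX⟩ := Int.eq_ofNat_of_zero_le kx
  obtain ⟨S, hS⟩ := Int.eq_ofNat_of_zero_le ks
  obtain ⟨p, hp⟩ := Int.eq_ofNat_of_zero_le (neg_nonneg.2 ha)
  obtain ⟨q, hq⟩ := Int.eq_ofNat_of_zero_le (neg_nonneg.2 hb)
  refine ⟨X, q * S, X, p * S, ?_, ?_, Iff.rfl, ?_⟩
  · rw [hu', D.wd_alt_α hi hj, ← hc, hX, hS]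
    have : -(D.A j i : ℚ) = q := by exact_mod_cast hq
    rw [this]; push_cast; rfl
  · rw [hu', D.cw_alt_cr hi hj, ← hc, hX, hS]
    have : -(D.A i j : ℚ) = p := by exact_mod_cast hp
    rw [this]; push_cast; rfl
  · have : p = 0 ↔ q = 0 := by
      have := D.hzero i j
      omega
    simp [this]

/-- A reduced real word. -/
def Red (l : List I) : Prop := D.RW l ∧ ∀ l', D.RW l' → D.wd l' = D.wd l → l.length ≤ l'.length

lemma exists_red {l : List I} (hl : D.RW l) : ∃ l', D.Red l' ∧ D.wd l' = D.wd l := by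
  classical
  have hex : ∃ n, ∃ l', D.RW l' ∧ D.wd l' = D.wd l ∧ l'.length = n := ⟨_, l, hl, rfl, rfl⟩
  obtain ⟨l', h1, h2, h3⟩ := Nat.find_spec hex
  refine ⟨l', ⟨h1, fun l'' h e => ?_⟩, h2⟩
  rw [h3]
  exact Nat.find_min' hex ⟨l'', h, e.trans h2, rfl⟩

lemma pos_of_ascent (n : ℕ) : ∀ (l : List I), l.length = n → D.Red l → ∀ i, D.A i i = 2 →
    (∀ l', D.RW l' → D.wd l' = D.wd (l ++ [i]) → l.length ≤ l'.length) →
    D.Pos (D.wd l (D.α i)) (D.cw l (D.cr i)) := by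
  classical
  induction n using Nat.strong_induction_on with
  | _ n ih =>
  intro l hn hl i hi hasc
  rcases List.eq_nil_or_concat' l with rfl | ⟨l0, j, rfl⟩
  · exact D.pos_simple i
  have hj : D.A j j = 2 := hl.1 j (by simp)
  have hij : i ≠ j := by
    rintro rfl
    have := hasc l0 hl.1.left (by
      rw [wd_append, wd_append, wd_singleton, mul_assoc, D.r_mul_r hi, mul_one])
    simp at this
  have hex : ∃ m, ∃ v u, D.RW v ∧ Two i j u ∧ D.wd (v ++ u) = D.wd (l0 ++ [j]) ∧
      v.length + u.length = n ∧ v.length = m :=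
    ⟨_, l0, [j], hl.1.left, by intro m hm; simp at hm; exact Or.inr hm, rfl, by simpa using hn, rfl⟩
  obtain ⟨v, u, hv, hu, hvu, hlen, hvm⟩ := Nat.find_spec hex
  have hmin : ∀ v u, D.RW v → Two i j u → D.wd (v ++ u) = D.wd (l0 ++ [j]) →
      v.length + u.length = n → Nat.find hex ≤ v.length := fun v u h1 h2 h3 h4 =>
    Nat.find_min' hex ⟨v, u, h1, h2, h3, h4, rfl⟩
  have hvn : v.length < n := by
    have := hmin l0 [j] hl.1.left (by intro m hm; simp at hm; exact Or.inr hm) rfl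
      (by simpa using hn)
    simp at hn
    omega
  have hur : D.RW u := hu.rw hi hj
  have hvred : D.Red v := by
    refine ⟨hv, fun v' hv' e => ?_⟩
    have := hl.2 (v' ++ u) (hv'.append hur) (by rw [← hvu, wd_append, wd_append, e])
    rw [hn, List.length_append] at this
    omega
  have hvasc : ∀ x, x = i ∨ x = j → D.A x x = 2 →
      ∀ l', D.RW l' → D.wd l' = D.wd (v ++ [x]) → v.length ≤ l'.length := by
    intro x hx hxr v' hv' e
    by_contra! hlt
    have hT : Two i j (x :: u) := by
      intro m hm
      rcases List.mem_cons.1 hm with rfl | hm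
      exacts [hx, hu m hm]
    have e2 : D.wd (v' ++ x :: u) = D.wd (l0 ++ [j]) := by
      rw [← hvu, wd_append, e, wd_append, wd_singleton, wd_cons, wd_append, mul_assoc,
        ← mul_assoc (D.r x), D.r_mul_r hxr, one_mul]
    have h5 := hl.2 (v' ++ x :: u) (hv'.append (RW.cons hxr hur)) e2
    rw [hn, List.length_append, List.length_cons] at h5
    have := hmin v' (x :: u) hv' hT e2 (by rw [List.length_cons]; omega)
    omega
  have P1 := ih v.length hvn v rfl hvred i hi (hvasc i (Or.inl rfl) hi)
  have P2 := ih v.length hvn v rfl hvred j hj (hvasc j (Or.inr rfl) hj)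
  obtain ⟨x, y, x', y', e1, e2, hx, hy⟩ := D.rank_two hij hi hj u hu
    (fun u' hu' e => by
      have := hl.2 (v ++ u') (hv.append (hu'.rw hi hj)) (by rw [← hvu, wd_append, wd_append, e])
      rw [hn, List.length_append] at this
      omega)
    (fun u' hu' e => by
      have := hasc (v ++ u') (hv.append (hu'.rw hi hj)) (by
        rw [wd_append _ (l0 ++ [j]), ← hvu, wd_append, wd_append, e, wd_append, mul_assoc])
      rw [hn, List.length_append] at this
      omega)
  have hcw : D.cw (l0 ++ [j]) = D.cw v * D.cw u := by
    rw [← cw_append]; exact D.cw_eq_of_wd_eq hl.1 (hv.append hur) hvu.symm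
  rw [← hvu, wd_append, hcw, Module.End.mul_apply, Module.End.mul_apply, e1, e2, map_add, map_add,
    map_smul, map_smul, map_smul, map_smul]
  exact (P1.smul hx).add (P2.smul hy)

/-- A real root is positive or negative. -/
lemma pos_or_neg {l : List I} (hl : D.RW l) {i : I} (hi : D.A i i = 2) :
    D.Pos (D.wd l (D.α i)) (D.cw l (D.cr i)) ∨
      D.Pos (-D.wd l (D.α i)) (-D.cw l (D.cr i)) := by
  obtain ⟨l1, hl1, e1⟩ := D.exists_red hl
  obtain ⟨l2, hl2, e2⟩ := D.exists_red (hl1.1.append (RW.singleton hi))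
  have e1' := D.cw_eq_of_wd_eq hl1.1 hl e1
  by_cases h : l1.length ≤ l2.length
  · left
    rw [← e1, ← e1']
    exact D.pos_of_ascent _ l1 rfl hl1 i hi fun l' h1 h2 => h.trans (hl2.2 l' h1 (h2.trans e2.symm))
  · right
    have e2' := D.cw_eq_of_wd_eq hl2.1 (hl1.1.append (RW.singleton hi)) e2
    have := D.pos_of_ascent _ l2 rfl hl2 i hi fun l' h1 h2 => by
      have h3 := hl1.2 l' h1 (by
        rw [h2, wd_append, e2, wd_append, wd_singleton, mul_assoc, D.r_mul_r hi, mul_one])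
      omega
    rw [e2, e2', wd_append, cw_append, Module.End.mul_apply, Module.End.mul_apply, wd_singleton,
      D.r_α hi, map_neg, e1, e1'] at this
    convert this using 1
    simp only [cw, List.map_cons, List.map_nil, List.prod_cons, List.prod_nil, mul_one]
    rw [crefl_apply, D.hpair, hi, ← map_neg]
    congr 1
    push_cast; module

lemma Pos.ne_zero_of_neg {D : Datum I V} {β : V} {βv γv : V →ₗ[ℚ] ℚ} (h : D.Pos β βv)
    (h' : D.Pos (-β) γv) : β = 0 := by
  obtain ⟨c, c', h1, -, -⟩ := h
  obtain ⟨d, d', h2, -, -⟩ := h'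
  have : D.rs (c + d) = D.rs 0 := by rw [rs_add, ← h1, ← h2, rs_zero, add_neg_cancel]
  have := D.rs_injective this
  have hc : c = 0 := by
    ext l
    have := DFunLike.congr_fun this l
    simp at this
    simpa using this.1
  rw [h1, hc, rs_zero]

lemma α_ne_zero (i : I) : D.α i ≠ 0 := D.hind.ne_zero i

lemma red_length_append {l l' : List I} (hl : D.Red l) (hl' : D.Red l') {i : I} (hi : D.A i i = 2)
    (e : D.wd l' = D.wd (l ++ [i])) : l'.length = l.length + 1 ∨ l.length = l'.length + 1 := by
  have h1 : l'.length ≤ l.length + 1 := by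
    simpa using hl'.2 (l ++ [i]) (hl.1.append (RW.singleton hi)) e.symm
  have e' : D.wd l = D.wd (l' ++ [i]) := by
    rw [wd_append, e, wd_append, wd_singleton, mul_assoc, D.r_mul_r hi, mul_one]
  have h2 : l.length ≤ l'.length + 1 := by
    simpa using hl.2 (l' ++ [i]) (hl'.1.append (RW.singleton hi)) e'.symm
  have h3 : l.length ≠ l'.length := by
    intro h
    have P1 := D.pos_of_ascent _ l rfl hl i hi fun m h1 h2 =>
      h ▸ hl'.2 m h1 (h2.trans e.symm)
    have P2 := D.pos_of_ascent _ l' rfl hl' i hi fun m h1 h2 =>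
      h ▸ hl.2 m h1 (h2.trans e'.symm)
    rw [e, wd_append, wd_singleton, Module.End.mul_apply, D.r_α hi, map_neg] at P2
    have := P1.ne_zero_of_neg P2
    rw [← map_zero (D.wd l)] at this
    exact D.α_ne_zero i (D.wd_injective hl.1 this)
  omega

end Datum
end GKM

namespace GKM
namespace Datum

variable {I V : Type*} [AddCommGroup V] [Module ℚ V] (D : Datum I V) {i j k : I}
variable {β : V} {βv : V →ₗ[ℚ] ℚ}

/-- `β ∈ Wα_k`, with coroot `βv`. -/
def Pair (k : I) (β : V) (βv : V →ₗ[ℚ] ℚ) : Prop :=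
  ∃ l, D.RW l ∧ β = D.wd l (D.α k) ∧ βv = D.cw l (D.cr k)

lemma Pair.simple (k : I) : D.Pair k (D.α k) (D.cr k) := ⟨[], RW.nil, rfl, rfl⟩

variable {D}

lemma Pair.refl (h : D.Pair k β βv) (hj : D.A j j = 2) :
    D.Pair k (D.r j β) (crefl D.α D.cr j βv) := by
  obtain ⟨l, hl, rfl, rfl⟩ := h
  exact ⟨j :: l, RW.cons hj hl, by rw [wd_cons]; rfl, by rw [cw_cons]; rfl⟩

lemma Pair.self (h : D.Pair k β βv) : βv β = D.A k k := by
  obtain ⟨l, hl, rfl, rfl⟩ := h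
  rw [cw_apply, wd_reverse_apply _ hl, D.hpair]

lemma Pair.ne_zero (h : D.Pair k β βv) : β ≠ 0 := by
  obtain ⟨l, hl, rfl, rfl⟩ := h
  intro h
  rw [← map_zero (D.wd l)] at h
  exact D.α_ne_zero k (D.wd_injective hl h)

variable (D)

lemma crd_r (hj : D.A j j = 2) (hk : D.A k k ≠ 2) (x : V) : D.crd (D.r j x) k = D.crd x k := by
  have : j ≠ k := by rintro rfl; exact hk hj
  simp [r_apply, this]

lemma crd_wd {l : List I} (hl : D.RW l) (hk : D.A k k ≠ 2) (x : V) :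
    D.crd (D.wd l x) k = D.crd x k := by
  induction l with
  | nil => simp
  | cons j l ih => rw [wd_cons, Module.End.mul_apply, D.crd_r hl.head hk, ih hl.tail]

open Classical in
lemma Pair.crd_imag {D : Datum I V} (h : D.Pair k β βv) (hi : D.A i i ≠ 2) :
    D.crd β i = if k = i then 1 else 0 := by
  obtain ⟨l, hl, rfl, rfl⟩ := h
  rw [D.crd_wd hl hi, crd_α]

lemma Red.left {D : Datum I V} {l l' : List I} (h : D.Red (l ++ l')) : D.Red l := by
  refine ⟨h.1.left, fun u hu e => ?_⟩
  have := h.2 (u ++ l') (hu.append h.1.right) (by rw [wd_append, wd_append, e])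
  simpa using this

lemma wd_reverse_eq {l l' : List I} (h : D.RW l) (h' : D.RW l') (e : D.wd l = D.wd l') :
    D.wd l.reverse = D.wd l'.reverse := by
  calc D.wd l.reverse = D.wd l.reverse * (D.wd l' * D.wd l'.reverse) := by
        rw [D.wd_mul_reverse h', mul_one]
    _ = D.wd l'.reverse := by rw [← mul_assoc, ← e, D.wd_reverse_mul h, one_mul]

lemma Red.reverse {D : Datum I V} {l : List I} (h : D.Red l) : D.Red l.reverse := by
  refine ⟨h.1.reverse, fun u hu e => ?_⟩
  have := h.2 u.reverse hu.reverse (by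
    rw [D.wd_reverse_eq hu h.1.reverse e, List.reverse_reverse])
  simpa using this

lemma Red.pos {D : Datum I V} {l : List I} (h : D.Red (l ++ [i])) :
    D.Pos (D.wd l (D.α i)) (D.cw l (D.cr i)) :=
  D.pos_of_ascent _ l rfl h.left i (h.1 i (by simp)) fun l' h1 h2 => by
    have := h.2 l' h1 h2
    simp at this
    omega

lemma r_α_eq (i j : I) : D.r j (D.α i) = D.α i - (D.A j i : ℚ) • D.α j := by
  rw [r_apply, D.hpair]

lemma crefl_cr_eq (i j : I) : crefl D.α D.cr j (D.cr i) = D.cr i - (D.A i j : ℚ) • D.cr j := by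
  rw [crefl_apply, D.hpair]

lemma exists_nat_neg (hij : i ≠ j) : ∃ n : ℕ, -(D.A i j : ℚ) = n := by
  obtain ⟨n, hn⟩ := Int.eq_ofNat_of_zero_le (neg_nonneg.2 (D.hoff i j hij))
  exact ⟨n, by exact_mod_cast hn⟩

lemma cw_singleton (i : I) : D.cw [i] = crefl D.α D.cr i := by simp [cw]

lemma pos_imag_word (hk : D.A k k ≠ 2) {l : List I} (hl : D.Red l) :
    D.Pos (D.wd l (D.α k)) (D.cw l (D.cr k)) := by
  induction l using List.reverseRecOn with
  | nil => exact D.pos_simple k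
  | append_singleton l n ih =>
    have hn : D.A n n = 2 := hl.1 n (by simp)
    have hnk : n ≠ k := by rintro rfl; exact hk hn
    obtain ⟨x, hx⟩ := D.exists_nat_neg hnk
    obtain ⟨x', hx'⟩ := D.exists_nat_neg hnk.symm
    have h0 : x = 0 ↔ x' = 0 := by
      have := D.hzero n k
      rw [← Nat.cast_eq_zero (R := ℚ), ← Nat.cast_eq_zero (R := ℚ), ← hx, ← hx', neg_eq_zero,
        neg_eq_zero]
      exact_mod_cast this
    have := (ih hl.left).add (hl.pos.smul h0)
    convert this using 1
    · rw [wd_append, wd_singleton, Module.End.mul_apply, r_α_eq, ← hx, map_sub, map_smul]; module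
    · rw [cw_append, cw_singleton, Module.End.mul_apply, crefl_cr_eq, ← hx', map_sub, map_smul]
      module

variable {D}

lemma Pair.pos_imag (h : D.Pair k β βv) (hk : D.A k k ≠ 2) : D.Pos β βv := by
  obtain ⟨l, hl, rfl, rfl⟩ := h
  obtain ⟨l', h1, h2⟩ := D.exists_red hl
  rw [← h2, ← D.cw_eq_of_wd_eq h1.1 hl h2]
  exact D.pos_imag_word hk h1

lemma Pair.pos_or_neg (h : D.Pair k β βv) : D.Pos β βv ∨ D.Pos (-β) (-βv) := by
  by_cases hk : D.A k k = 2
  · obtain ⟨l, hl, rfl, rfl⟩ := h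
    exact D.pos_or_neg hl hk
  · exact Or.inl (h.pos_imag hk)

lemma mem_Qplus_iff {x : V} : x ∈ Qplus D.α ↔ ∃ c, x = D.rs c := Iff.rfl

lemma Pair.pos (h : D.Pair k β βv) (hβ : β ∈ Qplus D.α) : D.Pos β βv := by
  rcases h.pos_or_neg with h1 | h1
  · exact h1
  · exfalso
    obtain ⟨c, hc⟩ := mem_Qplus_iff.1 hβ
    obtain ⟨d, -, hd, -, -⟩ := h1
    have : D.rs (c + d) = D.rs 0 := by rw [rs_add, ← hc, ← hd, rs_zero, add_neg_cancel]
    have := D.rs_injective this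
    have hc0 : c = 0 := by
      ext l
      have := DFunLike.congr_fun this l
      simp at this
      simpa using this.1
    exact h.ne_zero (by rw [hc, hc0, rs_zero])

lemma Pos.mem (h : D.Pos β βv) : β ∈ Qplus D.α := by
  obtain ⟨c, -, h, -, -⟩ := h
  exact ⟨c, h⟩

variable (D)

lemma cs_α (c : I →₀ ℕ) (j : I) : D.cs c (D.α j) = c.sum fun i n => (n : ℚ) * D.A i j := by
  simp [cs, Finsupp.sum, LinearMap.sum_apply, D.hpair]

lemma cr_rs (c : I →₀ ℕ) (j : I) : D.cr j (D.rs c) = c.sum fun i n => (n : ℚ) * D.A j i := by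
  simp [rs, Finsupp.sum, D.hpair]

/-- If `k` is not in the support of `β`, the numbers `β^∨(α_k)` and `α_k^∨(β)` are both `≤ 0`
and vanish simultaneously. -/
lemma Pos.off {D : Datum I V} (h : D.Pos β βv) (hk : D.crd β k = 0) :
    βv (D.α k) ≤ 0 ∧ D.cr k β ≤ 0 ∧ (βv (D.α k) = 0 ↔ D.cr k β = 0) := by
  obtain ⟨c, c', rfl, rfl, hc⟩ := h
  rw [crd_rs] at hk
  have hck : c k = 0 := by exact_mod_cast hk
  have hne : ∀ i ∈ c.support, i ≠ k := by
    rintro i hi rfl; exact Finsupp.mem_support_iff.1 hi hck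
  have hs : c'.support = c.support := by
    ext l; rw [Finsupp.mem_support_iff, Finsupp.mem_support_iff, ne_eq, ne_eq, hc]
  rw [cs_α, cr_rs, Finsupp.sum, Finsupp.sum, hs]
  have n1 : ∀ i ∈ c.support, (c' i : ℚ) * D.A i k ≤ 0 := fun i hi =>
    mul_nonpos_of_nonneg_of_nonpos (by positivity) (by exact_mod_cast D.hoff i k (hne i hi))
  have n2 : ∀ i ∈ c.support, (c i : ℚ) * D.A k i ≤ 0 := fun i hi =>
    mul_nonpos_of_nonneg_of_nonpos (by positivity) (by exact_mod_cast D.hoff k i (hne i hi).symm)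
  refine ⟨Finset.sum_nonpos n1, Finset.sum_nonpos n2, ?_⟩
  rw [Finset.sum_eq_zero_iff_of_nonpos n1, Finset.sum_eq_zero_iff_of_nonpos n2]
  refine forall₂_congr fun i hi => ?_
  rw [mul_eq_zero, mul_eq_zero, Nat.cast_eq_zero, Nat.cast_eq_zero, ← hc, Int.cast_eq_zero,
    Int.cast_eq_zero, D.hzero i k]

/-- For a `W`-translate `β` of an imaginary simple root, `β^∨(α_j)` and `α_j^∨(β)` have the same
sign. -/
lemma Pair.sign {D : Datum I V} (h : D.Pair k β βv) (hk : D.A k k ≠ 2) (hj : D.A j j = 2) :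
    (0 < βv (D.α j) ↔ 0 < D.cr j β) ∧ (βv (D.α j) = 0 ↔ D.cr j β = 0) := by
  obtain ⟨l, hl, rfl, rfl⟩ := h
  have e1 : D.cw l (D.cr k) (D.α j) = D.cr k (D.wd l.reverse (D.α j)) := by rw [cw_apply]
  have e2 : D.cr j (D.wd l (D.α k)) = D.cw l.reverse (D.cr j) (D.α k) := by
    rw [cw_apply, List.reverse_reverse]
  have hjk : j ≠ k := by rintro rfl; exact hk hj
  have hP : D.Pair j (D.wd l.reverse (D.α j)) (D.cw l.reverse (D.cr j)) :=
    ⟨_, hl.reverse, rfl, rfl⟩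
  have hc : D.crd (D.wd l.reverse (D.α j)) k = 0 := by
    rw [D.crd_wd hl.reverse hk, D.crd_α_ne hjk]
  rw [e1, e2]
  rcases hP.pos_or_neg with h | h
  · obtain ⟨h1, h2, h3⟩ := h.off hc
    exact ⟨⟨fun h => by linarith, fun h => by linarith⟩, h3.symm⟩
  · obtain ⟨h1, h2, h3⟩ := h.off (k := k) (by rw [map_neg, Finsupp.neg_apply, hc, neg_zero])
    simp only [LinearMap.neg_apply, map_neg, neg_eq_zero] at h1 h2 h3
    refine ⟨⟨fun h => lt_of_le_of_ne (by linarith) fun h' => ?_,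
      fun h => lt_of_le_of_ne (by linarith) fun h' => ?_⟩, h3.symm⟩
    · have := h3.1 h'.symm; linarith
    · have := h3.2 h'.symm; linarith

/-- Induction over the `W`-translates of an imaginary simple root, by decreasing height. -/
lemma imag_induction {D : Datum I V} (hk : D.A k k ≠ 2) {P : V → (V →ₗ[ℚ] ℚ) → Prop}
    (h0 : P (D.α k) (D.cr k))
    (hs : ∀ j β βv, D.A j j = 2 → D.Pair k β βv → 0 < D.cr j β →
      P (D.r j β) (crefl D.α D.cr j βv) → P β βv) (h : D.Pair k β βv) : P β βv := by
  classical
  obtain ⟨l, hl, h1, h2⟩ := h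
  induction hn : l.length using Nat.strong_induction_on generalizing l β βv with
  | _ n ih =>
  have hex : ∃ m, ∃ l, D.RW l ∧ β = D.wd l (D.α k) ∧ βv = D.cw l (D.cr k) ∧ l.length = m :=
    ⟨_, l, hl, h1, h2, rfl⟩
  obtain ⟨u, hu, e1, e2, e3⟩ := Nat.find_spec hex
  have hmin : ∀ u', D.RW u' → β = D.wd u' (D.α k) → βv = D.cw u' (D.cr k) →
      u.length ≤ u'.length := fun u' g1 g2 g3 => e3 ▸ Nat.find_min' hex ⟨u', g1, g2, g3, rfl⟩
  have hun : u.length ≤ n := hn ▸ hmin l hl h1 h2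
  cases u with
  | nil => rw [e1, e2]; exact h0
  | cons j u =>
    have hj := hu.head
    have hβ : D.Pair k β βv := ⟨_, hu, e1, e2⟩
    have r1 : D.r j β = D.wd u (D.α k) := by
      rw [e1, wd_cons, Module.End.mul_apply, D.r_r hj]
    have r2 : crefl D.α D.cr j βv = D.cw u (D.cr k) := by
      ext x
      rw [crefl_apply_apply, e2, cw_cons, Module.End.mul_apply, crefl_apply_apply, D.r_r hj]
    have hred : D.Red (j :: u) := by
      refine ⟨hu, fun u' g1 g2 => hmin u' g1 (by rw [e1, g2]) ?_⟩
      rw [e2, D.cw_eq_of_wd_eq g1 hu g2]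
    refine hs j β βv hj hβ ?_ (ih u.length (by simp at hun; omega) u hu.tail r1 r2 rfl)
    have hpos : D.Pos (D.wd u.reverse (D.α j)) (D.cw u.reverse (D.cr j)) := by
      have := hred.reverse
      rw [List.reverse_cons] at this
      exact this.pos
    have hjk : j ≠ k := by rintro rfl; exact hk hj
    have hc : D.crd (D.wd u.reverse (D.α j)) k = 0 := by
      rw [D.crd_wd hu.tail.reverse hk, D.crd_α_ne hjk]
    obtain ⟨g1, g2, g3⟩ := hpos.off hc
    have q1 : D.cr j β = - D.cw u.reverse (D.cr j) (D.α k) := by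
      rw [cw_apply, List.reverse_reverse, ← r1, D.cr_r hj, neg_neg]
    have q2 : βv (D.α j) = - D.cr k (D.wd u.reverse (D.α j)) := by
      rw [← cw_apply, ← r2, crefl_apply_apply, D.r_α hj, map_neg, neg_neg]
    rw [q1]
    rcases g1.lt_or_eq with g | g
    · linarith
    · exfalso
      have z1 : D.cr j β = 0 := by rw [q1, g, neg_zero]
      have z2 : βv (D.α j) = 0 := by rw [q2, g3.1 g, neg_zero]
      have := hmin u hu.tail (by rw [← r1, r_apply, z1]; simp)
        (by rw [← r2, crefl_apply, z2]; simp)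
      simp at this

end Datum
end GKM

namespace GKM
namespace Datum

variable {I V : Type*} [AddCommGroup V] [Module ℚ V] (D : Datum I V) {i j k l : I}
variable {β : V} {βv : V →ₗ[ℚ] ℚ}

lemma Qplus_zero : (0 : V) ∈ Qplus D.α := ⟨0, by simp⟩

variable {D}

lemma Qplus_add {x y : V} (hx : x ∈ Qplus D.α) (hy : y ∈ Qplus D.α) : x + y ∈ Qplus D.α := by
  obtain ⟨c, rfl⟩ := mem_Qplus_iff.1 hx
  obtain ⟨d, rfl⟩ := mem_Qplus_iff.1 hy
  exact ⟨c + d, (D.rs_add c d).symm⟩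

lemma Qplus_smul {x : V} (n : ℕ) (hx : x ∈ Qplus D.α) : (n : ℚ) • x ∈ Qplus D.α := by
  obtain ⟨c, rfl⟩ := mem_Qplus_iff.1 hx
  exact ⟨n • c, (D.rs_nsmul n c).symm⟩

variable (D) in
lemma Qplus_α (i : I) : D.α i ∈ Qplus D.α := ⟨Finsupp.single i 1, by simp⟩

lemma Qplus_crd {x : V} (hx : x ∈ Qplus D.α) (l : I) : ∃ n : ℕ, D.crd x l = n := by
  obtain ⟨c, rfl⟩ := mem_Qplus_iff.1 hx
  exact ⟨c l, D.crd_rs c l⟩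

lemma Qplus_crd_nonneg {x : V} (hx : x ∈ Qplus D.α) (l : I) : 0 ≤ D.crd x l := by
  obtain ⟨n, hn⟩ := Qplus_crd hx l
  rw [hn]; positivity

lemma Qplus_int {x : V} (hx : x ∈ Qplus D.α) (i : I) : ∃ n : ℤ, D.cr i x = n := by
  obtain ⟨c, rfl⟩ := mem_Qplus_iff.1 hx
  refine ⟨c.sum fun l n => (n : ℤ) * D.A i l, ?_⟩
  rw [cr_rs]; simp [Finsupp.sum]

lemma Qplus_eq_of_crd {x y : V} (hx : x ∈ Qplus D.α) (hy : y ∈ Qplus D.α)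
    (h : ∀ l, D.crd x l = D.crd y l) : x = y := by
  obtain ⟨c, rfl⟩ := mem_Qplus_iff.1 hx
  obtain ⟨d, rfl⟩ := mem_Qplus_iff.1 hy
  congr 1
  ext l
  have := h l
  rw [crd_rs, crd_rs] at this
  exact_mod_cast this

/-- An imaginary root orthogonal to the rest of its support is simple. -/
lemma Pair.eq_of_nbr (h : D.Pair k β βv) (hk : D.A k k ≠ 2)
    (hn : ∀ l, l ≠ k → D.crd β l ≠ 0 → D.A k l = 0) : β = D.α k ∧ βv = D.cr k := by
  refine imag_induction (P := fun β βv => (∀ l, l ≠ k → D.crd β l ≠ 0 → D.A k l = 0) →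
    β = D.α k ∧ βv = D.cr k) hk (fun _ => ⟨rfl, rfl⟩) ?_ h hn
  intro j β βv hj hβ hpos ih hn
  have hjk : j ≠ k := by rintro rfl; exact hk hj
  have hc : ∀ l, l ≠ j → D.crd (D.r j β) l = D.crd β l := by
    intro l hl; simp [r_apply, D.crd_α_ne hl.symm]
  have hcj : D.crd (D.r j β) j = D.crd β j - D.cr j β := by
    simp [r_apply]
  have e := ih fun l hl hl' => hn l hl (by
    by_cases hlj : l = j
    · subst hlj
      have := Qplus_crd_nonneg ((hβ.refl hj).pos_imag hk).mem l
      rw [hcj] at this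
      intro h0; linarith
    · rwa [← hc l hlj])
  have e1 : D.cr j β = - D.A j k := by
    have := D.cr_r hj β
    rw [e.1, D.hpair] at this
    linarith
  have e2 : D.crd β j ≠ 0 := by
    have := hcj
    rw [e.1, D.crd_α_ne hjk.symm] at this
    intro h0; linarith
  have := (D.hzero k j).1 (hn j hjk e2)
  rw [e1, this] at hpos
  simp at hpos

lemma Pair.imag_cases (h : D.Pair k β βv) (hk : D.A k k ≠ 2) :
    (β = D.α k ∧ βv = D.cr k) ∨ ∃ j, D.A j j = 2 ∧ 0 < D.cr j β :=
  imag_induction (P := fun β βv => (β = D.α k ∧ βv = D.cr k) ∨ ∃ j, D.A j j = 2 ∧ 0 < D.cr j β)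
    hk (Or.inl ⟨rfl, rfl⟩) (fun j _ _ hj _ hp _ => Or.inr ⟨j, hj, hp⟩) h

lemma Pos.supp (h : D.Pos β βv) (hs : ∀ m, m ≠ l → D.crd β m = 0) :
    ∃ c c' : ℕ, β = (c : ℚ) • D.α l ∧ βv = (c' : ℚ) • D.cr l := by
  obtain ⟨c, c', rfl, rfl, hc⟩ := h
  have h1 : c = Finsupp.single l (c l) := by
    ext m
    by_cases hm : m = l
    · subst hm; simp
    · have := hs m hm
      rw [crd_rs] at this
      rw [Finsupp.single_eq_of_ne hm]
      exact_mod_cast this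
  have h2 : c' = Finsupp.single l (c' l) := by
    ext m
    by_cases hm : m = l
    · subst hm; simp
    · rw [Finsupp.single_eq_of_ne hm, ← hc, h1, Finsupp.single_eq_of_ne hm]
  exact ⟨c l, c' l, by rw [← D.rs_single, ← h1], by rw [← D.cs_single, ← h2]⟩

/-- A positive root proportional to a simple root is that simple root. -/
lemma Pair.eq_simple (h : D.Pair k β βv) (hβ : β ∈ Qplus D.α)
    (hs : ∀ m, m ≠ l → D.crd β m = 0) : β = D.α l ∧ βv = D.cr l := by
  by_cases hk : D.A k k = 2
  · obtain ⟨c, c', rfl, rfl⟩ := (h.pos hβ).supp hs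
    have := h.self
    rw [hk] at this
    simp only [LinearMap.smul_apply, map_smul, D.hpair, smul_eq_mul] at this
    have h2 : (c : ℤ) * (c' * D.A l l) = 2 := by exact_mod_cast this
    have hl : D.A l l = 2 := by
      rcases D.hdiag l with h | h
      · exact h
      · have : (c : ℤ) * (c' * D.A l l) ≤ 0 :=
          mul_nonpos_of_nonneg_of_nonpos (by positivity)
            (mul_nonpos_of_nonneg_of_nonpos (by positivity) h)
        omega
    rw [hl] at h2
    have h3 : c' * c = 1 := by
      have : (c' : ℤ) * c = 1 := by linarith
      exact_mod_cast this
    obtain ⟨h4, h5⟩ := mul_eq_one.1 h3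
    subst h4; subst h5
    simp
  · have hkl : k = l := by
      by_contra hkl
      have := h.crd_imag hk
      rw [hs k hkl] at this
      simp at this
    subst hkl
    exact h.eq_of_nbr hk fun l hl hl' => absurd (hs l hl) hl'

lemma Pair.real_iff {βv : V →ₗ[ℚ] ℚ} (h : D.Pair k (D.α l) βv) :
    D.A k k = 2 ↔ D.A l l = 2 := by
  constructor
  · intro hk
    have := h.self
    rw [(h.eq_simple (D.Qplus_α l) fun m hm => D.crd_α_ne hm.symm).2, D.hpair, hk] at this
    exact_mod_cast this
  · intro hl
    by_contra hk
    have := h.crd_imag hk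
    have hlk : l ≠ k := by rintro rfl; exact hk hl
    rw [D.crd_α_ne hlk] at this
    simp at this

lemma Pair.cr_eq {βv : V →ₗ[ℚ] ℚ} (h : D.Pair k (D.α l) βv) : βv = D.cr l :=
  (h.eq_simple (D.Qplus_α l) fun _ hm => D.crd_α_ne hm.symm).2

lemma Pair.refl_mem (h : D.Pair k β βv) (hβ : β ∈ Qplus D.α) (hj : D.A j j = 2)
    (hne : β ≠ D.α j) : D.r j β ∈ Qplus D.α := by
  rcases (h.refl hj).pos_or_neg with h1 | h1
  · exact h1.mem
  · exfalso
    refine hne (h.eq_simple hβ fun m hm => ?_).1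
    have := Qplus_crd_nonneg h1.mem m
    rw [r_apply] at this
    simp [D.crd_α_ne hm.symm] at this
    exact le_antisymm this (Qplus_crd_nonneg hβ m)

variable (D)

/-- For real-dominant integral `κ`, one has `κ - wκ ∈ Q⁺`. -/
lemma sub_wd_mem {κ : V} (hκ : ∀ j, D.A j j = 2 → ∃ n : ℕ, D.cr j κ = n) {l : List I}
    (hl : D.RW l) : κ - D.wd l κ ∈ Qplus D.α := by
  obtain ⟨l', h1, h2⟩ := D.exists_red hl
  rw [← h2]
  clear h2 hl
  induction l' using List.reverseRecOn with
  | nil => simpa using D.Qplus_zero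
  | append_singleton l n ih =>
    obtain ⟨m, hm⟩ := hκ n (h1.1 n (by simp))
    have := Qplus_add (ih h1.left) (Qplus_smul m h1.pos.mem)
    convert this using 1
    rw [wd_append, wd_singleton, Module.End.mul_apply, r_apply, hm, map_sub, map_smul]
    abel

/-- The rational cone spanned by the simple roots. -/
def Cone (x : V) : Prop :=
  ∃ c : I →₀ ℚ, (∀ l, 0 ≤ c l) ∧ x = Finsupp.linearCombination ℚ D.α c

lemma crd_linearCombination (c : I →₀ ℚ) : D.crd (Finsupp.linearCombination ℚ D.α c) = c := by
  ext l
  rw [Finsupp.linearCombination_apply, Finsupp.sum, map_sum, Finsupp.finsetSum_apply]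
  classical
  simp only [map_smul, Finsupp.smul_apply, crd_α, smul_eq_mul, mul_ite, mul_one, mul_zero]
  rw [Finset.sum_ite_eq']
  simp +contextual [Finsupp.mem_support_iff]

variable {D}

lemma Cone.crd_nonneg {x : V} (h : D.Cone x) (l : I) : 0 ≤ D.crd x l := by
  obtain ⟨c, hc, rfl⟩ := h
  rw [crd_linearCombination]; exact hc l

lemma Cone.zero : D.Cone 0 := ⟨0, fun _ => le_rfl, by simp⟩

lemma Cone.add {x y : V} (hx : D.Cone x) (hy : D.Cone y) : D.Cone (x + y) := by
  obtain ⟨c, hc, rfl⟩ := hx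
  obtain ⟨d, hd, rfl⟩ := hy
  exact ⟨c + d, fun l => add_nonneg (hc l) (hd l), by rw [map_add]⟩

lemma Cone.smul {x : V} {q : ℚ} (hq : 0 ≤ q) (hx : D.Cone x) : D.Cone (q • x) := by
  obtain ⟨c, hc, rfl⟩ := hx
  exact ⟨q • c, fun l => mul_nonneg hq (hc l), by rw [map_smul]⟩

lemma Cone.α (i : I) : D.Cone (D.α i) :=
  ⟨Finsupp.single i 1, fun l => by classical rw [Finsupp.single_apply]; split_ifs <;> simp, by simp⟩

lemma Cone.of_Qplus {x : V} (hx : x ∈ Qplus D.α) : D.Cone x := by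
  obtain ⟨c, rfl⟩ := hx
  refine Finset.sum_induction _ D.Cone (fun _ _ => Cone.add) Cone.zero fun l _ => ?_
  exact (Cone.α l).smul (by positivity)

lemma Cone.eq {x : V} (h : D.Cone x) : x = Finsupp.linearCombination ℚ D.α (D.crd x) := by
  obtain ⟨c, hc, rfl⟩ := h
  rw [crd_linearCombination]

lemma Cone.map_eq {x : V} (h : D.Cone x) (f : V →ₗ[ℚ] ℚ) :
    f x = ∑ l ∈ (D.crd x).support, D.crd x l * f (D.α l) := by
  conv_lhs => rw [h.eq, Finsupp.linearCombination_apply, Finsupp.sum, map_sum]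
  simp

lemma Cone.le {x : V} (h : D.Cone x) (f : V →ₗ[ℚ] ℚ) (l : I) (hf : ∀ m, m ≠ l → f (D.α m) ≤ 0) :
    f x ≤ D.crd x l * f (D.α l) := by
  classical
  rw [h.map_eq]
  by_cases hl : l ∈ (D.crd x).support
  · rw [← Finset.add_sum_erase _ _ hl]
    have : ∑ m ∈ (D.crd x).support.erase l, D.crd x m * f (D.α m) ≤ 0 :=
      Finset.sum_nonpos fun m hm => mul_nonpos_of_nonneg_of_nonpos (h.crd_nonneg m)
        (hf m (Finset.ne_of_mem_erase hm))
    linarith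
  · rw [Finsupp.notMem_support_iff.1 hl, zero_mul]
    refine Finset.sum_nonpos fun m hm => mul_nonpos_of_nonneg_of_nonpos (h.crd_nonneg m) (hf m ?_)
    rintro rfl; exact hl hm

lemma cr_α_nonpos (h : i ≠ j) : D.cr i (D.α j) ≤ 0 := by
  rw [D.hpair]; exact_mod_cast D.hoff i j h

lemma A_nonpos (hi : D.A i i ≠ 2) (j : I) : D.A i j ≤ 0 := by
  by_cases h : i = j
  · subst h; exact (D.hdiag i).resolve_left hi
  · exact D.hoff i j h

lemma cr_α_nonpos' (hi : D.A i i ≠ 2) (j : I) : D.cr i (D.α j) ≤ 0 := by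
  rw [D.hpair]; exact_mod_cast A_nonpos hi j

lemma Cone.cr_real {x : V} (h : D.Cone x) (hj : D.A j j = 2) : D.cr j x ≤ 2 * D.crd x j := by
  have := h.le (D.cr j) j fun m hm => cr_α_nonpos hm.symm
  rw [D.hpair, hj] at this
  push_cast at this; linarith

lemma Cone.cr_imag {x : V} (h : D.Cone x) (hi : D.A i i ≠ 2) (l : I) :
    D.cr i x ≤ D.A i l * D.crd x l := by
  have := h.le (D.cr i) l fun m _ => cr_α_nonpos' hi m
  rw [D.hpair] at this
  linarith

lemma Cone.cr_nonpos {x : V} (h : D.Cone x) (hi : D.A i i ≠ 2) : D.cr i x ≤ 0 := by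
  have h1 := h.cr_imag hi i
  have h2 : (D.A i i : ℚ) ≤ 0 := by exact_mod_cast A_nonpos hi i
  have := mul_nonpos_of_nonpos_of_nonneg h2 (h.crd_nonneg i)
  linarith

lemma Cone.cr_offsupp {x : V} (h : D.Cone x) (hl : D.crd x i = 0) : D.cr i x ≤ 0 := by
  have := h.le (D.cr i) i fun m hm => cr_α_nonpos hm.symm
  rwa [hl, zero_mul] at this

end Datum
end GKM

namespace GKM
namespace Datum

variable {I V : Type*} [AddCommGroup V] [Module ℚ V] (D : Datum I V) {i j k l : I}
variable {β : V} {βv : V →ₗ[ℚ] ℚ} {lam x y z : V}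

/-- Membership in the orbit `Tλ`. -/
def T (lam x : V) : Prop := x ∈ Torbit D.α D.cr lam

lemma T.self : D.T lam lam := ⟨1, one_mem _, rfl⟩

variable {D}

lemma T.r (h : D.T lam x) (i : I) : D.T lam (D.r i x) := by
  obtain ⟨τ, h1, rfl⟩ := h
  exact ⟨D.r i * τ, mul_mem (Submonoid.subset_closure ⟨i, rfl⟩) h1, rfl⟩

lemma T.wd (h : D.T lam x) (l : List I) : D.T lam (D.wd l x) := by
  induction l with
  | nil => exact h
  | cons i l ih => rw [wd_cons]; exact ih.r i

/-- All `W`-translates of `x` lie below `lam`. -/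
def InC (D : Datum I V) (lam x : V) : Prop := ∀ l, D.RW l → lam - D.wd l x ∈ Qplus D.α

lemma InC.imag_nonneg (hlam : lam ∈ Pplus D.cr) (h : D.InC lam x) (hi : D.A i i ≠ 2) :
    0 ≤ D.cr i x := by
  have h1 := (Cone.of_Qplus (h [] RW.nil)).cr_nonpos hi
  have h2 := hlam.2 i
  simp at h1
  linarith

lemma InC.int (hlam : lam ∈ Pplus D.cr) (h : D.InC lam x) (i : I) : ∃ n : ℤ, D.cr i x = n := by
  obtain ⟨m, hm⟩ := Qplus_int (h [] RW.nil) i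
  obtain ⟨n, hn⟩ := hlam.1 i
  refine ⟨n - m, ?_⟩
  simp [hn] at hm
  push_cast; linarith

lemma exists_nat_of_int {q : ℚ} (h : ∃ n : ℤ, q = n) (h0 : 0 ≤ q) : ∃ n : ℕ, q = n := by
  obtain ⟨n, rfl⟩ := h
  obtain ⟨m, rfl⟩ := Int.eq_ofNat_of_zero_le (show 0 ≤ n by exact_mod_cast h0)
  exact ⟨m, by simp⟩

lemma InC.r (hlam : lam ∈ Pplus D.cr) (h : D.InC lam x) (i : I) : D.InC lam (D.r i x) := by
  intro l hl
  by_cases hi : D.A i i = 2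
  · have := h (l ++ [i]) (hl.append (RW.singleton hi))
    rwa [wd_append, wd_singleton] at this
  · obtain ⟨n, hn⟩ := exists_nat_of_int (h.int hlam i) (h.imag_nonneg hlam hi)
    have hp : D.Pair i (D.wd l (D.α i)) (D.cw l (D.cr i)) := ⟨l, hl, rfl, rfl⟩
    have := Qplus_add (h l hl) (Qplus_smul n (hp.pos_imag hi).mem)
    convert this using 1
    rw [r_apply, hn, map_sub, map_smul]
    abel

lemma InC.self (hlam : lam ∈ Pplus D.cr) : D.InC lam lam := fun _ hl =>
  D.sub_wd_mem (fun j _ => exists_nat_of_int (hlam.1 j) (hlam.2 j)) hl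

lemma T.inC (hlam : lam ∈ Pplus D.cr) (h : D.T lam x) : D.InC lam x := by
  obtain ⟨τ, h1, rfl⟩ := h
  suffices ∀ y, D.InC lam y → D.InC lam (τ y) from this lam (InC.self hlam)
  induction h1 using Submonoid.closure_induction with
  | mem τ h => obtain ⟨i, rfl⟩ := h; exact fun y hy => hy.r hlam i
  | one => exact fun y hy => hy
  | mul τ σ _ _ h1 h2 => exact fun y hy => h1 _ (h2 y hy)

lemma T.sub_mem (hlam : lam ∈ Pplus D.cr) (h : D.T lam x) : lam - x ∈ Qplus D.α :=
  h.inC hlam [] RW.nil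

lemma T.int (hlam : lam ∈ Pplus D.cr) (h : D.T lam x) (i : I) : ∃ n : ℤ, D.cr i x = n :=
  (h.inC hlam).int hlam i

lemma T.imag_nonneg (hlam : lam ∈ Pplus D.cr) (h : D.T lam x) (hi : D.A i i ≠ 2) :
    0 ≤ D.cr i x := (h.inC hlam).imag_nonneg hlam hi

lemma Pair.apply_eq (h : D.Pair k β βv) : ∃ l, D.RW l ∧ (∀ x, βv x = D.cr k (D.wd l.reverse x)) ∧
    β = D.wd l (D.α k) := by
  obtain ⟨l, hl, h1, rfl⟩ := h
  exact ⟨l, hl, fun x => by rw [cw_apply], h1⟩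

lemma T.pair_int (hlam : lam ∈ Pplus D.cr) (h : D.T lam x) (hp : D.Pair k β βv) :
    ∃ n : ℤ, βv x = n := by
  obtain ⟨l, hl, h1, -⟩ := hp.apply_eq
  rw [h1]
  exact (h.wd _).int hlam k

lemma T.pair_imag_nonneg (hlam : lam ∈ Pplus D.cr) (h : D.T lam x) (hp : D.Pair k β βv)
    (hk : D.A k k ≠ 2) : 0 ≤ βv x := by
  obtain ⟨l, hl, h1, -⟩ := hp.apply_eq
  rw [h1]
  exact (h.wd _).imag_nonneg hlam hk

lemma T.refl (h : D.T lam x) (hp : D.Pair k β βv) : D.T lam (x - βv x • β) := by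
  obtain ⟨l, hl, h1, h2⟩ := hp.apply_eq
  have : x - βv x • β = D.wd l (D.r k (D.wd l.reverse x)) := by
    rw [h1, h2, r_apply, map_sub, map_smul, D.wd_apply_reverse hl]
  rw [this]
  exact ((h.wd _).r k).wd l

variable (D)

/-- One step `x → r_β x` away from `lam`. -/
structure Step (lam x y : V) (k : I) (β : V) (βv : V →ₗ[ℚ] ℚ) : Prop where
  T : D.T lam x
  pair : D.Pair k β βv
  mem : β ∈ Qplus D.α
  pos : 0 < βv x
  eq : y = x - βv x • β

/-- Chains of `m` steps. -/
def Ch (lam : V) : ℕ → V → V → Prop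
  | 0, x, y => D.T lam x ∧ x = y
  | m + 1, x, y => ∃ z, (∃ k β βv, D.Step lam x z k β βv) ∧ Ch lam m z y

variable {D}

lemma Step.T_right (h : D.Step lam x y k β βv) : D.T lam y := by
  rw [h.eq]; exact h.T.refl h.pair

lemma Step.ch (h : D.Step lam x y k β βv) : D.Ch lam 1 x y :=
  ⟨y, ⟨k, β, βv, h⟩, h.T_right, rfl⟩

lemma Ch.T_right {m : ℕ} (h : D.Ch lam m x y) : D.T lam y := by
  induction m generalizing x with
  | zero => exact h.2 ▸ h.1
  | succ m ih => obtain ⟨z, -, h⟩ := h; exact ih h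

lemma Ch.cons {m : ℕ} (h : D.Step lam x z k β βv) (h' : D.Ch lam m z y) :
    D.Ch lam (m + 1) x y := ⟨z, ⟨k, β, βv, h⟩, h'⟩

lemma Ch.trans {m n : ℕ} (h : D.Ch lam m x y) (h' : D.Ch lam n y z) : D.Ch lam (m + n) x z := by
  induction m generalizing x with
  | zero => rw [zero_add, h.2]; exact h'
  | succ m ih =>
    obtain ⟨w, hs, h⟩ := h
    rw [show m + 1 + n = m + n + 1 by ring]
    exact ⟨w, hs, ih h⟩

lemma Step.exists_nat (hlam : lam ∈ Pplus D.cr) (h : D.Step lam x y k β βv) :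
    ∃ n : ℕ, 0 < n ∧ βv x = n := by
  obtain ⟨n, hn⟩ := exists_nat_of_int (h.T.pair_int hlam h.pair) h.pos.le
  refine ⟨n, ?_, hn⟩
  have := h.pos
  rw [hn] at this; exact_mod_cast this

lemma Step.sub_mem (hlam : lam ∈ Pplus D.cr) (h : D.Step lam x y k β βv) : x - y ∈ Qplus D.α := by
  obtain ⟨n, -, hn⟩ := h.exists_nat hlam
  rw [h.eq, hn, sub_sub_cancel]
  exact Qplus_smul n h.mem

lemma Step.sub_eq (h : D.Step lam x y k β βv) : x - y = βv x • β := by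
  rw [h.eq, sub_sub_cancel]

lemma Ch.sub_mem (hlam : lam ∈ Pplus D.cr) {m : ℕ} (h : D.Ch lam m x y) : x - y ∈ Qplus D.α := by
  induction m generalizing x with
  | zero => rw [h.2, sub_self]; exact D.Qplus_zero
  | succ m ih =>
    obtain ⟨z, ⟨k, β, βv, hs⟩, h⟩ := h
    have := Qplus_add (hs.sub_mem hlam) (ih h)
    rwa [sub_add_sub_cancel] at this

lemma Qplus_add_eq_zero {x y : V} (hx : x ∈ Qplus D.α) (hy : y ∈ Qplus D.α) (h : x + y = 0) :
    x = 0 := by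
  refine Qplus_eq_of_crd hx D.Qplus_zero fun l => ?_
  have h1 := Qplus_crd_nonneg hx l
  have h2 := Qplus_crd_nonneg hy l
  have h3 : D.crd (x + y) l = 0 := by rw [h]; simp
  simp at h3 ⊢
  linarith

lemma Ch.eq_zero (hlam : lam ∈ Pplus D.cr) {m : ℕ} (h : D.Ch lam m x x) : m = 0 := by
  cases m with
  | zero => rfl
  | succ m =>
    exfalso
    obtain ⟨z, ⟨k, β, βv, hs⟩, h⟩ := h
    have := Qplus_add_eq_zero (hs.sub_mem hlam) (h.sub_mem hlam) (by simp)
    rw [hs.sub_eq, smul_eq_zero] at this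
    rcases this with h | h
    · exact hs.pos.ne' h
    · exact hs.pair.ne_zero h

variable (D)

/-- Covering steps. -/
structure Cov (lam x y : V) (k : I) (β : V) (βv : V →ₗ[ℚ] ℚ) : Prop extends
    D.Step lam x y k β βv where
  max : ∀ m, D.Ch lam m x y → m ≤ 1

/-- Integrality condition of an `a`-chain step. -/
def Adm (a : ℚ) (k : I) (v : ℚ) : Prop :=
  (D.A k k = 2 → ∃ n : ℕ, 0 < n ∧ a * v = n) ∧ (D.A k k ≠ 2 → a * v = 1)

/-- One step of an `a`-chain. -/
def AStep (lam : V) (a : ℚ) (x y : V) : Prop :=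
  ∃ k β βv, D.Cov lam x y k β βv ∧ D.Adm a k (βv x)

/-- Reflexive-transitive closure of `AStep`. -/
abbrev R (lam : V) (a : ℚ) : V → V → Prop := Relation.ReflTransGen (D.AStep lam a)

variable {D}

lemma Adm.exists_nat {a v : ℚ} (h : D.Adm a k v) : ∃ n : ℕ, 0 < n ∧ a * v = n := by
  by_cases hk : D.A k k = 2
  · exact h.1 hk
  · exact ⟨1, one_pos, by simpa using h.2 hk⟩

lemma Step.simple (hx : D.T lam x) (h : 0 < D.cr l x) :
    D.Step lam x (D.r l x) l (D.α l) (D.cr l) :=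
  ⟨hx, Pair.simple D l, D.Qplus_α l, h, by rw [r_apply]⟩

lemma Cov.simple (hlam : lam ∈ Pplus D.cr) (hx : D.T lam x) (h : 0 < D.cr l x) :
    D.Cov lam x (D.r l x) l (D.α l) (D.cr l) := by
  refine ⟨Step.simple hx h, fun m hm => ?_⟩
  cases m with
  | zero => exact zero_le_one
  | succ m =>
    obtain ⟨z, ⟨k, β, βv, hs⟩, hm⟩ := hm
    have h1 : ∀ n, n ≠ l → D.crd β n = 0 := by
      intro n hn
      have h2 := Qplus_crd_nonneg (hm.sub_mem hlam) n
      have h3 : D.crd (x - D.r l x) n = 0 := by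
        rw [r_apply, sub_sub_cancel]; simp [D.crd_α_ne hn.symm]
      have h4 : D.crd (x - z) n + D.crd (z - D.r l x) n = 0 := by
        rw [← Finsupp.add_apply, ← map_add, sub_add_sub_cancel, h3]
      rw [hs.sub_eq, map_smul, Finsupp.smul_apply, smul_eq_mul] at h4
      have h5 := Qplus_crd_nonneg hs.mem n
      have h6 := hs.pos
      have h7 := mul_nonneg h6.le h5
      have h8 : βv x * D.crd β n = 0 := by linarith
      exact (mul_eq_zero.1 h8).resolve_left h6.ne'
    obtain ⟨rfl, rfl⟩ := hs.pair.eq_simple hs.mem h1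
    have : z = D.r l x := by rw [hs.eq, r_apply]
    rw [this] at hm
    rw [hm.eq_zero hlam]

lemma AStep.T_right {a : ℚ} (h : D.AStep lam a x y) : D.T lam y := by
  obtain ⟨k, β, βv, h, -⟩ := h; exact h.T_right

lemma R.T_right {a : ℚ} (h : D.R lam a x y) (hx : D.T lam x) : D.T lam y := by
  induction h with
  | refl => exact hx
  | tail _ h _ => exact h.T_right

lemma AStep.sub_mem {a : ℚ} (h : D.AStep lam a x y) : a • (x - y) ∈ Qplus D.α := by
  obtain ⟨k, β, βv, h, h'⟩ := h
  obtain ⟨n, -, hn⟩ := h'.exists_nat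
  rw [h.sub_eq, smul_smul, hn]
  exact Qplus_smul n h.mem

lemma R.sub_mem {a : ℚ} (h : D.R lam a x y) : a • (x - y) ∈ Qplus D.α := by
  induction h with
  | refl => rw [sub_self, smul_zero]; exact D.Qplus_zero
  | tail _ h ih =>
    have := Qplus_add ih h.sub_mem
    rwa [← smul_add, sub_add_sub_cancel] at this

lemma R.cone {a : ℚ} (ha : 0 < a) (h : D.R lam a x y) : D.Cone (x - y) := by
  have := (Cone.of_Qplus h.sub_mem).smul (inv_nonneg.2 ha.le)
  rwa [smul_smul, inv_mul_cancel₀ ha.ne', one_smul] at this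

end Datum
end GKM

namespace GKM
namespace Datum

variable {I V : Type*} [AddCommGroup V] [Module ℚ V] (D : Datum I V) {i j k l : I}
variable {β : V} {βv : V →ₗ[ℚ] ℚ} {lam x y z u v : V} {a : ℚ}

open Classical in
/-- Whichever of `x`, `r_j x` has nonnegative `j`-weight. -/
noncomputable def up (j : I) (x : V) : V := if 0 ≤ D.cr j x then x else D.r j x

open Classical in
/-- Whichever of `x`, `r_j x` has nonpositive `j`-weight. -/
noncomputable def dn (j : I) (x : V) : V := if D.cr j x ≤ 0 then x else D.r j x

variable {D}

lemma up_nonneg (h : 0 ≤ D.cr j x) : D.up j x = x := by simp [up, h]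
lemma up_neg (h : D.cr j x < 0) : D.up j x = D.r j x := by simp [up, h]
lemma dn_nonpos (h : D.cr j x ≤ 0) : D.dn j x = x := by simp [dn, h]
lemma dn_pos (h : 0 < D.cr j x) : D.dn j x = D.r j x := by simp [dn, h]
lemma r_zero (h : D.cr j x = 0) : D.r j x = x := by simp [r_apply, h]

lemma dn_r (h : 0 ≤ D.cr j x) : D.dn j x = D.r j x := by
  rcases h.lt_or_eq with h | h
  · exact dn_pos h
  · rw [dn_nonpos h.ge, r_zero h.symm]

lemma Step.transport (h : D.Step lam x y k β βv) (hj : D.A j j = 2) (hne : β ≠ D.α j) :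
    D.Step lam (D.r j x) (D.r j y) k (D.r j β) (crefl D.α D.cr j βv) := by
  refine ⟨h.T.r j, h.pair.refl hj, h.pair.refl_mem h.mem hj hne, ?_, ?_⟩
  · rw [crefl_apply_apply, D.r_r hj]; exact h.pos
  · rw [crefl_apply_apply, D.r_r hj, h.eq, map_sub, map_smul]

lemma Step.eq_r (h : D.Step lam x y k (D.α j) βv) : y = D.r j x ∧ 0 < D.cr j x := by
  have := h.pair.cr_eq
  subst this
  exact ⟨by rw [h.eq, r_apply], h.pos⟩

lemma step_r_neg (hx : D.T lam x) (hj : D.A j j = 2) (h : D.cr j x < 0) :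
    D.Step lam (D.r j x) x j (D.α j) (D.cr j) := by
  have := Step.simple (l := j) (hx.r j) (by rw [D.cr_r hj]; linarith)
  rwa [D.r_r hj] at this

lemma Cov.c1 (h : D.Cov lam x y k β βv) (hj : D.A j j = 2) (hne : β ≠ D.α j) :
    (0 < D.cr j x → 0 < D.cr j y) ∧ (0 ≤ D.cr j x → 0 ≤ D.cr j y) := by
  have ht := h.transport hj hne
  constructor
  · intro hx
    by_contra! hy
    rcases hy.lt_or_eq with hy | hy
    · have := h.max _ (((Step.simple h.T hx).ch.trans ht.ch).trans (step_r_neg h.T_right hj hy).ch)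
      norm_num at this
    · rw [r_zero hy] at ht
      have := h.max _ ((Step.simple h.T hx).ch.trans ht.ch)
      norm_num at this
  · intro hx
    by_contra! hy
    rcases hx.lt_or_eq with hx | hx
    · have := h.max _ (((Step.simple h.T hx).ch.trans ht.ch).trans (step_r_neg h.T_right hj hy).ch)
      norm_num at this
    · rw [r_zero hx.symm] at ht
      have := h.max _ (ht.ch.trans (step_r_neg h.T_right hj hy).ch)
      norm_num at this

lemma Step.up_dn (h : D.Step lam x y k β βv) (hj : D.A j j = 2) :
    (∃ n, D.Ch lam n (D.up j x) (D.up j y)) ∧ ∃ n, D.Ch lam n (D.dn j x) (D.dn j y) := by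
  by_cases hne : β = D.α j
  · subst hne
    obtain ⟨rfl, hx⟩ := h.eq_r
    have hy : D.cr j (D.r j x) < 0 := by rw [D.cr_r hj]; linarith
    rw [up_nonneg hx.le, up_neg hy, D.r_r hj, dn_pos hx, dn_nonpos hy.le]
    exact ⟨⟨0, h.T, rfl⟩, ⟨0, h.T.r j, rfl⟩⟩
  have ht := h.transport hj hne
  rcases le_or_gt 0 (D.cr j x) with hx | hx <;> rcases le_or_gt 0 (D.cr j y) with hy | hy
  · rw [up_nonneg hx, up_nonneg hy, dn_r hx, dn_r hy]
    exact ⟨⟨_, h.ch⟩, ⟨_, ht.ch⟩⟩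
  · rw [up_nonneg hx, up_neg hy, dn_r hx, dn_nonpos hy.le]
    refine ⟨?_, ⟨_, ht.ch.trans (step_r_neg h.T_right hj hy).ch⟩⟩
    rcases hx.lt_or_eq with hx | hx
    · exact ⟨_, (Step.simple h.T hx).ch.trans ht.ch⟩
    · rw [r_zero hx.symm] at ht
      exact ⟨_, ht.ch⟩
  · rw [up_neg hx, up_nonneg hy, dn_nonpos hx.le, dn_r hy]
    refine ⟨⟨_, (step_r_neg h.T hj hx).ch.trans h.ch⟩, ?_⟩
    rcases hy.lt_or_eq with hy | hy
    · exact ⟨_, h.ch.trans (Step.simple h.T_right hy).ch⟩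
    · rw [r_zero hy.symm]
      exact ⟨_, h.ch⟩
  · rw [up_neg hx, up_neg hy, dn_nonpos hx.le, dn_nonpos hy.le]
    exact ⟨⟨_, ht.ch⟩, ⟨_, h.ch⟩⟩

lemma Ch.up_dn {m : ℕ} (h : D.Ch lam m x y) (hj : D.A j j = 2) :
    (∃ n, D.Ch lam n (D.up j x) (D.up j y)) ∧ ∃ n, D.Ch lam n (D.dn j x) (D.dn j y) := by
  induction m generalizing x with
  | zero =>
    obtain ⟨hT, rfl⟩ := h
    refine ⟨⟨0, ?_, rfl⟩, ⟨0, ?_, rfl⟩⟩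
    · unfold up; split_ifs; exacts [hT, hT.r j]
    · unfold dn; split_ifs; exacts [hT, hT.r j]
  | succ m ih =>
    obtain ⟨z, ⟨k, β, βv, hs⟩, h⟩ := h
    obtain ⟨⟨n1, h1⟩, ⟨n2, h2⟩⟩ := hs.up_dn hj
    obtain ⟨⟨n3, h3⟩, ⟨n4, h4⟩⟩ := ih h
    exact ⟨⟨_, h1.trans h3⟩, ⟨_, h2.trans h4⟩⟩

lemma Ch.refl_of_neg {m : ℕ} (h : D.Ch lam m u v) (hj : D.A j j = 2) (hu : D.cr j u < 0) :
    D.Ch lam m (D.r j u) (D.r j v) ∨ ∃ n, 2 ≤ n ∧ D.Ch lam n (D.up j u) (D.up j v) := by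
  induction m generalizing u with
  | zero =>
    obtain ⟨hT, rfl⟩ := h
    exact Or.inl ⟨hT.r j, rfl⟩
  | succ m ih =>
    obtain ⟨z, ⟨k, β, βv, hs⟩, h⟩ := h
    have hne : β ≠ D.α j := by
      rintro rfl
      have := hs.eq_r.2
      linarith
    have ht := hs.transport hj hne
    rcases lt_or_ge (D.cr j z) 0 with hz | hz
    · rcases ih h hz with h' | ⟨n, hn, h'⟩
      · exact Or.inl (Ch.cons ht h')
      · refine Or.inr ⟨n + 1, by omega, ?_⟩
        rw [up_neg hu]
        rw [up_neg hz] at h'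
        exact Ch.cons ht h'
    · obtain ⟨⟨n, hn⟩, -⟩ := h.up_dn hj
      rw [up_nonneg hz] at hn
      refine Or.inr ⟨n + 1 + 1, by omega, ?_⟩
      rw [up_neg hu]
      exact Ch.cons (step_r_neg hs.T hj hu) (Ch.cons hs hn)

lemma Ch.refl_of_pos {m : ℕ} (h : D.Ch lam m u v) (hj : D.A j j = 2) (hv : 0 < D.cr j v) :
    D.Ch lam m (D.r j u) (D.r j v) ∨ ∃ n, 2 ≤ n ∧ D.Ch lam n (D.dn j u) (D.dn j v) := by
  induction m generalizing u with
  | zero =>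
    obtain ⟨hT, rfl⟩ := h
    exact Or.inl ⟨hT.r j, rfl⟩
  | succ m ih =>
    obtain ⟨z, ⟨k, β, βv, hs⟩, h⟩ := h
    rcases ih h with h' | ⟨n, hn, h'⟩
    · by_cases hne : β = D.α j
      · right
        subst hne
        obtain ⟨rfl, hu⟩ := hs.eq_r
        refine ⟨m + 1, ?_, ?_⟩
        · rcases Nat.eq_zero_or_pos m with rfl | hm
          · obtain ⟨-, rfl⟩ := h
            rw [D.cr_r hj] at hv; linarith
          · omega
        · rw [dn_pos hu, dn_pos hv]
          exact h.trans (Step.simple h.T_right hv).ch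
      · exact Or.inl (Ch.cons (hs.transport hj hne) h')
    · obtain ⟨-, ⟨n', hn'⟩⟩ := hs.up_dn hj
      have hcomp := hn'.trans h'
      exact Or.inr ⟨n' + n, by omega, hcomp⟩

/-- Covers are transported by simple reflections that do not change the sign of the weight. -/
lemma Cov.transport (h : D.Cov lam x y k β βv) (hj : D.A j j = 2) (hne : β ≠ D.α j)
    (hxy : 0 < D.cr j x * D.cr j y) :
    D.Cov lam (D.r j x) (D.r j y) k (D.r j β) (crefl D.α D.cr j βv) := by
  refine ⟨h.toStep.transport hj hne, fun m hm => ?_⟩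
  rcases lt_trichotomy (D.cr j x) 0 with hx | hx | hx
  · have hy : D.cr j y < 0 := by by_contra! h'; nlinarith
    rcases hm.refl_of_pos hj (by rw [D.cr_r hj]; linarith) with h' | ⟨n, hn, h'⟩
    · rw [D.r_r hj, D.r_r hj] at h'; exact h.max m h'
    · rw [dn_pos (by rw [D.cr_r hj]; linarith), dn_pos (by rw [D.cr_r hj]; linarith), D.r_r hj,
        D.r_r hj] at h'
      have := h.max n h'
      omega
  · rw [hx, zero_mul] at hxy; exact absurd hxy (lt_irrefl _)
  · have hy : 0 < D.cr j y := by by_contra! h'; nlinarith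
    rcases hm.refl_of_neg hj (by rw [D.cr_r hj]; linarith) with h' | ⟨n, hn, h'⟩
    · rw [D.r_r hj, D.r_r hj] at h'; exact h.max m h'
    · rw [up_neg (by rw [D.cr_r hj]; linarith), up_neg (by rw [D.cr_r hj]; linarith), D.r_r hj,
        D.r_r hj] at h'
      have := h.max n h'
      omega

lemma AStep.of_simple (hlam : lam ∈ Pplus D.cr) (hx : D.T lam x) (hj : D.A j j = 2)
    (h : 0 < D.cr j x) (ha : 0 < a) (hnum : ∃ n : ℤ, a * D.cr j x = n) :
    D.AStep lam a x (D.r j x) := by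
  refine ⟨j, _, _, Cov.simple hlam hx h, fun _ => ?_, fun h => absurd hj h⟩
  obtain ⟨n, hn⟩ := exists_nat_of_int hnum (by positivity)
  refine ⟨n, ?_, hn⟩
  have : 0 < a * D.cr j x := by positivity
  rw [hn] at this; exact_mod_cast this

lemma AStep.of_simple_neg (hlam : lam ∈ Pplus D.cr) (hx : D.T lam x) (hj : D.A j j = 2)
    (h : D.cr j x < 0) (ha : 0 < a) (hnum : ∃ n : ℤ, a * D.cr j x = n) :
    D.AStep lam a (D.r j x) x := by
  have := AStep.of_simple (x := D.r j x) hlam (hx.r j) hj (by rw [D.cr_r hj]; linarith) ha (by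
    obtain ⟨n, hn⟩ := hnum
    exact ⟨-n, by rw [D.cr_r hj, mul_neg, hn]; push_cast; rfl⟩)
  rwa [D.r_r hj] at this

lemma AStep.int_iff (h : D.AStep lam a x y) (i : I) :
    (∃ n : ℤ, a * D.cr i x = n) ↔ ∃ n : ℤ, a * D.cr i y = n := by
  obtain ⟨m, hm⟩ := Qplus_int h.sub_mem i
  have : a * D.cr i x - a * D.cr i y = m := by
    rw [← hm, map_smul, map_sub, smul_eq_mul]; ring
  constructor
  · rintro ⟨n, hn⟩; exact ⟨n - m, by push_cast; linarith⟩
  · rintro ⟨n, hn⟩; exact ⟨n + m, by push_cast; linarith⟩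

lemma R.int_iff (h : D.R lam a x y) (i : I) :
    (∃ n : ℤ, a * D.cr i x = n) ↔ ∃ n : ℤ, a * D.cr i y = n := by
  induction h with
  | refl => rfl
  | tail _ h ih => exact ih.trans (h.int_iff i)

lemma Cov.astep_transport (h : D.Cov lam x y k β βv) (hA : D.Adm a k (βv x)) (hj : D.A j j = 2)
    (hne : β ≠ D.α j) (hxy : 0 < D.cr j x * D.cr j y) :
    D.AStep lam a (D.r j x) (D.r j y) :=
  ⟨_, _, _, h.transport hj hne hxy, by rwa [crefl_apply_apply, D.r_r hj]⟩

lemma AStep.up_dn (hlam : lam ∈ Pplus D.cr) (ha : 0 < a) (h : D.AStep lam a x y)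
    (hj : D.A j j = 2) (hnum : ∃ n : ℤ, a * D.cr j x = n) :
    D.R lam a (D.up j x) (D.up j y) ∧ D.R lam a (D.dn j x) (D.dn j y) := by
  have hinty := (h.int_iff j).1 hnum
  have h0 := h
  obtain ⟨k, β, βv, h, hA⟩ := h
  by_cases hne : β = D.α j
  · subst hne
    obtain ⟨rfl, hx⟩ := h.eq_r
    have hy : D.cr j (D.r j x) < 0 := by rw [D.cr_r hj]; linarith
    rw [up_nonneg hx.le, up_neg hy, D.r_r hj, dn_pos hx, dn_nonpos hy.le]
    exact ⟨.refl, .refl⟩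
  obtain ⟨c1, c2⟩ := h.c1 hj hne
  rcases lt_trichotomy (D.cr j x) 0 with hx | hx | hx
  · rcases lt_or_ge (D.cr j y) 0 with hy | hy
    · rw [up_neg hx, up_neg hy, dn_nonpos hx.le, dn_nonpos hy.le]
      exact ⟨.single (h.astep_transport hA hj hne (by nlinarith)), .single h0⟩
    · rw [up_neg hx, up_nonneg hy, dn_nonpos hx.le]
      refine ⟨.head (AStep.of_simple_neg hlam h.T hj hx ha hnum) (.single h0), ?_⟩
      rcases hy.lt_or_eq with hy | hy
      · rw [dn_pos hy]
        exact .head h0 (.single (AStep.of_simple hlam h.T_right hj hy ha hinty))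
      · rw [dn_nonpos hy.ge]; exact .single h0
  · have hy := c2 hx.ge
    rw [up_nonneg hx.ge, up_nonneg hy, dn_nonpos hx.le]
    refine ⟨.single h0, ?_⟩
    rcases hy.lt_or_eq with hy | hy
    · rw [dn_pos hy]
      exact .head h0 (.single (AStep.of_simple hlam h.T_right hj hy ha hinty))
    · rw [dn_nonpos hy.ge]; exact .single h0
  · have hy := c1 hx
    rw [up_nonneg hx.le, up_nonneg hy.le, dn_pos hx, dn_pos hy]
    exact ⟨.single h0, .single (h.astep_transport hA hj hne (by positivity))⟩

lemma R.up_dn (hlam : lam ∈ Pplus D.cr) (ha : 0 < a) (h : D.R lam a x y) (hj : D.A j j = 2)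
    (hnum : ∃ n : ℤ, a * D.cr j x = n) :
    D.R lam a (D.up j x) (D.up j y) ∧ D.R lam a (D.dn j x) (D.dn j y) := by
  induction h with
  | refl => exact ⟨.refl, .refl⟩
  | tail h1 h2 ih =>
    obtain ⟨h3, h4⟩ := h2.up_dn hlam ha hj ((R.int_iff h1 j).1 hnum)
    exact ⟨ih.1.trans h3, ih.2.trans h4⟩

lemma R.up_to_dn (hlam : lam ∈ Pplus D.cr) (ha : 0 < a) (hx : D.T lam x) (h : D.R lam a x y)
    (hj : D.A j j = 2) (hnum : ∃ n : ℤ, a * D.cr j x = n) :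
    D.R lam a (D.up j x) (D.dn j y) := by
  refine Relation.ReflTransGen.trans ?_ (h.up_dn hlam ha hj hnum).2
  rcases lt_trichotomy (D.cr j x) 0 with h | h | h
  · rw [up_neg h, dn_nonpos h.le]
    exact .single (AStep.of_simple_neg hlam hx hj h ha hnum)
  · rw [up_nonneg h.ge, dn_nonpos h.le]
  · rw [up_nonneg h.le, dn_pos h]
    exact .single (AStep.of_simple hlam hx hj h ha hnum)

lemma AStep.ne_of_nonint (h : D.AStep lam a x y) (hj : D.A j j = 2)
    (hnum : ¬ ∃ n : ℤ, a * D.cr j x = n) :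
    (0 < D.cr j x → 0 < D.cr j y) ∧ (0 < D.cr j x * D.cr j y →
      D.AStep lam a (D.r j x) (D.r j y)) := by
  obtain ⟨k, β, βv, h, hA⟩ := h
  have hne : β ≠ D.α j := by
    rintro rfl
    obtain ⟨n, -, hn⟩ := hA.exists_nat
    rw [h.pair.cr_eq] at hn
    exact hnum ⟨n, by simpa using hn⟩
  exact ⟨(h.c1 hj hne).1, h.astep_transport hA hj hne⟩

lemma R.of_nonint (h : D.R lam a x y) (hj : D.A j j = 2) (hnum : ¬ ∃ n : ℤ, a * D.cr j x = n) :
    (0 < D.cr j x → 0 < D.cr j y) ∧ (0 < D.cr j x * D.cr j y →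
      D.R lam a (D.r j x) (D.r j y)) := by
  have hne : ∀ {z}, (¬ ∃ n : ℤ, a * D.cr j z = n) → D.cr j z ≠ 0 := by
    intro z hz h; exact hz ⟨0, by rw [h]; simp⟩
  induction h using Relation.ReflTransGen.head_induction_on with
  | refl => exact ⟨id, fun _ => .refl⟩
  | @head x z h1 h2 ih =>
    have hz : ¬ ∃ n : ℤ, a * D.cr j z = n := fun h => hnum ((h1.int_iff j).2 h)
    obtain ⟨i1, i2⟩ := ih hz
    obtain ⟨s1, s2⟩ := h1.ne_of_nonint hj hnum
    refine ⟨fun h => i1 (s1 h), fun h => ?_⟩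
    rcases (hne hnum).lt_or_gt with hx | hx
    · have hy : D.cr j y < 0 := by by_contra! h'; nlinarith
      have hz0 : D.cr j z < 0 := by
        rcases (hne hz).lt_or_gt with h' | h'
        · exact h'
        · have := i1 h'; linarith
      exact .head (s2 (by nlinarith)) (i2 (by nlinarith))
    · exact .head (s2 (mul_pos hx (s1 hx))) (i2 (mul_pos (s1 hx) (i1 (s1 hx))))

lemma R.same (hlam : lam ∈ Pplus D.cr) (ha : 0 < a) (h : D.R lam a x y) (hj : D.A j j = 2)
    (hxy : 0 < D.cr j x * D.cr j y) : D.R lam a (D.r j x) (D.r j y) := by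
  by_cases hnum : ∃ n : ℤ, a * D.cr j x = n
  · obtain ⟨h1, h2⟩ := h.up_dn hlam ha hj hnum
    rcases lt_trichotomy (D.cr j x) 0 with hx | hx | hx
    · have hy : D.cr j y < 0 := by by_contra! h'; nlinarith
      rwa [up_neg hx, up_neg hy] at h1
    · rw [hx, zero_mul] at hxy; exact absurd hxy (lt_irrefl _)
    · have hy : 0 < D.cr j y := by by_contra! h'; nlinarith
      rwa [dn_pos hx, dn_pos hy] at h2
  · exact (h.of_nonint hj hnum).2 hxy

lemma R.opp (h : D.R lam a x y) (hj : D.A j j = 2)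
    (hxy : (D.cr j y ≤ 0 ∧ 0 < D.cr j x) ∨ (D.cr j y < 0 ∧ 0 ≤ D.cr j x)) :
    ∃ n : ℤ, a * D.cr j x = n := by
  by_contra hnum
  have h1 := (h.of_nonint hj hnum).1
  have h0 : D.cr j x ≠ 0 := fun h => hnum ⟨0, by rw [h]; simp⟩
  rcases hxy with ⟨h2, h3⟩ | ⟨h2, h3⟩
  · linarith [h1 h3]
  · linarith [h1 (lt_of_le_of_ne h3 h0.symm)]

end Datum
end GKM

namespace GKM
namespace Datum

variable {I V : Type*} [AddCommGroup V] [Module ℚ V] (D : Datum I V) {i j k l : I}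
variable {β : V} {βv : V →ₗ[ℚ] ℚ} {lam x y z u v w : V} {a C s : ℚ}

/-- `z` has no `α_i`-component and is orthogonal to `α_i^∨`. -/
def Orth (i : I) (z : V) : Prop := D.crd z i = 0 ∧ D.cr i z = 0

variable {D}

lemma Orth.of_smul (hs : s ≠ 0) (h : D.Orth i (s • z)) : D.Orth i z := by
  obtain ⟨h1, h2⟩ := h
  simp [hs] at h1 h2
  exact ⟨h1, h2⟩

lemma Orth.smul (s : ℚ) (h : D.Orth i z) : D.Orth i (s • z) := by
  obtain ⟨h1, h2⟩ := h
  simp [Orth, h1, h2]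

lemma Orth.add (h : D.Orth i y) (h' : D.Orth i z) : D.Orth i (y + z) := by
  obtain ⟨h1, h2⟩ := h
  obtain ⟨h3, h4⟩ := h'
  simp [Orth, h1, h2, h3, h4]

lemma Orth.split (h1 : D.Cone y) (h2 : D.Cone z) (h : D.Orth i (y + z)) :
    D.Orth i y ∧ D.Orth i z := by
  obtain ⟨h3, h4⟩ := h
  simp at h3 h4
  have h5 := h1.crd_nonneg i
  have h6 := h2.crd_nonneg i
  have h7 : D.crd y i = 0 := by linarith
  have h8 : D.crd z i = 0 := by linarith
  have h9 := h1.cr_offsupp h7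
  have h10 := h2.cr_offsupp h8
  exact ⟨⟨h7, by linarith⟩, ⟨h8, by linarith⟩⟩

lemma Pair.orth_apply (h : D.Pair k β βv) (hm : β ∈ Qplus D.α) (ho : D.Orth i β) :
    βv (D.α i) = 0 :=
  ((h.pos hm).off ho.1).2.2.2 ho.2

lemma Step.orth (h : D.Step lam x y k β βv) (ho : D.Orth i (x - y)) : D.Orth i β := by
  rw [h.sub_eq] at ho
  exact ho.of_smul h.pos.ne'

lemma Step.shift (h : D.Step lam x y k β βv) (ho : D.Orth i (x - y))
    (hT : D.T lam (x + s • D.α i)) : D.Step lam (x + s • D.α i) (y + s • D.α i) k β βv := by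
  have e : βv (x + s • D.α i) = βv x := by
    rw [map_add, map_smul, h.pair.orth_apply h.mem (h.orth ho), smul_zero, add_zero]
  exact ⟨hT, h.pair, h.mem, by rw [e]; exact h.pos, by rw [e, h.eq]; abel⟩

lemma Ch.shift (hlam : lam ∈ Pplus D.cr) {m : ℕ} (h : D.Ch lam m x y) (ho : D.Orth i (x - y))
    (hT : D.T lam (x + s • D.α i)) : D.Ch lam m (x + s • D.α i) (y + s • D.α i) := by
  induction m generalizing x with
  | zero => obtain ⟨-, rfl⟩ := h; exact ⟨hT, rfl⟩
  | succ m ih =>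
    obtain ⟨z, ⟨k, β, βv, hs⟩, h⟩ := h
    have := Orth.split (Cone.of_Qplus (hs.sub_mem hlam)) (Cone.of_Qplus (h.sub_mem hlam))
      (by rwa [sub_add_sub_cancel])
    have h' := hs.shift this.1 hT
    exact Ch.cons h' (ih h this.2 h'.T_right)

lemma Cov.shift (hlam : lam ∈ Pplus D.cr) (h : D.Cov lam x y k β βv) (ho : D.Orth i (x - y))
    (hT : D.T lam (x + s • D.α i)) : D.Cov lam (x + s • D.α i) (y + s • D.α i) k β βv := by
  refine ⟨h.toStep.shift ho hT, fun m hm => h.max m ?_⟩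
  have := hm.shift (s := -s) (i := i) hlam (by rwa [add_sub_add_right_eq_sub])
    (by rw [neg_smul, add_neg_cancel_right]; exact h.T)
  simpa using this

lemma AStep.shift (hlam : lam ∈ Pplus D.cr) (h : D.AStep lam a x y) (ho : D.Orth i (x - y))
    (hT : D.T lam (x + s • D.α i)) : D.AStep lam a (x + s • D.α i) (y + s • D.α i) := by
  obtain ⟨k, β, βv, h, hA⟩ := h
  refine ⟨k, β, βv, h.shift hlam ho hT, ?_⟩
  rwa [map_add, map_smul, h.pair.orth_apply h.mem (h.toStep.orth ho), smul_zero, add_zero]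

lemma AStep.cone (ha : 0 < a) (h : D.AStep lam a x y) : D.Cone (x - y) :=
  R.cone ha (.single h)

lemma R.shift (hlam : lam ∈ Pplus D.cr) (ha : 0 < a) (h : D.R lam a x y) (ho : D.Orth i (x - y))
    (hT : D.T lam (x + s • D.α i)) : D.R lam a (x + s • D.α i) (y + s • D.α i) := by
  induction h using Relation.ReflTransGen.head_induction_on with
  | refl => exact .refl
  | @head x z h1 h2 ih =>
    have := Orth.split (h1.cone ha) (R.cone ha h2) (by rwa [sub_add_sub_cancel])
    have h' := h1.shift hlam this.1 hT
    exact .head h' (ih this.2 h'.T_right)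

lemma Cov.imag_neg (hlam : lam ∈ Pplus D.cr) (h : D.Cov lam x y k β βv) (hk : D.A k k ≠ 2)
    (hj : D.A j j = 2) (hpos : 0 < D.cr j β) : D.cr j x < 0 ∧ D.cr j y < 0 := by
  have hp := h.pair
  have hjk : k ≠ j := by rintro rfl; exact hk hj
  have hne : β ≠ D.α j := by
    rintro rfl
    exact hk (hp.real_iff.2 hj)
  obtain ⟨c1, c2⟩ := h.c1 hj hne
  have hq : 0 < βv (D.α j) := (hp.sign hk hj).1.2 hpos
  have hγ := h.T.pair_imag_nonneg hlam (hp.refl hj) hk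
  have e1 : crefl D.α D.cr j βv x = βv x - D.cr j x * βv (D.α j) := by
    rw [crefl_apply_apply, r_apply]; simp
  have e2 : D.cr j y = D.cr j x - βv x * D.cr j β := by rw [h.eq]; simp
  have hv := h.pos
  have hp1 : 1 ≤ D.cr j β := by
    obtain ⟨n, hn⟩ := Qplus_int h.mem j
    rw [hn] at hpos ⊢
    exact_mod_cast (by exact_mod_cast hpos : (0:ℤ) < n)
  have hq1 : 1 ≤ βv (D.α j) := by
    obtain ⟨c, c', -, rfl, -⟩ := hp.pos_imag hk
    have : ∃ n : ℤ, D.cs c' (D.α j) = n := by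
      rw [D.cs_α]
      exact ⟨c'.sum fun i n => n * D.A i j, by simp [Finsupp.sum]⟩
    obtain ⟨n, hn⟩ := this
    rw [hn] at hq ⊢
    exact_mod_cast (by exact_mod_cast hq : (0:ℤ) < n)
  rw [e1] at hγ
  have h3 : 0 < βv x * D.cr j β := by positivity
  have hx : D.cr j x < 0 := by
    by_contra! hx
    rcases hx.lt_or_eq with hx | hx
    · have := c1 hx
      have h3 : D.cr j x ≤ βv x * D.cr j β := by
        have : D.cr j x ≤ D.cr j x * βv (D.α j) := by nlinarith
        nlinarith
      linarith
    · have := c2 hx.le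
      linarith
  exact ⟨hx, by linarith⟩

/-- A cover along a `W`-translate of an imaginary `α_k`. -/
lemma Cov.imag_ge (hlam : lam ∈ Pplus D.cr) (h : D.Cov lam x y k β βv) (hk : D.A k k ≠ 2) :
    βv x ≤ D.cr k x := by
  refine imag_induction (P := fun β βv => ∀ x y, D.Cov lam x y k β βv → βv x ≤ D.cr k x) hk
    (fun _ _ _ => le_rfl) ?_ h.pair x y h
  intro j β βv hj hp hpos ih x y h
  have hjk : k ≠ j := by rintro rfl; exact hk hj
  have hne : β ≠ D.α j := by
    rintro rfl
    exact hk (hp.real_iff.2 hj)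
  obtain ⟨hx, hy⟩ := h.imag_neg hlam hk hj hpos
  have := ih _ _ (h.transport hj hne (by nlinarith))
  rw [crefl_apply_apply, D.r_r hj, r_apply, map_sub, map_smul, D.hpair, smul_eq_mul] at this
  have hA : (D.A k j : ℚ) ≤ 0 := by exact_mod_cast D.hoff k j hjk
  nlinarith

/-- Along an `a`-chain the value `a α_i^∨` (`i` imaginary) increases by natural numbers. -/
lemma AStep.orth (hlam : lam ∈ Pplus D.cr) (ha : 0 < a) (h : D.AStep lam a x y)
    (hi : D.A i i ≠ 2) (hlt : a * D.cr i y < 1) : D.Orth i (x - y) := by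
  have h0 := h
  obtain ⟨k, β, βv, h, hA⟩ := h
  have hx := h.T.imag_nonneg hlam hi
  have hn := (Cone.of_Qplus h0.sub_mem).cr_nonpos hi
  obtain ⟨n, hn'⟩ := Qplus_int h0.sub_mem i
  have hz : D.cr i (a • (x - y)) = 0 := by
    have h1 : a * D.cr i y = a * D.cr i x - n := by
      rw [← hn', map_smul, map_sub, smul_eq_mul]; ring
    have h2 : 0 ≤ a * D.cr i x := by positivity
    have h3 : (-1 : ℚ) < n := by linarith
    have h4 : (n : ℤ) ≤ 0 := by rw [hn'] at hn; exact_mod_cast hn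
    have h5 : (-1 : ℤ) < n := by exact_mod_cast h3
    rw [hn', show n = 0 by omega]; simp
  rw [map_smul, smul_eq_zero] at hz
  refine ⟨?_, hz.resolve_left ha.ne'⟩
  rw [h.sub_eq, map_smul, Finsupp.smul_apply, h.pair.crd_imag hi]
  split_ifs with hki
  · exfalso
    subst hki
    have h1 := h.imag_ge hlam hi
    have h2 := hA.2 hi
    have h3 := hz.resolve_left ha.ne'
    rw [map_sub] at h3
    nlinarith
  · simp

lemma AStep.cr_le (ha : 0 < a) (h : D.AStep lam a x y) (hi : D.A i i ≠ 2) :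
    D.cr i x ≤ D.cr i y := by
  have := (h.cone ha).cr_nonpos hi
  rw [map_sub] at this
  linarith

lemma R.cr_le (ha : 0 < a) (h : D.R lam a x y) (hi : D.A i i ≠ 2) :
    D.cr i x ≤ D.cr i y := by
  have := (h.cone ha).cr_nonpos hi
  rw [map_sub] at this
  linarith

lemma R.orth (hlam : lam ∈ Pplus D.cr) (ha : 0 < a) (h : D.R lam a x y)
    (hi : D.A i i ≠ 2) (hlt : a * D.cr i y < 1) : D.Orth i (x - y) := by
  induction h with
  | refl => simp [Orth]
  | tail h1 h2 ih =>
    have h3 := h2.orth hlam ha hi hlt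
    rw [← sub_add_sub_cancel]
    exact (ih (by have := h2.cr_le ha hi; nlinarith)).add h3

lemma R.imag_lb (hlam : lam ∈ Pplus D.cr) (ha : 0 < a) (haC : a * C = 1) (h : D.R lam a w x)
    (hi : D.A i i ≠ 2) (hc : 0 < D.crd (w - x) i) : (1 - D.A i i) * C ≤ D.cr i x := by
  induction h with
  | refl => simp at hc
  | @tail y z h1 h2 ih =>
    by_cases h3 : 0 < D.crd (w - y) i
    · exact (ih h3).trans (h2.cr_le ha hi)
    · obtain ⟨k, β, βv, h, hA⟩ := h2
      have h4 : 0 < D.crd (y - z) i := by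
        have : D.crd (w - z) i = D.crd (w - y) i + D.crd (y - z) i := by
          rw [← Finsupp.add_apply, ← map_add, sub_add_sub_cancel]
        linarith
      rw [h.sub_eq, map_smul, Finsupp.smul_apply, h.pair.crd_imag hi] at h4
      have hki : k = i := by by_contra hki; simp [hki] at h4
      subst hki
      have h5 := h.imag_ge hlam hi
      have h6 : βv y = C := by
        have := hA.2 hi
        rw [← haC] at this
        exact mul_left_cancel₀ ha.ne' this
      have h7 := (Cone.of_Qplus h.mem).cr_imag hi k
      rw [h.pair.crd_imag hi, if_pos rfl, mul_one] at h7
      have h8 := h.pos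
      rw [h.eq, map_sub, map_smul, smul_eq_mul, h6]
      rw [h6] at h5 h8
      nlinarith

/-- At the minimal possible value of `α_i^∨` the chain passes through `α_i` last. -/
lemma R.imag_extract (hlam : lam ∈ Pplus D.cr) (hw : D.T lam w) (ha : 0 < a) (haC : a * C = 1)
    (h : D.R lam a w x) (hi : D.A i i ≠ 2) (hc : 0 < D.crd (w - x) i)
    (hx : D.cr i x = (1 - D.A i i) * C) : D.R lam a w (x + C • D.α i) := by
  induction h with
  | refl => simp at hc
  | @tail y z h1 h2 ih =>
    have hz := hx
    have h20 := h2
    obtain ⟨k, β, βv, h, hA⟩ := h2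
    by_cases hki : k = i
    · subst hki
      have h6 : βv y = C := by
        have := hA.2 hi
        rw [← haC] at this
        exact mul_left_cancel₀ ha.ne' this
      have h5 := h.imag_ge hlam hi
      have h8 := h.pos
      rw [h.eq, map_sub, map_smul, smul_eq_mul, h6] at hx
      rw [h6] at h5 h8
      have e : β = D.α k := by
        refine (h.pair.eq_of_nbr hi fun l hl hl' => ?_).1
        have h10 : D.cr k β ≤ D.A k k + D.A k l * D.crd β l := by
          have hcone : D.Cone (β - D.α k) := by
            refine ⟨D.crd β - Finsupp.single k 1, fun m => ?_, ?_⟩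
            · by_cases hm : m = k
              · subst hm; simp [h.pair.crd_imag hi]
              · simp [Ne.symm hm, Qplus_crd_nonneg h.mem m]
            · rw [map_sub, ← (Cone.of_Qplus h.mem).eq]; simp
          have := hcone.cr_imag hi l
          simp [D.hpair, D.crd_α_ne (Ne.symm hl)] at this
          linarith
        have h11 : (D.A k k : ℚ) ≤ D.cr k β := by nlinarith
        have h12 : 0 ≤ (D.A k l : ℚ) * D.crd β l := by linarith
        have h13 : (D.A k l : ℚ) ≤ 0 := by exact_mod_cast D.A_nonpos hi l
        have h14 := Qplus_crd_nonneg h.mem l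
        have h15 : 0 < D.crd β l := lt_of_le_of_ne h14 (Ne.symm hl')
        have : (D.A k l : ℚ) = 0 := by nlinarith
        exact_mod_cast this
      have : z + C • D.α k = y := by rw [h.eq, h6, e]; abel
      rwa [this]
    · have h4 : D.crd (y - z) i = 0 := by
        rw [h.sub_eq, map_smul, Finsupp.smul_apply, h.pair.crd_imag hi, if_neg hki, smul_zero]
      have h3 : 0 < D.crd (w - y) i := by
        have : D.crd (w - z) i = D.crd (w - y) i + D.crd (y - z) i := by
          rw [← Finsupp.add_apply, ← map_add, sub_add_sub_cancel]
        linarith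
      have h5 := R.imag_lb hlam ha haC h1 hi h3
      have h6 := h20.cr_le ha hi
      have h7 : D.cr i y = (1 - D.A i i) * C := by linarith
      have h8 := ih h3 h7
      exact h8.tail (h20.shift hlam ⟨h4, by rw [map_sub]; linarith⟩ (R.T_right h8 hw))

end Datum
end GKM

namespace GKM
namespace Datum

variable {I V : Type*} [AddCommGroup V] [Module ℚ V] {D : Datum I V} {i j k l : I}
variable {lam x y z μ ν : V} {a : ℚ} {s : ℕ} {c β : ℕ → V} {βv : ℕ → (V →ₗ[ℚ] ℚ)} {ks : ℕ → I}

lemma ch_of_isChain (h : IsChain D.A D.α D.cr lam μ ν s c β βv) : D.Ch lam s ν μ := by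
  induction s generalizing ν with
  | zero => obtain ⟨rfl, h2, h3, -⟩ := h; exact ⟨h2 ▸ h3 0 le_rfl, h2.symm⟩
  | succ s ih =>
    obtain ⟨h1, rfl, h3, h4⟩ := h
    obtain ⟨⟨l, k, hp⟩, hm, hpos, he⟩ := h4 s (Nat.lt_succ_self s)
    exact Ch.cons (k := k) ⟨h3 _ le_rfl, ⟨l, hp⟩, hm, hpos, he⟩
      (ih ⟨h1, rfl, fun k hk => h3 k (by omega), fun k hk => h4 k (by omega)⟩)

lemma isChain_snoc {b : V} {bv : V →ₗ[ℚ] ℚ} (h : IsChain D.A D.α D.cr lam μ ν s c β βv)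
    (hs : D.Step lam x ν k b bv) :
    IsChain D.A D.α D.cr lam μ x (s + 1) (Function.update c (s + 1) x) (Function.update β s b)
      (Function.update βv s bv) := by
  obtain ⟨h1, h2, h3, h4⟩ := h
  refine ⟨by simp [h1], by simp, fun m hm => ?_, fun m hm => ?_⟩
  · rcases eq_or_ne m (s + 1) with rfl | hne
    · rw [Function.update_self]; exact hs.T
    · rw [Function.update_of_ne hne]; exact h3 m (by omega)
  · rcases eq_or_ne m s with rfl | hne
    · simp only [Function.update_self, Function.update_of_ne (Nat.lt_succ_self m).ne, h2]
      obtain ⟨l, hl⟩ := hs.pair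
      exact ⟨⟨l, k, hl⟩, hs.mem, hs.pos, hs.eq⟩
    · rw [Function.update_of_ne hne, Function.update_of_ne hne,
        Function.update_of_ne (by omega : m ≠ s + 1), Function.update_of_ne (by omega)]
      exact h4 m (by omega)

lemma Ch.isChain {m : ℕ} (h : D.Ch lam m x y) :
    ∃ c β βv, IsChain D.A D.α D.cr lam y x m c β βv := by
  induction m generalizing x with
  | zero =>
    obtain ⟨h, rfl⟩ := h
    exact ⟨fun _ => x, fun _ => 0, fun _ => 0, rfl, rfl, fun _ _ => h, fun k hk => by omega⟩
  | succ m ih =>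
    obtain ⟨z, ⟨k, b, bv, hs⟩, h⟩ := h
    obtain ⟨c, β, βv, h⟩ := ih h
    exact ⟨_, _, _, isChain_snoc h hs⟩

lemma Cov.distEq {b : V} {bv : V →ₗ[ℚ] ℚ} (h : D.Cov lam x y k b bv) :
    distEq D.A D.α D.cr lam y x 1 :=
  ⟨h.toStep.ch.isChain, fun m _ _ _ hm => h.max m (ch_of_isChain hm)⟩

lemma transGen_of_hasAChain (h : HasAChain D.A D.α D.cr lam a μ ν) :
    Relation.TransGen (D.AStep lam a) ν μ := by
  obtain ⟨s, c, β, βv, ks, h1, ⟨rfl, rfl, h4, h5⟩, h6⟩ := h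
  have hst : ∀ k < s, D.AStep lam a (c (k + 1)) (c k) := by
    intro k hk
    obtain ⟨hp, ⟨-, hd⟩, ha⟩ := h6 k hk
    obtain ⟨-, hm, hpos, he⟩ := h5 k hk
    exact ⟨ks k, β k, βv k, ⟨⟨h4 _ hk, hp, hm, hpos, he⟩, fun m hm => by
      obtain ⟨c', β', βv', hc⟩ := hm.isChain
      exact hd m _ _ _ hc⟩, ha⟩
  clear h4 h5 h6
  induction s with
  | zero => omega
  | succ s ih =>
    rcases Nat.eq_zero_or_pos s with rfl | hs
    · exact .single (hst 0 one_pos)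
    · exact .head (hst s (Nat.lt_succ_self s)) (ih hs fun k hk => hst k (by omega))

lemma hasAChain_of_transGen (h : Relation.TransGen (D.AStep lam a) ν μ) :
    HasAChain D.A D.α D.cr lam a μ ν := by
  induction h using Relation.TransGen.head_induction_on with
  | @single x h =>
    obtain ⟨k, b, bv, h, hA⟩ := h
    have h0 : IsChain D.A D.α D.cr lam μ μ 0 (fun _ => μ) (fun _ => b) (fun _ => bv) :=
      ⟨rfl, rfl, fun _ _ => h.T_right, fun k hk => by omega⟩
    refine ⟨1, _, _, _, fun _ => k, le_rfl, isChain_snoc h0 h.toStep, fun m hm => ?_⟩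
    obtain rfl : m = 0 := by omega
    simp only [Function.update_self, zero_add, Function.update_of_ne zero_ne_one]
    exact ⟨h.pair, h.distEq, hA⟩
  | @head x z h h' ih =>
    obtain ⟨k, b, bv, h, hA⟩ := h
    obtain ⟨s, c, β, βv, ks, h1, h2, h3⟩ := ih
    refine ⟨s + 1, _, _, _, Function.update ks s k, by omega, isChain_snoc h2 h.toStep,
      fun m hm => ?_⟩
    rcases eq_or_ne m s with rfl | hne
    · simp only [Function.update_self, Function.update_of_ne (Nat.lt_succ_self m).ne, h2.2.1]
      exact ⟨h.pair, h.distEq, hA⟩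
    · rw [Function.update_of_ne hne, Function.update_of_ne hne, Function.update_of_ne hne,
        Function.update_of_ne (by omega : m ≠ s + 1), Function.update_of_ne (by omega)]
      exact h3 m (by omega)

lemma hasAChain_iff : HasAChain D.A D.α D.cr lam a μ ν ↔ Relation.TransGen (D.AStep lam a) ν μ :=
  ⟨transGen_of_hasAChain, hasAChain_of_transGen⟩

end Datum
end GKM

namespace GKM
namespace Datum

variable {I V : Type*} [AddCommGroup V] [Module ℚ V] (D : Datum I V) {i j k l : I}
variable {lam x y z : V} {N M : ℕ} {d : ℕ → V} {π : ℚ → V}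

/-- The path with velocity `d k` on `[k/N, (k+1)/N]`. -/
noncomputable def pth (N : ℕ) (d : ℕ → V) (t : ℚ) : V :=
  ∑ k ∈ Finset.range N, (min t (((k + 1 : ℕ) : ℚ) / N) - min t ((k : ℚ) / N)) • d k

lemma glsPath_eq {lamseq : ℕ → V} {a : ℕ → ℚ} {s : ℕ} (ha : ∀ k < s, a k ≤ a (k + 1)) (t : ℚ) :
    glsPath lamseq a s t = ∑ k ∈ Finset.range s, (min t (a (k + 1)) - min t (a k)) • lamseq
    (k + 1) := by
  refine Finset.sum_congr rfl fun k hk => ?_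
  have := ha k (Finset.mem_range.1 hk)
  congr 1
  rcases le_total t (a k) with h | h
  · rw [min_eq_left h, min_eq_left (h.trans this), max_eq_right (by linarith), sub_self]
  · rw [min_eq_right h, max_eq_left]
    rw [sub_nonneg]; exact le_min h this

/-- Data of a GLS path on the grid `(1/N)ℤ`. -/
structure Grd (lam : V) (N : ℕ) (d : ℕ → V) : Prop where
  pos : 0 < N
  ge : ∀ k, N ≤ k → d k = lam
  R : ∀ k < N, D.R lam (((k + 1 : ℕ) : ℚ) / N) (d (k + 1)) (d k)

variable {D}

lemma Grd.T (h : D.Grd lam N d) (k : ℕ) : D.T lam (d k) := by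
  rcases le_or_gt N k with hk | hk
  · rw [h.ge k hk]; exact T.self D
  · obtain ⟨n, hn⟩ := Nat.exists_eq_add_of_le hk.le
    clear hk
    induction n generalizing k with
    | zero => rw [h.ge k (by omega)]; exact T.self D
    | succ n ih => exact R.T_right (h.R k (by omega)) (ih (k + 1) (by omega))

lemma Grd.R1 (h : D.Grd lam N d) {k : ℕ} (hk : k + 1 = N) : D.R lam 1 lam (d k) := by
  have := h.R k (by omega)
  rwa [hk, h.ge N le_rfl, div_self (by have := h.pos; positivity)] at this

section convert

variable {s : ℕ} {lamseq : ℕ → V} {a : ℕ → ℚ} {b : ℕ → ℕ}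

lemma mono_of_succ (hb : ∀ k < s, b k ≤ b (k + 1)) {m n : ℕ} (hmn : m ≤ n) (hn : n ≤ s) :
    b m ≤ b n := by
  induction n, hmn using Nat.le_induction with
  | base => exact le_rfl
  | succ n hmn ih => exact (ih (by omega)).trans (hb n (by omega))

lemma exists_cell (h0 : b 0 = 0) {l : ℕ} (hl : l < b s) :
    ∃ k < s, b k ≤ l ∧ l < b (k + 1) := by
  induction s with
  | zero => omega
  | succ s ih =>
    rcases lt_or_ge l (b s) with h | h
    · obtain ⟨k, hk, h⟩ := ih h; exact ⟨k, by omega, h⟩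
    · exact ⟨s, by omega, h, hl⟩

lemma pth_of_cells (hN : 0 < N) (h0 : b 0 = 0) (hs : b s = N) (hb : ∀ k < s, b k ≤ b (k + 1))
    (hab : ∀ k ≤ s, (b k : ℚ) = N * a k)
    (hd : ∀ k < s, ∀ l, b k ≤ l → l < b (k + 1) → d l = lamseq (k + 1)) :
    glsPath lamseq a s = pth N d := by
  have hN' : (0 : ℚ) < N := by exact_mod_cast hN
  have hab' : ∀ k ≤ s, a k = (b k : ℚ) / N := fun k hk => by
    rw [hab k hk, mul_div_cancel_left₀ _ hN'.ne']
  funext t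
  rw [glsPath_eq (fun k hk => by
    rw [hab' k (by omega), hab' (k + 1) (by omega)]
    have := hb k hk
    gcongr)]
  rw [pth, ← hs]
  have hh : ∀ n ≤ s, ∑ k ∈ Finset.range n, (min t (a (k + 1)) - min t (a k)) • lamseq (k + 1) =
      ∑ k ∈ Finset.range (b n), (min t (((k + 1 : ℕ) : ℚ) / N) - min t ((k : ℚ) / N)) • d k := by
    intro n hn
    induction n with
    | zero => simp [h0]
    | succ n ih =>
      rw [Finset.sum_range_succ, ih (by omega),
        ← Finset.sum_range_add_sum_Ico _ (hb n (by omega))]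
      congr 1
      rw [Finset.sum_congr rfl (g := fun k : ℕ =>
        (min t (((k + 1 : ℕ) : ℚ) / N) - min t ((k : ℚ) / N)) • lamseq (n + 1)) fun k hk => by
          rw [hd n (by omega) k (Finset.mem_Ico.1 hk).1 (Finset.mem_Ico.1 hk).2],
        ← Finset.sum_smul, Finset.sum_Ico_sub (fun k : ℕ => min t ((k : ℚ) / N)) (hb n (by omega)),
        hab' n (by omega), hab' (n + 1) (by omega)]
  rw [hh s le_rfl, hs]

lemma exists_denom (s : ℕ) (ha : ∀ k ≤ s, 0 ≤ a k) :
    ∃ N : ℕ, 0 < N ∧ ∃ b : ℕ → ℕ, ∀ k ≤ s, (b k : ℚ) = N * a k := by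
  suffices ∃ N : ℕ, 0 < N ∧ ∀ k ≤ s, ∃ b : ℕ, (b : ℚ) = N * a k by
    obtain ⟨N, hN, h⟩ := this
    choose! b hb using h
    exact ⟨N, hN, b, hb⟩
  have h1 : ∀ k ≤ s, ∃ b : ℕ, (b : ℚ) = (a k).den * a k := by
    intro k hk
    refine ⟨(a k).num.toNat, ?_⟩
    have : ((a k).num.toNat : ℤ) = (a k).num := Int.toNat_of_nonneg (Rat.num_nonneg.2 (ha k hk))
    rw [Rat.den_mul_eq_num]
    exact_mod_cast this
  refine ⟨∏ k ∈ Finset.range (s + 1), (a k).den, Finset.prod_pos fun k _ => (a k).den_pos,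
    fun k hk => ?_⟩
  obtain ⟨b, hb⟩ := h1 k hk
  refine ⟨(∏ m ∈ (Finset.range (s + 1)).erase k, (a m).den) * b, ?_⟩
  rw [← Finset.mul_prod_erase _ _ (Finset.mem_range.2 (Nat.lt_succ_of_le hk))]
  push_cast
  rw [hb]; ring

open Classical in
lemma exists_grd_of_cells (hN : 0 < N) (h0 : b 0 = 0) (hs : b s = N) (hb : ∀ k < s, b k < b (k + 1))
    (hab : ∀ k ≤ s, (b k : ℚ) = N * a k)
    (hR : ∀ k, 1 ≤ k → k < s → D.R lam (a k) (lamseq (k + 1)) (lamseq k))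
    (hR1 : D.R lam 1 lam (lamseq s)) :
    ∃ d, D.Grd lam N d ∧ glsPath lamseq a s = pth N d := by
  have hN' : (0 : ℚ) < N := by exact_mod_cast hN
  have hb' : ∀ k < s, b k ≤ b (k + 1) := fun k hk => (hb k hk).le
  let d : ℕ → V := fun l => if h : ∃ k < s, b k ≤ l ∧ l < b (k + 1) then lamseq (h.choose + 1) else lam
  have hd : ∀ k < s, ∀ l, b k ≤ l → l < b (k + 1) → d l = lamseq (k + 1) := by
    intro k hk l h1 h2
    have h : ∃ k < s, b k ≤ l ∧ l < b (k + 1) := ⟨k, hk, h1, h2⟩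
    have e : h.choose = k := by
      obtain ⟨h3, h4, h5⟩ := h.choose_spec
      rcases lt_trichotomy h.choose k with h6 | h6 | h6
      · have := mono_of_succ hb' (show h.choose + 1 ≤ k by omega) hk.le
        omega
      · exact h6
      · have := mono_of_succ hb' (show k + 1 ≤ h.choose by omega) h3.le
        omega
    simp only [d, dif_pos h, e]
  have hge : ∀ k, N ≤ k → d k = lam := by
    intro l hl
    simp only [d]
    rw [dif_neg]
    rintro ⟨k, hk, h1, h2⟩
    have := mono_of_succ hb' (show k + 1 ≤ s by omega) le_rfl
    omega
  refine ⟨d, ⟨hN, hge, fun l hl => ?_⟩, pth_of_cells hN h0 hs hb' hab hd⟩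
  obtain ⟨k, hk, h1, h2⟩ := exists_cell h0 (hs ▸ hl)
  rw [hd k hk l h1 h2]
  rcases lt_or_ge (l + 1) (b (k + 1)) with h3 | h3
  · rw [hd k hk (l + 1) (by omega) h3]
  · have h4 : l + 1 = b (k + 1) := by omega
    rw [h4, hab (k + 1) (by omega), mul_div_cancel_left₀ _ hN'.ne']
    rcases Nat.lt_or_ge (k + 1) s with h5 | h5
    · rw [hd (k + 1) h5 _ le_rfl (hb _ h5)]
      exact hR (k + 1) (by omega) h5
    · obtain rfl : k + 1 = s := by omega
      have h6 : a (k + 1) = 1 := by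
        have := hab (k + 1) le_rfl
        rw [hs] at this
        field_simp at this
        exact this.symm
      rw [hge _ hs.ge, h6]
      exact hR1

end convert

lemma exists_grd (h : π ∈ GLSset D.A D.α D.cr lam) : ∃ N d, D.Grd lam N d ∧ π = pth N d := by
  obtain ⟨s, lamseq, a, ⟨h1, h2, h3, h4, h5, h6, h7⟩, rfl⟩ := h
  have hpos : ∀ k ≤ s, 0 ≤ a k := by
    intro k hk
    induction k with
    | zero => exact h2.ge
    | succ k ih => exact (ih (by omega)).trans (h4 k (by omega)).le
  obtain ⟨N, hN, b, hb⟩ := exists_denom s hpos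
  have hN' : (0 : ℚ) < N := by exact_mod_cast hN
  obtain ⟨d, hd, e⟩ := exists_grd_of_cells (D := D) (lam := lam) (lamseq := lamseq) hN
    (by have := hb 0 (by omega); rw [h2, mul_zero] at this; exact_mod_cast this)
    (by have := hb s le_rfl; rw [h3, mul_one] at this; exact_mod_cast this)
    (fun k hk => by
      have e1 := hb k (by omega)
      have e2 := hb (k + 1) (by omega)
      have : (b k : ℚ) < b (k + 1) := by rw [e1, e2]; have := h4 k hk; gcongr
      exact_mod_cast this) hb
    (fun k hk hk' => (hasAChain_iff.1 (h6 k hk hk')).to_reflTransGen)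
    (by
      rcases h7 with h7 | h7
      · rw [h7]
      · exact (hasAChain_iff.1 h7).to_reflTransGen)
  exact ⟨N, d, hd, e⟩

lemma Grd.mem (h : D.Grd lam N d) : pth N d ∈ GLSset D.A D.α D.cr lam := by
  have hN' : (0 : ℚ) < N := by exact_mod_cast h.pos
  have key : ∀ k, k + 1 ≤ N → ∃ s, ∃ lamseq : ℕ → V, ∃ a : ℕ → ℚ, a 0 = 0 ∧
      a (s + 1) = ((k + 1 : ℕ) : ℚ) / N ∧ lamseq (s + 1) = d k ∧ (∀ m < s + 1, a m < a (m + 1)) ∧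
      (∀ m, 1 ≤ m → m ≤ s + 1 → D.T lam (lamseq m)) ∧
      (∀ m, 1 ≤ m → m < s + 1 → HasAChain D.A D.α D.cr lam (a m) (lamseq m) (lamseq (m + 1))) ∧
      ∀ t, ∑ m ∈ Finset.range (s + 1), (min t (a (m + 1)) - min t (a m)) • lamseq (m + 1) =
        ∑ m ∈ Finset.range (k + 1), (min t (((m + 1 : ℕ) : ℚ) / N) - min t ((m : ℚ) / N)) • d m := by
    intro k hk
    induction k with
    | zero =>
      refine ⟨0, fun _ => d 0, fun m => (m : ℚ) / N, by simp, by simp, rfl, fun m hm => ?_,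
        fun _ _ _ => h.T 0, fun m h1 h2 => by omega, fun t => by simp⟩
      obtain rfl : m = 0 := by omega
      simp [h.pos]
    | succ k ih =>
      obtain ⟨s, lamseq, a, h0, h1, h2, h3, h4, h5, h6⟩ := ih (by omega)
      have hlt : a (s + 1) < ((k + 1 + 1 : ℕ) : ℚ) / N := by
        rw [h1]; gcongr; omega
      by_cases heq : d (k + 1) = d k
      · refine ⟨s, lamseq, Function.update a (s + 1) (((k + 1 + 1 : ℕ) : ℚ) / N), by simp [h0],
          by simp, by rw [h2, heq], fun m hm => ?_, h4, fun m hm hm' => ?_, fun t => ?_⟩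
        · rcases eq_or_ne m s with rfl | hne
          · rw [Function.update_self, Function.update_of_ne (by omega)]
            exact (h3 m hm).trans hlt
          · rw [Function.update_of_ne (by omega), Function.update_of_ne (by omega)]
            exact h3 m hm
        · rw [Function.update_of_ne (by omega)]
          exact h5 m hm hm'
        · have e := h6 t
          rw [Finset.sum_range_succ] at e ⊢
          rw [Finset.sum_range_succ _ (k + 1), ← e, heq, ← h1]
          have e3 : ∑ x ∈ Finset.range s,
              (min t (Function.update a (s + 1) (((k + 1 + 1 : ℕ) : ℚ) / N) (x + 1)) -
                min t (Function.update a (s + 1) (((k + 1 + 1 : ℕ) : ℚ) / N) x)) • lamseq (x + 1) =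
              ∑ x ∈ Finset.range s, (min t (a (x + 1)) - min t (a x)) • lamseq (x + 1) :=
            Finset.sum_congr rfl fun m hm => by
              rw [Finset.mem_range] at hm
              rw [Function.update_of_ne (by omega), Function.update_of_ne (by omega)]
          rw [e3, Function.update_self, Function.update_of_ne (by omega), h2]
          module
      · refine ⟨s + 1, Function.update lamseq (s + 1 + 1) (d (k + 1)),
          Function.update a (s + 1 + 1) (((k + 1 + 1 : ℕ) : ℚ) / N), by simp [h0],
          by simp, by simp, fun m hm => ?_, fun m hm hm' => ?_, fun m hm hm' => ?_, fun t => ?_⟩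
        · rcases eq_or_ne m (s + 1) with rfl | hne
          · rw [Function.update_self, Function.update_of_ne (by omega)]
            exact hlt
          · rw [Function.update_of_ne (by omega), Function.update_of_ne (by omega)]
            exact h3 m (by omega)
        · rcases eq_or_ne m (s + 1 + 1) with rfl | hne
          · rw [Function.update_self]; exact h.T _
          · rw [Function.update_of_ne (by omega)]; exact h4 m hm (by omega)
        · rcases eq_or_ne m (s + 1) with rfl | hne
          · rw [Function.update_self, Function.update_of_ne (by omega),
              Function.update_of_ne (by omega), h1, h2, hasAChain_iff]
            rcases Relation.reflTransGen_iff_eq_or_transGen.1 (h.R k (by omega)) with h' | h'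
            · exact absurd h'.symm heq
            · exact h'
          · rw [Function.update_of_ne (by omega), Function.update_of_ne (by omega),
              Function.update_of_ne (by omega)]
            exact h5 m hm (by omega)
        · rw [Finset.sum_range_succ, Finset.sum_range_succ _ (k + 1), ← h6 t, Function.update_self,
            Function.update_self, Function.update_of_ne (by omega), ← h1]
          congr 1
          refine Finset.sum_congr rfl fun m hm => ?_
          rw [Finset.mem_range] at hm
          rw [Function.update_of_ne (by omega), Function.update_of_ne (by omega),
            Function.update_of_ne (by omega)]
  obtain ⟨n, rfl⟩ : ∃ n, N = n + 1 := ⟨N - 1, by have := h.pos; omega⟩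
  obtain ⟨s, lamseq, a, h0, h1, h2, h3, h4, h5, h6⟩ := key n le_rfl
  rw [div_self hN'.ne'] at h1
  refine ⟨s + 1, lamseq, a, ⟨by omega, h0, h1, h3, h4, h5, ?_⟩, ?_⟩
  · rw [h2]
    rcases Relation.reflTransGen_iff_eq_or_transGen.1 (h.R1 rfl) with h' | h'
    · exact Or.inl h'
    · exact Or.inr (hasAChain_iff.2 h')
  · funext t
    rw [glsPath_eq (fun k hk => (h3 k hk).le), h6 t, pth]

lemma pth_refine (hN : 0 < N) (hM : 0 < M) : pth (N * M) (fun k => d (k / M)) = pth N d := by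
  have := pth_of_cells (N := N * M) (d := fun k => d (k / M)) (b := fun k => k * M) (s := N)
    (lamseq := fun k => d (k - 1)) (a := fun k => (k : ℚ) / N) (by positivity) (by simp) rfl
    (fun k _ => by gcongr; omega) (fun k _ => by
      have : (N : ℚ) ≠ 0 := by positivity
      push_cast; field_simp) (fun k _ l h1 h2 => by
      simp only [Nat.add_sub_cancel]
      rw [Nat.div_eq_of_lt_le h1 h2])
  rw [← this]
  funext t
  rw [glsPath_eq fun k _ => by gcongr; omega]
  simp [pth]

lemma Grd.refine (h : D.Grd lam N d) (hM : 0 < M) : D.Grd lam (N * M) (fun k => d (k / M)) := by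
  refine ⟨Nat.mul_pos h.pos hM, fun k hk => h.ge _ ((Nat.le_div_iff_mul_le hM).2 hk), fun k hk => ?_⟩
  have hk' : k / M < N := (Nat.div_lt_iff_lt_mul hM).2 hk
  have e0 : (k + 1) / M = k / M ∨ ((k + 1) / M = k / M + 1 ∧ M ∣ k + 1) := by
    have := Nat.succ_div (a := k) (b := M)
    split_ifs at this with h1
    · exact Or.inr ⟨this, h1⟩
    · exact Or.inl this
  rcases e0 with e | ⟨e, h2⟩
  · simp only [e]; exact .refl
  · simp only [e]
    obtain ⟨c, hc⟩ := h2
    have e2 : k / M + 1 = c := by rw [← e, hc, Nat.mul_div_cancel_left _ hM]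
    have := h.R (k / M) hk'
    have e3 : ((k + 1 : ℕ) : ℚ) / (N * M : ℕ) = ((k / M + 1 : ℕ) : ℚ) / N := by
      rw [e2, hc]
      have : (M : ℚ) ≠ 0 := by positivity
      have : (N : ℚ) ≠ 0 := by have := h.pos; positivity
      push_cast
      field_simp
    rwa [e3]

end Datum
end GKM

namespace GKM

/-- Values of `h` on `[t, 1]`. -/
def tailVals (h : ℚ → ℚ) (t : ℚ) : Set ℚ := {y | ∃ u, t ≤ u ∧ u ≤ 1 ∧ h u = y}

open Classical in
/-- The minimum of `h` on `[t, 1]` (if it exists). -/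
noncomputable def fm (h : ℚ → ℚ) (t : ℚ) : ℚ :=
  if H : ∃ y, IsLeast (tailVals h t) y then H.choose else 0

/-- The multiplicity of `α_j` subtracted at time `t` by the `n`-th power of `f_j`. -/
noncomputable def cf (h : ℚ → ℚ) (n t : ℚ) : ℚ := min n (fm h t - fm h 0)

lemma fm_eq {h : ℚ → ℚ} {t y : ℚ} (H : IsLeast (tailVals h t) y) : fm h t = y := by
  have h1 : ∃ y, IsLeast (tailVals h t) y := ⟨y, H⟩
  rw [fm, dif_pos h1]
  exact h1.choose_spec.unique H

/-- The `k`-th node of the grid. -/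
def nd (N k : ℕ) : ℚ := (k : ℚ) / N

/-- A point of the `k`-th cell of the grid. -/
def cl (N k : ℕ) (s : ℚ) : ℚ := ((k : ℚ) + s) / N

lemma cl_zero (N k : ℕ) : cl N k 0 = nd N k := by simp [cl, nd]
lemma cl_one (N k : ℕ) : cl N k 1 = nd N (k + 1) := by simp [cl, nd]
lemma nd_zero (N : ℕ) : nd N 0 = 0 := by simp [nd]
lemma nd_self {N : ℕ} (hN : 0 < N) : nd N N = 1 := by
  have : (N : ℚ) ≠ 0 := by positivity
  simp [nd, this]

lemma cl_le {N k : ℕ} {s s' : ℚ} (h : s ≤ s') : cl N k s ≤ cl N k s' := by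
  unfold cl; gcongr

lemma nd_mono {N k k' : ℕ} (h : k ≤ k') : nd N k ≤ nd N k' := by
  unfold nd; gcongr

lemma nd_nonneg (N k : ℕ) : 0 ≤ nd N k := by unfold nd; positivity

lemma nd_le_one {N k : ℕ} (hN : 0 < N) (h : k ≤ N) : nd N k ≤ 1 := by
  rw [← nd_self hN]; exact nd_mono h

lemma nd_le_cl {N k : ℕ} {s : ℚ} (h : 0 ≤ s) : nd N k ≤ cl N k s := by
  rw [← cl_zero]; exact cl_le h

lemma cl_le_nd {N k : ℕ} {s : ℚ} (h : s ≤ 1) : cl N k s ≤ nd N (k + 1) := by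
  rw [← cl_one]; exact cl_le h

lemma exists_cl {N k : ℕ} (hN : 0 < N) {u : ℚ} (h1 : nd N k ≤ u) (h2 : u ≤ nd N (k + 1)) :
    ∃ s, 0 ≤ s ∧ s ≤ 1 ∧ u = cl N k s := by
  have : (0 : ℚ) < N := by positivity
  unfold nd at h1 h2
  rw [div_le_iff₀ this] at h1
  rw [le_div_iff₀ this] at h2
  push_cast at h2
  refine ⟨u * N - k, by linarith, by linarith, ?_⟩
  unfold cl; field_simp; ring

lemma exists_cell_of_mem {N : ℕ} (hN : 0 < N) {t : ℚ} (h0 : 0 ≤ t) (h1 : t ≤ 1) :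
    ∃ k < N, ∃ s, 0 ≤ s ∧ s ≤ 1 ∧ t = cl N k s := by
  have : ∀ n, n ≤ N → t ≤ nd N n → 0 < n → ∃ k < N, ∃ s, 0 ≤ s ∧ s ≤ 1 ∧ t = cl N k s := by
    intro n hn ht hpos
    induction n with
    | zero => omega
    | succ n ih =>
      rcases le_total t (nd N n) with h | h
      · rcases Nat.eq_zero_or_pos n with rfl | hp
        · exact ⟨0, hN, exists_cl hN (by rwa [nd_zero]) ht⟩
        · exact ih (by omega) h hp
      · exact ⟨n, by omega, exists_cl hN h ht⟩
  exact this N le_rfl (by rwa [nd_self hN]) hN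

/-- Functions linear on the cells of the grid. -/
structure PL (N : ℕ) (h : ℚ → ℚ) : Prop where
  pos : 0 < N
  lin : ∀ k < N, ∀ s, 0 ≤ s → s ≤ 1 →
    h (cl N k s) = h (nd N k) + s * (h (nd N (k + 1)) - h (nd N k))

section

variable {N k : ℕ} {h : ℚ → ℚ} {s t u y : ℚ}

lemma PL.least_cl (H : PL N h) (hk : k < N) (hs : 0 ≤ s) (hs' : s ≤ 1)
    (hy : IsLeast (tailVals h (nd N (k + 1))) y) :
    IsLeast (tailVals h (cl N k s)) (min (h (cl N k s)) y) := by
  have hN := H.pos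
  have h1 := nd_le_one hN (show k + 1 ≤ N by omega)
  constructor
  · rcases min_choice (h (cl N k s)) y with e | e
    · rw [e]; exact ⟨_, le_rfl, (cl_le_nd hs').trans h1, rfl⟩
    · rw [e]
      obtain ⟨u, hu, hu', e⟩ := hy.1
      exact ⟨u, (cl_le_nd hs').trans hu, hu', e⟩
  · rintro _ ⟨u, hu, hu', rfl⟩
    rcases le_total (nd N (k + 1)) u with h2 | h2
    · exact (min_le_right _ _).trans (hy.2 ⟨u, h2, hu', rfl⟩)
    · obtain ⟨s', h3, h4, rfl⟩ := exists_cl hN ((nd_le_cl hs).trans hu) h2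
      have h5 := hy.2 ⟨_, le_rfl, h1, rfl⟩
      have h6 : s ≤ s' := by
        unfold cl at hu
        have : (0 : ℚ) < N := by positivity
        rw [div_le_div_iff_of_pos_right this] at hu
        linarith
      rw [H.lin k hk s' h3 h4, H.lin k hk s hs hs']
      rcases le_total (h (nd N k)) (h (nd N (k + 1))) with h7 | h7
      · refine (min_le_left _ _).trans ?_
        nlinarith
      · refine (min_le_right _ _).trans ?_
        nlinarith

lemma PL.exists_least_nd (H : PL N h) (hk : k ≤ N) : ∃ y, IsLeast (tailVals h (nd N k)) y := by
  obtain ⟨n, hn⟩ := Nat.exists_eq_add_of_le hk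
  induction n generalizing k with
  | zero =>
    obtain rfl : N = k := by simpa using hn
    refine ⟨h 1, ⟨1, by rw [nd_self H.pos], le_rfl, rfl⟩, ?_⟩
    rintro _ ⟨u, hu, hu', rfl⟩
    rw [nd_self H.pos] at hu
    rw [le_antisymm hu' hu]
  | succ n ih =>
    obtain ⟨y, hy⟩ := ih (k := k + 1) (by omega) (by omega)
    have := H.least_cl (k := k) (by omega) le_rfl zero_le_one hy
    rw [cl_zero] at this
    exact ⟨_, this⟩

lemma PL.exists_least (H : PL N h) (h0 : 0 ≤ t) (h1 : t ≤ 1) : ∃ y, IsLeast (tailVals h t) y := by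
  obtain ⟨k, hk, s, hs, hs', rfl⟩ := exists_cell_of_mem H.pos h0 h1
  obtain ⟨y, hy⟩ := H.exists_least_nd (k := k + 1) (by omega)
  exact ⟨_, H.least_cl hk hs hs' hy⟩

lemma PL.fm_least (H : PL N h) (h0 : 0 ≤ t) (h1 : t ≤ 1) : IsLeast (tailVals h t) (fm h t) := by
  obtain ⟨y, hy⟩ := H.exists_least h0 h1
  rwa [fm_eq hy]

lemma PL.fm_le (H : PL N h) (h0 : 0 ≤ t) (hu : t ≤ u) (h1 : u ≤ 1) : fm h t ≤ h u :=
  (H.fm_least h0 (hu.trans h1)).2 ⟨u, hu, h1, rfl⟩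

lemma PL.fm_att (H : PL N h) (h0 : 0 ≤ t) (h1 : t ≤ 1) : ∃ u, t ≤ u ∧ u ≤ 1 ∧ h u = fm h t :=
  (H.fm_least h0 h1).1

lemma PL.fm_mono (H : PL N h) (h0 : 0 ≤ t) (hu : t ≤ u) (h1 : u ≤ 1) : fm h t ≤ fm h u := by
  obtain ⟨v, h2, h3, h4⟩ := H.fm_att (h0.trans hu) h1
  rw [← h4]
  exact H.fm_le h0 (hu.trans h2) h3

lemma PL.fm_cl (H : PL N h) (hk : k < N) (hs : 0 ≤ s) (hs' : s ≤ 1) :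
    fm h (cl N k s) = min (h (cl N k s)) (fm h (nd N (k + 1))) :=
  fm_eq (H.least_cl hk hs hs' (H.fm_least (nd_nonneg _ _) (nd_le_one H.pos (by omega))))

lemma PL.fm_nd (H : PL N h) (hk : k < N) :
    fm h (nd N k) = min (h (nd N k)) (fm h (nd N (k + 1))) := by
  have := H.fm_cl hk le_rfl zero_le_one
  rwa [cl_zero] at this

lemma PL.fm_one (H : PL N h) : fm h 1 = h 1 := by
  obtain ⟨u, h1, h2, h3⟩ := H.fm_att zero_le_one le_rfl
  rw [← h3, le_antisymm h2 h1]

end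

/-- Integrality conditions satisfied by the weight functions of GLS paths on fine grids. -/
structure FinePL (N : ℕ) (h : ℚ → ℚ) : Prop extends PL N h where
  int0 : ∃ z : ℤ, h 0 = z
  int1 : ∃ z : ℤ, h 1 = z
  lmL : ∀ k, k + 1 < N → h (nd N (k + 1)) < h (nd N k) → h (nd N (k + 1)) ≤ h (nd N (k + 2)) →
    ∃ z : ℤ, h (nd N (k + 1)) = z
  lmR : ∀ k, k + 1 < N → h (nd N (k + 1)) ≤ h (nd N k) → h (nd N (k + 1)) < h (nd N (k + 2)) →
    ∃ z : ℤ, h (nd N (k + 1)) = z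
  fineL : ∀ k < N, ∀ z : ℤ, h (nd N k) < z → h (nd N (k + 1)) ≤ z
  fineR : ∀ k < N, ∀ z : ℤ, h (nd N (k + 1)) < z → h (nd N k) ≤ z

section

variable {N k : ℕ} {h : ℚ → ℚ} {s t u y : ℚ} {n : ℤ}

lemma FinePL.fm_int (H : FinePL N h) (hk : k ≤ N) :
    fm h (nd N k) = h (nd N k) ∨ ∃ z : ℤ, fm h (nd N k) = z := by
  obtain ⟨n, hn⟩ := Nat.exists_eq_add_of_le hk
  induction n generalizing k with
  | zero =>
    obtain rfl : N = k := by simpa using hn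
    rw [nd_self H.pos, H.toPL.fm_one]; exact Or.inl rfl
  | succ n ih =>
    rw [H.toPL.fm_nd (by omega)]
    rcases le_or_gt (h (nd N k)) (fm h (nd N (k + 1))) with h1 | h1
    · rw [min_eq_left h1]; exact Or.inl rfl
    · rw [min_eq_right h1.le]
      right
      rcases ih (k := k + 1) (by omega) (by omega) with e | e
      · rw [e] at h1 ⊢
        rcases Nat.lt_or_ge (k + 1) N with h2 | h2
        · refine H.lmL k h2 h1 ?_
          rw [← e]
          exact H.toPL.fm_le (nd_nonneg _ _) (nd_mono (by omega)) (nd_le_one H.pos (by omega))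
        · obtain rfl : N = k + 1 := by omega
          rw [nd_self H.pos]; exact H.int1
      · exact e

lemma FinePL.fm_zero_int (H : FinePL N h) : ∃ z : ℤ, fm h 0 = z := by
  have := H.fm_int (Nat.zero_le _)
  rw [nd_zero] at this
  rcases this with e | e
  · rw [e]; exact H.int0
  · exact e

lemma PL.cf_mono (H : PL N h) (h0 : 0 ≤ t) (hu : t ≤ u) (h1 : u ≤ 1) (n : ℚ) :
    cf h n t ≤ cf h n u :=
  min_le_min_left _ (by linarith [H.fm_mono h0 hu h1])

lemma cf_zero (hn : 0 ≤ n) : cf h n 0 = 0 := by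
  have : (0 : ℚ) ≤ n := by exact_mod_cast hn
  simp [cf, this]

lemma PL.cf_one (H : PL N h) {n : ℚ} (hn : n ≤ h 1 - fm h 0) : cf h n 1 = n := by
  rw [cf, H.fm_one, min_eq_left hn]

lemma PL.cf_nonneg (H : PL N h) (hn : 0 ≤ n) (h0 : 0 ≤ t) (h1 : t ≤ 1) : 0 ≤ cf h n t := by
  rw [← cf_zero (h := h) hn]
  exact H.cf_mono le_rfl h0 h1 n

/-- On each cell either `cf` is constant or the path is reflected there. -/
lemma FinePL.cell_cases (H : FinePL N h) (n : ℤ) (hk : k < N) :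
    (cf h n (nd N (k + 1)) = cf h n (nd N k) ∧
      ∀ s, 0 ≤ s → s ≤ 1 → cf h n (cl N k s) = cf h n (nd N k)) ∨
    (h (nd N k) < h (nd N (k + 1)) ∧ cf h n (nd N k) < cf h n (nd N (k + 1)) ∧
      ∀ s, 0 ≤ s → s ≤ 1 → fm h (cl N k s) = h (cl N k s) ∧
        cf h n (cl N k s) = h (cl N k s) - fm h 0) := by
  have h0 := nd_nonneg N k
  have h1 := nd_le_one H.pos (show k + 1 ≤ N by omega)
  rcases (H.toPL.cf_mono h0 (nd_mono k.le_succ) h1 n).eq_or_lt with e | e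
  · refine Or.inl ⟨e.symm, fun s hs hs' => le_antisymm ?_ ?_⟩
    · rw [e]; exact H.toPL.cf_mono (h0.trans (nd_le_cl hs)) (cl_le_nd hs') h1 n
    · exact H.toPL.cf_mono h0 (nd_le_cl hs) ((cl_le_nd hs').trans h1) n
  · right
    obtain ⟨z, hz⟩ := H.fm_zero_int
    have e0 := e
    unfold cf at e
    have h2 : fm h (nd N k) - fm h 0 < n := by
      by_contra! h3
      rw [min_eq_left h3] at e
      exact absurd (min_le_left _ _) (not_le.2 e)
    have h3 : fm h (nd N k) < fm h (nd N (k + 1)) := by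
      rw [min_eq_right h2.le] at e
      have := lt_of_lt_of_le e (min_le_right _ _)
      linarith
    have h4 : fm h (nd N k) = h (nd N k) := by
      rw [H.toPL.fm_nd hk] at h3 ⊢
      rcases min_choice (h (nd N k)) (fm h (nd N (k + 1))) with e' | e'
      · exact e'
      · rw [e'] at h3; exact absurd h3 (lt_irrefl _)
    have h5 : fm h (nd N (k + 1)) ≤ h (nd N (k + 1)) := H.toPL.fm_le (nd_nonneg _ _) le_rfl h1
    have h6 : fm h (nd N (k + 1)) = h (nd N (k + 1)) := by
      rcases H.fm_int (show k + 1 ≤ N by omega) with e' | ⟨z', e'⟩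
      · exact e'
      · refine le_antisymm h5 ?_
        rw [e']
        exact H.fineL k hk z' (by rw [← e', ← h4]; exact h3)
    have h7 : h (nd N (k + 1)) ≤ n + fm h 0 := by
      have := H.fineL k hk (n + z) (by push_cast; rw [← h4, ← hz]; linarith)
      rw [hz]; push_cast at this; exact this
    have h8 : h (nd N k) < h (nd N (k + 1)) := by rw [← h4, ← h6]; exact h3
    refine ⟨h8, e0, fun s hs hs' => ?_⟩
    have h9 : h (cl N k s) ≤ h (nd N (k + 1)) := by
      rw [H.lin k hk s hs hs']; nlinarith
    have h10 : fm h (cl N k s) = h (cl N k s) := by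
      rw [H.toPL.fm_cl hk hs hs', h6, min_eq_left h9]
    refine ⟨h10, ?_⟩
    rw [cf, h10, min_eq_right]
    linarith

lemma FinePL.start (H : FinePL N h) (n : ℤ) (hk : k + 1 < N)
    (h1 : cf h n (nd N (k + 1)) = cf h n (nd N k))
    (h2 : cf h n (nd N (k + 1)) ≠ cf h n (nd N (k + 2))) : h (nd N (k + 1)) ≤ h (nd N k) := by
  rcases H.cell_cases n hk with ⟨e, -⟩ | ⟨-, h3, h4⟩
  · exact absurd e.symm h2
  · obtain ⟨h5, h6⟩ := h4 0 le_rfl zero_le_one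
    rw [cl_zero] at h5 h6
    have h7 : cf h n (nd N (k + 1)) < n := lt_of_lt_of_le h3 (min_le_left _ _)
    have h8 : fm h (nd N k) = fm h (nd N (k + 1)) := by
      rw [h1] at h7
      have : cf h n (nd N k) = fm h (nd N k) - fm h 0 := by
        unfold cf at h7 ⊢
        rcases min_choice (n : ℚ) (fm h (nd N k) - fm h 0) with e | e
        · rw [e] at h7; exact absurd h7 (lt_irrefl _)
        · exact e
      linarith
    rw [← h5, ← h8]
    exact H.toPL.fm_le (nd_nonneg _ _) le_rfl (nd_le_one H.pos (by omega))

lemma FinePL.leave (H : FinePL N h) (n : ℤ) (hk : k + 1 < N)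
    (h1 : cf h n (nd N (k + 1)) ≠ cf h n (nd N k))
    (h2 : cf h n (nd N (k + 2)) = cf h n (nd N (k + 1))) :
    (∃ z : ℤ, h (nd N (k + 1)) = z) ∨ h (nd N (k + 2)) = h (nd N (k + 1)) := by
  rcases H.cell_cases n (show k < N by omega) with ⟨e, -⟩ | ⟨-, h3, h4⟩
  · exact absurd e h1
  · obtain ⟨h5, h6⟩ := h4 1 zero_le_one le_rfl
    rw [cl_one] at h5 h6
    have h7 : cf h n (nd N (k + 1)) ≤ n := min_le_left _ _
    obtain ⟨z, hz⟩ := H.fm_zero_int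
    rcases h7.lt_or_eq with h7 | h7
    · have h8 : cf h n (nd N (k + 2)) = fm h (nd N (k + 2)) - fm h 0 := by
        rw [← h2] at h7
        unfold cf at h7 ⊢
        rcases min_choice (n : ℚ) (fm h (nd N (k + 2)) - fm h 0) with e | e
        · rw [e] at h7; exact absurd h7 (lt_irrefl _)
        · exact e
      have h9 : fm h (nd N (k + 2)) = h (nd N (k + 1)) := by linarith
      rcases H.fm_int (show k + 2 ≤ N by omega) with e | ⟨z, e⟩
      · right; rw [← e, h9]
      · exact Or.inl ⟨z, by rw [← h9, e]⟩
    · left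
      refine ⟨n + z, ?_⟩
      push_cast; linarith

/-- Every positive value of `cf` is attained at an earlier time by `h - min h`. -/
lemma FinePL.cf_node (H : FinePL N h) (hn : 0 ≤ n) (hk : k ≤ N) :
    cf h n (nd N k) = 0 ∨ ∃ u, 0 ≤ u ∧ u ≤ nd N k ∧ h u = fm h 0 + cf h n (nd N k) ∧
      cf h n u = cf h n (nd N k) := by
  induction k with
  | zero => left; rw [nd_zero, cf_zero hn]
  | succ k ih =>
    rcases H.cell_cases n (show k < N by omega) with ⟨e, -⟩ | ⟨-, h3, h4⟩
    · rw [e]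
      refine (ih (by omega)).imp_right ?_
      rintro ⟨u, h1, h2, h3⟩
      exact ⟨u, h1, h2.trans (nd_mono k.le_succ), h3⟩
    · right
      obtain ⟨h5, h6⟩ := h4 1 zero_le_one le_rfl
      rw [cl_one] at h5 h6
      exact ⟨_, nd_nonneg _ _, le_rfl, by linarith, rfl⟩

lemma FinePL.cf_att (H : FinePL N h) (hn : 0 ≤ n) (h0 : 0 ≤ t) (h1 : t ≤ 1) :
    cf h n t = 0 ∨ ∃ u, 0 ≤ u ∧ u ≤ t ∧ h u = fm h 0 + cf h n t ∧ cf h n u = cf h n t := by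
  obtain ⟨k, hk, s, hs, hs', rfl⟩ := exists_cell_of_mem H.pos h0 h1
  rcases H.cell_cases n hk with ⟨-, e⟩ | ⟨-, h3, h4⟩
  · rw [e s hs hs']
    refine (H.cf_node hn hk.le).imp_right ?_
    rintro ⟨u, h1, h2, h3⟩
    exact ⟨u, h1, h2.trans (nd_le_cl hs), h3⟩
  · exact Or.inr ⟨_, h0, le_rfl, by linarith [(h4 s hs hs').2], rfl⟩

lemma PL.sub_cf_ge (H : PL N h) (h0 : 0 ≤ u) (hu : u ≤ t) (h1 : t ≤ 1) :
    fm h 0 - cf h n t ≤ h u - 2 * cf h n u := by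
  have h2 := H.fm_le h0 le_rfl (hu.trans h1)
  have h3 := H.fm_mono h0 hu h1
  have h4 := H.fm_mono le_rfl h0 (hu.trans h1)
  unfold cf
  rcases min_cases (n : ℚ) (fm h t - fm h 0) with ⟨e, e'⟩ | ⟨e, e'⟩ <;>
  rcases min_cases (n : ℚ) (fm h u - fm h 0) with ⟨f, f'⟩ | ⟨f, f'⟩ <;> rw [e, f] <;> linarith

/-- The reversed function. -/
def rev (h : ℚ → ℚ) (t : ℚ) : ℚ := h (1 - t)

lemma nd_rev (hN : 0 < N) (hk : k ≤ N) : 1 - nd N k = nd N (N - k) := by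
  have : (N : ℚ) ≠ 0 := by positivity
  unfold nd
  rw [Nat.cast_sub hk]; field_simp

lemma PL.rev (H : PL N h) : PL N (rev h) := by
  refine ⟨H.pos, fun k hk s hs hs' => ?_⟩
  have hN : (N : ℚ) ≠ 0 := by have := H.pos; positivity
  have e : 1 - cl N k s = cl N (N - (k + 1)) (1 - s) := by
    unfold cl
    rw [Nat.cast_sub (by omega)]
    field_simp; push_cast; ring
  unfold GKM.rev
  rw [e, H.lin _ (by omega) _ (by linarith) (by linarith), nd_rev H.pos (by omega),
    nd_rev H.pos (by omega), show N - (k + 1) + 1 = N - k by omega]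
  ring

lemma FinePL.rev (H : FinePL N h) : FinePL N (rev h) := by
  have hr : ∀ k ≤ N, GKM.rev h (nd N k) = h (nd N (N - k)) := fun k hk => by
    unfold GKM.rev; rw [nd_rev H.pos hk]
  refine ⟨H.toPL.rev, by simpa [GKM.rev] using H.int1, by simpa [GKM.rev] using H.int0, ?_, ?_, ?_, ?_⟩
  · intro k hk
    rw [hr _ (by omega), hr _ (by omega), hr _ (by omega)]
    have := H.lmR (N - (k + 2)) (by omega)
    rw [show N - (k + 2) + 1 = N - (k + 1) by omega, show N - (k + 2) + 2 = N - k by omega] at this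
    exact fun h1 h2 => this h2 h1
  · intro k hk
    rw [hr _ (by omega), hr _ (by omega), hr _ (by omega)]
    have := H.lmL (N - (k + 2)) (by omega)
    rw [show N - (k + 2) + 1 = N - (k + 1) by omega, show N - (k + 2) + 2 = N - k by omega] at this
    exact fun h1 h2 => this h2 h1
  · intro k hk z
    rw [hr _ (by omega), hr _ (by omega)]
    have := H.fineR (N - (k + 1)) (by omega) z
    rwa [show N - (k + 1) + 1 = N - k by omega] at this
  · intro k hk z
    rw [hr _ (by omega), hr _ (by omega)]
    have := H.fineL (N - (k + 1)) (by omega) z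
    rwa [show N - (k + 1) + 1 = N - k by omega] at this

lemma FinePL.cf_PL (H : FinePL N h) (n : ℤ) : PL N (cf h n) := by
  refine ⟨H.pos, fun k hk s hs hs' => ?_⟩
  rcases H.cell_cases n hk with ⟨e, e'⟩ | ⟨-, h3, h4⟩
  · rw [e, e' s hs hs']; ring
  · have h5 := (h4 0 le_rfl zero_le_one).2
    have h6 := (h4 1 zero_le_one le_rfl).2
    rw [cl_zero] at h5
    rw [cl_one] at h6
    rw [h5, h6, (h4 s hs hs').2, H.lin k hk s hs hs']; ring

lemma FinePL.sub_PL (H : FinePL N h) (n : ℤ) : PL N (fun t => h t - 2 * cf h n t) := by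
  refine ⟨H.pos, fun k hk s hs hs' => ?_⟩
  show h _ - 2 * cf h n _ = _
  rw [(H.cf_PL n).lin k hk s hs hs', H.lin k hk s hs hs']; ring

lemma FinePL.cf_inv (H : FinePL N h) (hn : 0 ≤ n) (hn' : n ≤ h 1 - fm h 0) (h0 : 0 ≤ t)
    (h1 : t ≤ 1) : cf (GKM.rev fun t => h t - 2 * cf h n t) n (1 - t) = n - cf h n t := by
  set g : ℚ → ℚ := fun t => h t - 2 * cf h n t with hg
  have hPL : PL N g := H.sub_PL n
  have hb : ∀ t, 0 ≤ t → t ≤ 1 → fm h 0 - cf h n t ≤ fm (GKM.rev g) (1 - t) ∧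
      (0 < cf h n t → fm (GKM.rev g) (1 - t) = fm h 0 - cf h n t) := by
    intro t h0 h1
    have hlow : ∀ v, 1 - t ≤ v → v ≤ 1 → fm h 0 - cf h n t ≤ GKM.rev g v := fun v hv hv' =>
      H.toPL.sub_cf_ge (by linarith) (by linarith) h1
    constructor
    · obtain ⟨v, hv, hv', e⟩ := hPL.rev.fm_att (t := 1 - t) (by linarith) (by linarith)
      rw [← e]; exact hlow v hv hv'
    · intro hc
      apply fm_eq
      refine ⟨?_, ?_⟩
      · rcases H.cf_att hn h0 h1 with e | ⟨u, hu, hu', e1, e2⟩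
        · exact absurd e hc.ne'
        · refine ⟨1 - u, by linarith, by linarith, ?_⟩
          simp only [GKM.rev, hg, sub_sub_cancel]
          rw [e1, e2]; ring
      · rintro _ ⟨v, hv, hv', rfl⟩
        exact hlow v hv hv'
  obtain ⟨b1, b2⟩ := hb t h0 h1
  obtain ⟨b3, b4⟩ := hb 1 zero_le_one le_rfl
  rw [H.toPL.cf_one hn', sub_self] at b3 b4
  have hnq : (0 : ℚ) ≤ n := by exact_mod_cast hn
  have hmono := H.toPL.cf_mono h0 h1 le_rfl n
  rw [H.toPL.cf_one hn'] at hmono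
  rcases (H.toPL.cf_nonneg hn h0 h1).eq_or_lt with hc | hc
  · rw [← hc, sub_zero]
    rw [← hc, sub_zero] at b1
    unfold cf
    rw [min_eq_left]
    rcases hnq.eq_or_lt with h2 | h2
    · have := hPL.rev.fm_mono (t := 0) (u := 1 - t) le_rfl (by linarith) (by linarith)
      linarith
    · rw [b4 h2]; linarith
  · rw [cf, b2 hc, b4 (by linarith)]
    rw [min_eq_right] <;> linarith

lemma tailVals_add (h : ℚ → ℚ) (a t y : ℚ) (hy : IsLeast (tailVals h t) y) :
    IsLeast (tailVals (fun u => h u + a) t) (y + a) := by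
  obtain ⟨⟨u, h1, h2, rfl⟩, h3⟩ := hy
  refine ⟨⟨u, h1, h2, rfl⟩, ?_⟩
  rintro _ ⟨v, h4, h5, rfl⟩
  have := h3 ⟨v, h4, h5, rfl⟩
  simpa using this

lemma PL.cf_add (H : PL N h) (a : ℚ) (n : ℚ) (h0 : 0 ≤ t) (h1 : t ≤ 1) :
    cf (fun u => h u + a) n t = cf h n t := by
  have e1 := fm_eq (tailVals_add h a t _ (H.fm_least h0 h1))
  have e2 := fm_eq (tailVals_add h a 0 _ (H.fm_least le_rfl zero_le_one))
  rw [cf, e1, e2, add_sub_add_right_eq_sub, cf]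

end

end GKM

namespace GKM

/-- Clamping to the unit interval. -/
def clp (t : ℚ) : ℚ := max 0 (min t 1)

lemma clp_nonneg (t : ℚ) : 0 ≤ clp t := le_max_left _ _
lemma clp_le_one (t : ℚ) : clp t ≤ 1 := max_le zero_le_one (min_le_right _ _)
lemma clp_of_mem {t : ℚ} (h0 : 0 ≤ t) (h1 : t ≤ 1) : clp t = t := by
  rw [clp, min_eq_left h1, max_eq_right h0]
lemma clp_clp (t : ℚ) : clp (clp t) = clp t := clp_of_mem (clp_nonneg t) (clp_le_one t)
@[simp] lemma clp_one : clp 1 = 1 := clp_of_mem zero_le_one le_rfl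

namespace Datum

variable {I V : Type*} [AddCommGroup V] [Module ℚ V] {D : Datum I V} {i j k l : I}
variable {lam x y z : V} {N M : ℕ} {d e : ℕ → V} {π σ : ℚ → V}

lemma pth_cl {N k : ℕ} (hk : k < N) {s : ℚ} (hs : 0 ≤ s) (hs' : s ≤ 1) (d : ℕ → V) :
    pth N d (cl N k s) = (1 / N : ℚ) • (∑ l ∈ Finset.range k, d l + s • d k) := by
  have hN : (0 : ℚ) < N := by exact_mod_cast (show 0 < N by omega)
  obtain ⟨m, rfl⟩ := Nat.exists_eq_add_of_lt hk
  rw [show k + m + 1 = k + 1 + m by ring] at hN ⊢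
  rw [pth, Finset.sum_range_add, Finset.sum_range_succ]
  have e3 : ∑ x ∈ Finset.range m, (min (cl (k + 1 + m) k s) (((k + 1 + x + 1 : ℕ) : ℚ) / (k + 1 + m : ℕ)) -
      min (cl (k + 1 + m) k s) (((k + 1 + x : ℕ) : ℚ) / (k + 1 + m : ℕ))) • d (k + 1 + x) = 0 := by
    refine Finset.sum_eq_zero fun x _ => ?_
    have h1 : cl (k + 1 + m) k s ≤ ((k + 1 + x : ℕ) : ℚ) / (k + 1 + m : ℕ) := by
      unfold cl; gcongr; push_cast
      have : (0 : ℚ) ≤ x := by positivity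
      linarith
    have h2 : cl (k + 1 + m) k s ≤ ((k + 1 + x + 1 : ℕ) : ℚ) / (k + 1 + m : ℕ) :=
      h1.trans (nd_mono (Nat.le_succ _))
    rw [min_eq_left h1, min_eq_left h2, sub_self, zero_smul]
  rw [e3, add_zero, smul_add, Finset.smul_sum]
  congr 1
  · refine Finset.sum_congr rfl fun x hx => ?_
    rw [Finset.mem_range] at hx
    have h2 : ((x + 1 : ℕ) : ℚ) / (k + 1 + m : ℕ) ≤ cl (k + 1 + m) k s := by
      unfold cl; gcongr
      have : ((x + 1 : ℕ) : ℚ) ≤ k := by exact_mod_cast hx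
      linarith
    have h1 : ((x : ℕ) : ℚ) / (k + 1 + m : ℕ) ≤ cl (k + 1 + m) k s :=
      le_trans (by gcongr; omega) h2
    rw [min_eq_right h1, min_eq_right h2, ← sub_div]
    push_cast; congr 2; ring
  · have h1 : ((k : ℕ) : ℚ) / (k + 1 + m : ℕ) ≤ cl (k + 1 + m) k s := nd_le_cl hs
    have h2 : cl (k + 1 + m) k s ≤ ((k + 1 : ℕ) : ℚ) / (k + 1 + m : ℕ) := cl_le_nd hs'
    rw [min_eq_right h1, min_eq_left h2, smul_smul, cl, ← sub_div]
    congr 1; ring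

lemma pth_nd {N k : ℕ} (hN : 0 < N) (hk : k ≤ N) (d : ℕ → V) :
    pth N d (nd N k) = (1 / N : ℚ) • ∑ l ∈ Finset.range k, d l := by
  rcases hk.lt_or_eq with h | rfl
  · rw [← cl_zero, pth_cl h le_rfl zero_le_one, zero_smul, add_zero]
  · obtain ⟨m, rfl⟩ : ∃ m, k = m + 1 := ⟨k - 1, by omega⟩
    rw [← cl_one, pth_cl (by omega) zero_le_one le_rfl, one_smul, Finset.sum_range_succ]

lemma pth_one {N : ℕ} (hN : 0 < N) (d : ℕ → V) :
    pth N d 1 = (1 / N : ℚ) • ∑ l ∈ Finset.range N, d l := by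
  rw [← pth_nd hN le_rfl, nd_self hN]

lemma pth_clp (N : ℕ) (d : ℕ → V) (t : ℚ) : pth N d (clp t) = pth N d t := by
  unfold pth
  refine Finset.sum_congr rfl fun k hk => ?_
  rw [Finset.mem_range] at hk
  have hN : (0 : ℚ) < N := by exact_mod_cast (show 0 < N by omega)
  have h1 : ((k : ℕ) : ℚ) / N ≤ 1 := nd_le_one (by omega) hk.le
  have h2 : ((k + 1 : ℕ) : ℚ) / N ≤ 1 := nd_le_one (by omega) hk
  have h3 : 0 ≤ ((k : ℕ) : ℚ) / N := by positivity
  have h4 : 0 ≤ ((k + 1 : ℕ) : ℚ) / N := by positivity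
  congr 1
  rcases le_total t 0 with h | h
  · rw [clp, min_eq_left (h.trans zero_le_one), max_eq_left h, min_eq_left h3, min_eq_left h4,
      min_eq_left (h.trans h3), min_eq_left (h.trans h4)]; ring
  rcases le_total t 1 with h' | h'
  · rw [clp_of_mem h h']
  · rw [clp, min_eq_right h', max_eq_right zero_le_one, min_eq_right h1, min_eq_right h2,
      min_eq_right (h1.trans h'), min_eq_right (h2.trans h')]

lemma pth_cl' {N k : ℕ} (hk : k < N) {s : ℚ} (hs : 0 ≤ s) (hs' : s ≤ 1) (d : ℕ → V) :
    pth N d (cl N k s) = pth N d (nd N k) + (s / N) • d k := by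
  rw [pth_cl hk hs hs', pth_nd (by omega) hk.le, smul_add, smul_smul]
  congr 2; ring

lemma pth_succ {N k : ℕ} (hk : k < N) (d : ℕ → V) :
    pth N d (nd N (k + 1)) = pth N d (nd N k) + (1 / N : ℚ) • d k := by
  rw [← cl_one, pth_cl' hk zero_le_one le_rfl]

/-- A function that moves with velocity `e k` on the `k`-th cell is the path `pth N e`. -/
lemma eq_pth (hN : 0 < N) (hc : ∀ t, σ (clp t) = σ t) (h0 : σ 0 = 0)
    (h : ∀ k < N, ∀ s, 0 ≤ s → s ≤ 1 → σ (cl N k s) = σ (nd N k) + (s / N) • e k) :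
    σ = pth N e := by
  have h1 : ∀ k ≤ N, σ (nd N k) = pth N e (nd N k) := by
    intro k hk
    induction k with
    | zero => rw [pth_nd hN hk, nd_zero, h0]; simp
    | succ k ih =>
      rw [pth_succ (by omega), ← cl_one, h k (by omega) 1 zero_le_one le_rfl, ih (by omega)]
  funext t
  rw [← hc, ← pth_clp]
  obtain ⟨k, hk, s, hs, hs', e⟩ := exists_cell_of_mem hN (clp_nonneg t) (clp_le_one t)
  rw [e, h k hk s hs hs', h1 k hk.le, pth_cl' hk hs hs']

lemma pth_congr (h : ∀ k < N, d k = e k) : pth N d = pth N e := by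
  funext t
  exact Finset.sum_congr rfl fun k hk => by rw [h k (Finset.mem_range.1 hk)]

lemma eq_of_pth_eq (h : pth N d = pth N e) {k : ℕ} (hk : k < N) : d k = e k := by
  have hN : (N : ℚ) ≠ 0 := by have : 0 < N := by omega
                              positivity
  have h1 := pth_succ hk d
  rw [h, pth_succ hk e] at h1
  have h2 := add_left_cancel h1
  have h3 := congrArg (fun v => (N : ℚ) • v) h2
  simpa [smul_smul, hN] using h3.symm

lemma pth_zero (N : ℕ) (d : ℕ → V) : pth N d 0 = 0 := by
  unfold pth
  refine Finset.sum_eq_zero fun k _ => ?_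
  rw [min_eq_left (by positivity), min_eq_left (by positivity), sub_self, zero_smul]

variable (D) in
/-- The weight function of a path. -/
def hf (j : I) (π : ℚ → V) (t : ℚ) : ℚ := D.cr j (π t)

lemma hf_succ {N k : ℕ} (hk : k < N) (d : ℕ → V) :
    D.hf j (pth N d) (nd N (k + 1)) = D.hf j (pth N d) (nd N k) + D.cr j (d k) / N := by
  unfold hf
  rw [pth_succ hk, map_add, map_smul, smul_eq_mul]; ring

lemma hf_PL (hN : 0 < N) (j : I) (d : ℕ → V) : PL N (D.hf j (pth N d)) := by
  refine ⟨hN, fun k hk s hs hs' => ?_⟩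
  rw [hf_succ hk, hf, pth_cl' hk hs hs', map_add, map_smul, smul_eq_mul, hf]; ring

lemma Grd.node_mem (h : D.Grd lam N d) {k : ℕ} (hk : k ≤ N) :
    nd N k • d k - pth N d (nd N k) ∈ Qplus D.α := by
  induction k with
  | zero => rw [nd_zero, pth_zero, zero_smul, sub_zero]; exact D.Qplus_zero
  | succ k ih =>
    have := Qplus_add (R.sub_mem (h.R k (by omega))) (ih (by omega))
    rw [pth_succ (by omega)]
    convert this using 1
    have hN : (N : ℚ) ≠ 0 := by have := h.pos; positivity
    unfold nd
    rw [smul_sub]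
    push_cast
    rw [add_div]
    module

lemma Grd.sub_one_mem (h : D.Grd lam N d) : lam - pth N d 1 ∈ Qplus D.α := by
  have := h.node_mem le_rfl
  rwa [nd_self h.pos, one_smul, h.ge N le_rfl] at this

lemma Grd.node_int (h : D.Grd lam N d) {k : ℕ} (hk : k ≤ N) (j : I) :
    ∃ z : ℤ, D.hf j (pth N d) (nd N k) = nd N k * D.cr j (d k) + z := by
  obtain ⟨m, hm⟩ := Qplus_int (h.node_mem hk) j
  refine ⟨-m, ?_⟩
  rw [map_sub, map_smul, smul_eq_mul] at hm
  unfold hf; push_cast; linarith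

lemma Grd.node_int_iff (h : D.Grd lam N d) {k : ℕ} (hk : k ≤ N) (j : I) :
    (∃ z : ℤ, D.hf j (pth N d) (nd N k) = z) ↔ ∃ z : ℤ, nd N k * D.cr j (d k) = z := by
  obtain ⟨m, hm⟩ := h.node_int hk j
  rw [hm]
  exact ⟨fun ⟨z, hz⟩ => ⟨z - m, by push_cast; linarith⟩, fun ⟨z, hz⟩ => ⟨z + m, by push_cast; linarith⟩⟩

lemma Grd.one_int (hlam : lam ∈ Pplus D.cr) (h : D.Grd lam N d) (j : I) :
    ∃ z : ℤ, D.hf j (pth N d) 1 = z := by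
  have := (h.node_int_iff le_rfl j).2
  rw [nd_self h.pos, one_mul, h.ge N le_rfl] at this
  exact this ((T.self D).int hlam j)

/-- Every direction has `j`-weight zero or dividing `N`. -/
def Fine (D : Datum I V) (N : ℕ) (d : ℕ → V) (j : I) : Prop :=
  ∀ k < N, D.cr j (d k) = 0 ∨ ∃ m : ℤ, D.cr j (d k) * m = N

lemma Grd.exists_fine (hlam : lam ∈ Pplus D.cr) (h : D.Grd lam N d) (j : I) :
    ∃ M, 0 < M ∧ D.Fine (N * M) (fun k => d (k / M)) j := by
  choose z hz using fun k => (h.T k).int hlam j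
  let g : ℕ → ℕ := fun k => if z k = 0 then 1 else (z k).natAbs
  have hg : ∀ k, 0 < g k := by
    intro k; simp only [g]; split_ifs with h0
    · exact one_pos
    · exact Int.natAbs_pos.2 h0
  have hM : 0 < ∏ k ∈ Finset.range N, g k := Finset.prod_pos fun k _ => hg k
  refine ⟨_, hM, fun k hk => ?_⟩
  have hk' : k / (∏ k ∈ Finset.range N, g k) < N := (Nat.div_lt_iff_lt_mul hM).2 hk
  set q := k / (∏ k ∈ Finset.range N, g k)
  by_cases h0 : z q = 0
  · left; rw [hz, h0]; simp
  · right
    have h1 : z q ∣ ((∏ k ∈ Finset.range N, g k : ℕ) : ℤ) := by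
      have h2 : g q ∣ ∏ k ∈ Finset.range N, g k := Finset.dvd_prod_of_mem g (Finset.mem_range.2 hk')
      have h3 : g q = (z q).natAbs := by simp [g, h0]
      rw [h3] at h2
      exact Int.natAbs_dvd.1 (by exact_mod_cast h2)
    obtain ⟨m, hm⟩ := h1
    refine ⟨m * N, ?_⟩
    rw [hz]
    have : ((∏ k ∈ Finset.range N, g k : ℕ) : ℚ) = z q * m := by exact_mod_cast hm
    rw [Nat.cast_mul, this]; push_cast; ring

lemma exists_fine (hlam : lam ∈ Pplus D.cr) (h : π ∈ GLSset D.A D.α D.cr lam) (j : I) :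
    ∃ N d, D.Grd lam N d ∧ D.Fine N d j ∧ π = pth N d := by
  obtain ⟨N, d, hd, rfl⟩ := exists_grd h
  obtain ⟨M, hM, hf⟩ := hd.exists_fine hlam j
  exact ⟨_, _, hd.refine hM, hf, (pth_refine hd.pos hM).symm⟩

lemma Grd.fine_node (h : D.Grd lam N d) (hf : D.Fine N d j) {k : ℕ} (hk : k < N) :
    ∃ z : ℤ, (D.hf j (pth N d) (nd N k) = z ∧ D.hf j (pth N d) (nd N (k + 1)) = z) ∨
      (D.cr j (d k) = 0 ∧ D.hf j (pth N d) (nd N (k + 1)) = D.hf j (pth N d) (nd N k)) ∨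
      ∃ m : ℤ, m ≠ 0 ∧ D.hf j (pth N d) (nd N k) = z + (k : ℚ) / m ∧
        D.hf j (pth N d) (nd N (k + 1)) = z + ((k : ℚ) + 1) / m := by
  obtain ⟨z, hz⟩ := h.node_int hk.le j
  have hN : (N : ℚ) ≠ 0 := by have := h.pos; positivity
  refine ⟨z, Or.inr ?_⟩
  rcases hf k hk with h0 | ⟨m, hm⟩
  · left; refine ⟨h0, ?_⟩
    rw [hf_succ hk, h0]; simp
  · right
    have hm0 : (m : ℚ) ≠ 0 := by rintro h0; rw [h0, mul_zero] at hm; exact hN hm.symm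
    have e : D.cr j (d k) = N / m := by rw [← hm]; field_simp
    refine ⟨m, by exact_mod_cast hm0, ?_, ?_⟩
    · rw [hz, e]; unfold nd; field_simp; ring
    · rw [hf_succ hk, hz, e]; unfold nd; field_simp; ring

lemma fine_aux {m k z w : ℤ} (hm : m ≠ 0) (h : (z : ℚ) + k / m < w) :
    (z : ℚ) + (k + 1) / m ≤ w ∧ (z : ℚ) + (k - 1) / m ≤ w := by
  rcases lt_or_gt_of_ne hm with h0 | h0
  · have h0' : (m : ℚ) < 0 := by exact_mod_cast h0
    have h1 : (k : ℚ) / m < w - z := by linarith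
    rw [div_lt_iff_of_neg h0'] at h1
    have h2 : (w - z) * m + 1 ≤ k := by exact_mod_cast h1
    have h3 : ((w : ℚ) - z) * m + 1 ≤ k := by exact_mod_cast h2
    constructor
    · have : ((k : ℚ) + 1) / m ≤ w - z := by rw [div_le_iff_of_neg h0']; linarith
      linarith
    · have : ((k : ℚ) - 1) / m ≤ w - z := by rw [div_le_iff_of_neg h0']; linarith
      linarith
  · have h0' : (0 : ℚ) < m := by exact_mod_cast h0
    have h1 : (k : ℚ) / m < w - z := by linarith
    rw [div_lt_iff₀ h0'] at h1
    have h2 : k + 1 ≤ (w - z) * m := by exact_mod_cast h1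
    have h3 : (k : ℚ) + 1 ≤ ((w : ℚ) - z) * m := by exact_mod_cast h2
    constructor
    · have : ((k : ℚ) + 1) / m ≤ w - z := by rw [div_le_iff₀ h0']; linarith
      linarith
    · have : ((k : ℚ) - 1) / m ≤ w - z := by rw [div_le_iff₀ h0']; linarith
      linarith

lemma Grd.hf_lt_iff (h : D.Grd lam N d) {k : ℕ} (hk : k < N) (j : I) :
    (D.hf j (pth N d) (nd N k) < D.hf j (pth N d) (nd N (k + 1)) ↔ 0 < D.cr j (d k)) ∧
    (D.hf j (pth N d) (nd N (k + 1)) < D.hf j (pth N d) (nd N k) ↔ D.cr j (d k) < 0) := by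
  have hN : (0 : ℚ) < N := by have := h.pos; positivity
  rw [hf_succ hk]
  constructor
  · rw [lt_add_iff_pos_right, div_pos_iff_of_pos_right hN]
  · rw [add_lt_iff_neg_left, div_neg_iff]
    constructor
    · rintro (⟨-, h⟩ | ⟨h, -⟩)
      · linarith
      · exact h
    · exact fun h => Or.inr ⟨h, hN⟩

lemma Grd.finePL (hlam : lam ∈ Pplus D.cr) (h : D.Grd lam N d) (hj : D.A j j = 2)
    (hf : D.Fine N d j) : FinePL N (D.hf j (pth N d)) := by
  refine ⟨hf_PL h.pos j d, ⟨0, by simp [Datum.hf, pth_zero]⟩, h.one_int hlam j, ?_, ?_, ?_, ?_⟩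
  · intro k hk h1 h2
    rw [(h.hf_lt_iff (by omega) j).2] at h1
    rw [← not_lt, (h.hf_lt_iff hk j).2, not_lt] at h2
    rw [h.node_int_iff hk.le j]
    exact R.opp (h.R k (by omega)) hj (Or.inr ⟨h1, h2⟩)
  · intro k hk h1 h2
    rw [← not_lt, (h.hf_lt_iff (by omega) j).1, not_lt] at h1
    rw [(h.hf_lt_iff hk j).1] at h2
    rw [h.node_int_iff hk.le j]
    exact R.opp (h.R k (by omega)) hj (Or.inl ⟨h1, h2⟩)
  · intro k hk w hw
    obtain ⟨z, ⟨e1, e2⟩ | ⟨-, e2⟩ | ⟨m, hm, e1, e2⟩⟩ := h.fine_node hf hk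
    · rw [e2, ← e1]; exact hw.le
    · rw [e2]; exact hw.le
    · rw [e1] at hw; rw [e2]
      exact_mod_cast (fine_aux (k := k) hm (by exact_mod_cast hw)).1
  · intro k hk w hw
    obtain ⟨z, ⟨e1, e2⟩ | ⟨-, e2⟩ | ⟨m, hm, e1, e2⟩⟩ := h.fine_node hf hk
    · rw [e1, ← e2]; exact hw.le
    · rw [← e2]; exact hw.le
    · rw [e2] at hw; rw [e1]
      have := (fine_aux (k := k + 1) hm (by exact_mod_cast hw)).2
      push_cast at this
      rwa [add_sub_cancel_right] at this

section reflect

variable {K : ℕ → Prop}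

open Classical in
lemma Grd.reflect_up (hlam : lam ∈ Pplus D.cr) (h : D.Grd lam N d) (hj : D.A j j = 2)
    (hpos : ∀ k < N, K k → 0 < D.cr j (d k))
    (hstart : ∀ k, k + 1 < N → ¬ K k → K (k + 1) → D.cr j (d k) ≤ 0)
    (hleave : ∀ k, k + 1 < N → K k → ¬ K (k + 1) → ∃ z : ℤ, nd N (k + 1) * D.cr j (d (k + 1)) = z) :
    D.Grd lam N (fun k => if k < N ∧ K k then D.r j (d k) else d k) := by
  refine ⟨h.pos, fun k hk => by rw [if_neg (by omega), h.ge k hk], fun k hk => ?_⟩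
  have hN : (0 : ℚ) < N := by have := h.pos; positivity
  have ha : (0 : ℚ) < ((k + 1 : ℕ) : ℚ) / N := by positivity
  have hR := h.R k hk
  simp only [hk, true_and]
  rcases Nat.lt_or_ge (k + 1) N with h1 | h1
  · simp only [h1, true_and]
    by_cases hk1 : K k <;> by_cases hk2 : K (k + 1) <;> simp only [hk1, hk2, if_true, if_false]
    · exact hR.same hlam ha hj (mul_pos (hpos _ h1 hk2) (hpos _ hk hk1))
    · have hnum := hleave k h1 hk1 hk2
      have hy := hpos k hk hk1
      rw [← dn_pos hy]
      rcases le_total 0 (D.cr j (d (k + 1))) with h2 | h2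
      · have := hR.up_to_dn hlam ha (h.T _) hj hnum
        rwa [up_nonneg h2] at this
      · have := (hR.up_dn hlam ha hj hnum).2
        rwa [dn_nonpos h2] at this
    · have hx := hpos _ h1 hk2
      have hy := hstart k h1 hk1 hk2
      have := (hR.up_dn hlam ha hj (hR.opp hj (Or.inl ⟨hy, hx⟩))).2
      rwa [dn_pos hx, dn_nonpos hy] at this
    · exact hR
  · obtain rfl : k + 1 = N := by omega
    simp only [lt_irrefl, false_and, if_false]
    split_ifs with hk1
    · have hy := hpos k hk hk1
      rw [h.ge _ le_rfl] at hR ⊢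
      have := hR.up_to_dn hlam ha (T.self D) hj (by
        rw [div_self hN.ne', one_mul]; exact (T.self D).int hlam j)
      rw [← dn_pos hy]
      rwa [up_nonneg] at this
      exact hlam.2 j
    · exact hR

open Classical in
lemma Grd.reflect_dn (hlam : lam ∈ Pplus D.cr) (h : D.Grd lam N d) (hj : D.A j j = 2)
    (hneg : ∀ k < N, K k → D.cr j (d k) < 0)
    (hstart : ∀ k, k + 1 < N → ¬ K k → K (k + 1) → ∃ z : ℤ, nd N (k + 1) * D.cr j (d (k + 1)) = z)
    (hleave : ∀ k, k + 1 < N → K k → ¬ K (k + 1) → 0 ≤ D.cr j (d (k + 1))) :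
    D.Grd lam N (fun k => if k < N ∧ K k then D.r j (d k) else d k) := by
  refine ⟨h.pos, fun k hk => by rw [if_neg (by omega), h.ge k hk], fun k hk => ?_⟩
  have hN : (0 : ℚ) < N := by have := h.pos; positivity
  have ha : (0 : ℚ) < ((k + 1 : ℕ) : ℚ) / N := by positivity
  have hR := h.R k hk
  simp only [hk, true_and]
  rcases Nat.lt_or_ge (k + 1) N with h1 | h1
  · simp only [h1, true_and]
    by_cases hk1 : K k <;> by_cases hk2 : K (k + 1) <;> simp only [hk1, hk2, if_true, if_false]
    · exact hR.same hlam ha hj (mul_pos_of_neg_of_neg (hneg _ h1 hk2) (hneg _ hk hk1))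
    · have hx := hleave k h1 hk1 hk2
      have hy := hneg k hk hk1
      have := (hR.up_dn hlam ha hj (hR.opp hj (Or.inr ⟨hy, hx⟩))).1
      rwa [up_nonneg hx, up_neg hy] at this
    · have hnum := hstart k h1 hk1 hk2
      have hx := hneg _ h1 hk2
      rw [← up_neg hx]
      rcases le_total 0 (D.cr j (d k)) with h2 | h2
      · have := (hR.up_dn hlam ha hj hnum).1
        rwa [up_nonneg h2] at this
      · have := hR.up_to_dn hlam ha (h.T _) hj hnum
        rwa [dn_nonpos h2] at this
    · exact hR
  · obtain rfl : k + 1 = N := by omega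
    simp only [lt_irrefl, false_and, if_false]
    split_ifs with hk1
    · have hy := hneg k hk hk1
      rw [h.ge _ le_rfl] at hR ⊢
      have := (hR.up_dn hlam ha hj (by
        rw [div_self hN.ne', one_mul]; exact (T.self D).int hlam j)).1
      rw [← up_neg hy]
      rwa [up_nonneg] at this
      exact hlam.2 j
    · exact hR

end reflect

end Datum
end GKM

namespace GKM

section

variable {N k : ℕ} {h h' : ℚ → ℚ} {s t u y n : ℚ}

lemma fm_congr (H : ∀ t, 0 ≤ t → t ≤ 1 → h t = h' t) (h0 : 0 ≤ t) : fm h t = fm h' t := by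
  have : tailVals h t = tailVals h' t := by
    ext y
    constructor <;> rintro ⟨u, h1, h2, rfl⟩
    · exact ⟨u, h1, h2, (H u (h0.trans h1) h2).symm⟩
    · exact ⟨u, h1, h2, H u (h0.trans h1) h2⟩
  unfold fm; rw [this]

lemma cf_congr (H : ∀ t, 0 ≤ t → t ≤ 1 → h t = h' t) (h0 : 0 ≤ t) : cf h n t = cf h' n t := by
  rw [cf, cf, fm_congr H h0, fm_congr H le_rfl]

/-- The multiplicity of `α_j` subtracted at time `t` by `f_j^n` (by `e_j^{-n}` if `n < 0`). -/
noncomputable def cc (h : ℚ → ℚ) (n : ℤ) (t : ℚ) : ℚ :=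
  if 0 ≤ n then cf h n t else cf (rev h) (-n : ℤ) (1 - t) + n

lemma cc_congr (H : ∀ t, 0 ≤ t → t ≤ 1 → h t = h' t) {n : ℤ} (h0 : 0 ≤ t) (h1 : t ≤ 1) :
    cc h n t = cc h' n t := by
  unfold cc
  rw [cf_congr H h0, cf_congr (h := rev h) (h' := rev h') (fun t h0 h1 => ?_) (by linarith)]
  exact H _ (by linarith) (by linarith)

lemma PL.fm_rev_zero (H : PL N h) : fm (GKM.rev h) 0 = fm h 0 := by
  obtain ⟨u, h1, h2, h3⟩ := H.fm_att le_rfl zero_le_one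
  obtain ⟨v, h4, h5, h6⟩ := H.rev.fm_att le_rfl zero_le_one
  apply le_antisymm
  · have := H.rev.fm_le (t := 0) (u := 1 - u) le_rfl (by linarith) (by linarith)
    unfold GKM.rev at this ⊢
    rw [sub_sub_cancel, h3] at this
    exact this
  · rw [← h6]
    exact H.fm_le le_rfl (by linarith) (by linarith)

lemma cc_at_zero (H : PL N h) {n : ℤ} (hn : fm h 0 ≤ h 0 + n) : cc h n 0 = 0 := by
  unfold cc
  split_ifs with h0
  · exact cf_zero h0
  · rw [sub_zero, H.rev.cf_one]
    · push_cast; ring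
    · rw [H.fm_rev_zero]; simp only [rev, sub_self]; push_cast; linarith

lemma cc_at_one (H : PL N h) {n : ℤ} (hn : n ≤ h 1 - fm h 0) : cc h n 1 = n := by
  unfold cc
  split_ifs with h0
  · exact H.cf_one hn
  · rw [sub_self, cf_zero (by omega), zero_add]

lemma cc_zero (H : PL N h) (h0 : 0 ≤ t) (h1 : t ≤ 1) : cc h 0 t = 0 := by
  rw [cc, if_pos le_rfl, cf, Int.cast_zero, min_eq_left]
  linarith [H.fm_mono le_rfl h0 h1]

lemma FinePL.cc_inv (H : FinePL N h) {n : ℤ} (hn : fm h 0 ≤ h 0 + n) (hn' : n ≤ h 1 - fm h 0)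
    (h0 : 0 ≤ t) (h1 : t ≤ 1) :
    cc (fun t => h t - 2 * cc h n t) (-n) t = - cc h n t := by
  rcases lt_trichotomy n 0 with hneg | rfl | hpos
  · have e : ∀ t, cc h n t = cf (GKM.rev h) (-n : ℤ) (1 - t) + n := fun t => by
      rw [cc, if_neg (by omega)]
    set g := GKM.rev fun u => GKM.rev h u - 2 * cf (GKM.rev h) (-n : ℤ) u
    have e2 : (fun t => h t - 2 * cc h n t) = fun t => g t + 2 * (-n : ℤ) := by
      funext t
      rw [e]; simp only [g, GKM.rev, sub_sub_cancel]; push_cast; ring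
    have hPL : PL N g := (H.rev.sub_PL _).rev
    rw [e2, cc, if_pos (by omega), hPL.cf_add _ _ h0 h1]
    have := H.rev.cf_inv (n := -n) (t := 1 - t) (by omega) (by
      rw [H.toPL.fm_rev_zero]; simp only [GKM.rev, sub_self]; push_cast; linarith)
      (by linarith) (by linarith)
    rw [sub_sub_cancel] at this
    rw [this, e]; push_cast; ring
  · have e : ∀ t, 0 ≤ t → t ≤ 1 → h t - 2 * cc h 0 t = h t := fun t h0 h1 => by
      rw [cc_zero H.toPL h0 h1]; ring
    rw [neg_zero, cc_congr e h0 h1, cc_zero H.toPL h0 h1, neg_zero]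
  · have e : ∀ t, cc h n t = cf h n t := fun t => by rw [cc, if_pos hpos.le]
    simp only [e]
    rw [cc, if_neg (by omega), neg_neg, H.cf_inv hpos.le hn' h0 h1]; push_cast; ring

lemma PL.cc_eq_zero (H : PL N h) {n : ℤ} {a : ℚ} (hn : (n : ℚ) = h 1 + a)
    (hm : fm h 0 ≤ -a) (h0 : 0 ≤ t) (h1 : t ≤ 1) (ha : ∀ u, 0 ≤ u → u < t → -a < h u)
    (ha' : -a ≤ h t) : cc h n t = 0 := by
  unfold cc
  split_ifs with hc
  · have h2 : fm h t = fm h 0 := by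
      apply le_antisymm _ (H.fm_mono le_rfl h0 h1)
      obtain ⟨u, h3, h4, h5⟩ := H.fm_att le_rfl zero_le_one
      rw [← h5]
      refine H.fm_le h0 ?_ h4
      by_contra! h6
      have := ha u h3 h6
      linarith
    rw [cf, h2, sub_self, min_eq_right (by exact_mod_cast hc)]
  · have h2 : -a ≤ fm (GKM.rev h) (1 - t) := by
      obtain ⟨u, h3, h4, h5⟩ := H.rev.fm_att (t := 1 - t) (by linarith) (by linarith)
      rw [← h5]
      rcases h3.eq_or_lt with rfl | h6
      · simpa [GKM.rev] using ha'
      · exact (ha (1 - u) (by linarith) (by linarith)).le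
    have h3 := H.fm_le le_rfl zero_le_one le_rfl
    rw [cf, H.fm_rev_zero, min_eq_left]
    · push_cast; ring
    · push_cast; linarith

lemma FinePL.first_hit (H : FinePL N h) {z : ℤ} (hm : fm h 0 ≤ z) (hz : (z : ℚ) ≤ h 0) :
    ∃ t, 0 ≤ t ∧ t ≤ 1 ∧ h t = z ∧ ∀ u, 0 ≤ u → u < t → z < h u := by
  classical
  have hex : ∃ k, k ≤ N ∧ h (nd N k) ≤ z := by
    obtain ⟨u, h1, h2, h3⟩ := H.fm_att le_rfl zero_le_one
    obtain ⟨k, hk, s, hs, hs', rfl⟩ := exists_cell_of_mem H.pos h1 h2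
    by_contra! hcon
    have h4 := hcon k hk.le
    have h5 := hcon (k + 1) hk
    rw [H.lin k hk s hs hs'] at h3
    have e1 := mul_nonneg hs (sub_nonneg.2 h5.le)
    have e2 := mul_nonneg (sub_nonneg.2 hs') (sub_nonneg.2 h4.le)
    rcases hs'.lt_or_eq with h6 | rfl
    · have e3 := mul_pos (sub_pos.2 h6) (sub_pos.2 h4)
      nlinarith
    · nlinarith
  obtain ⟨hk, hk'⟩ := Nat.find_spec hex
  set k := Nat.find hex
  have hmin : ∀ l < k, z < h (nd N l) := fun l hl => by
    by_contra! hcon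
    exact Nat.find_min hex hl ⟨by omega, hcon⟩
  have hkz : h (nd N k) = z := by
    rcases Nat.eq_zero_or_pos k with h0 | h0
    · rw [h0, nd_zero] at hk' ⊢
      linarith
    · refine hk'.antisymm ?_
      by_contra! hcon
      have := H.fineR (k - 1) (by omega) z
      rw [Nat.sub_add_cancel h0] at this
      have h2 := hmin (k - 1) (by omega)
      linarith [this hcon]
  refine ⟨nd N k, nd_nonneg _ _, nd_le_one H.pos hk, hkz, fun u h0 h1 => ?_⟩
  obtain ⟨l, hl, s, hs, hs', rfl⟩ := exists_cell_of_mem H.pos h0 (h1.le.trans (nd_le_one H.pos hk))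
  have hlk : l < k := by
    by_contra! hcon
    have := (nd_mono (N := N) hcon).trans (nd_le_cl hs)
    linarith
  rw [H.lin l hl s hs hs']
  have h2 := hmin l hlk
  rcases Nat.lt_or_ge (l + 1) k with h3 | h3
  · have h4 := hmin _ h3
    have e1 := mul_nonneg hs (sub_nonneg.2 h4.le)
    rcases hs'.lt_or_eq with h6 | rfl
    · have e3 := mul_pos (sub_pos.2 h6) (sub_pos.2 h2)
      nlinarith
    · nlinarith
  · have hkl : k = l + 1 := by omega
    have hs1 : s < 1 := by
      rcases hs'.lt_or_eq with h4 | rfl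
      · exact h4
      · rw [cl_one, hkl] at h1; exact absurd h1 (lt_irrefl _)
    rw [hkl] at hkz
    rw [hkz]
    have e3 := mul_pos (sub_pos.2 hs1) (sub_pos.2 h2)
    nlinarith

end

namespace Datum

variable {I V : Type*} [AddCommGroup V] [Module ℚ V] {D : Datum I V} {i j k l : I}
variable {lam x y z : V} {N M : ℕ} {d e : ℕ → V} {π σ : ℚ → V} {n : ℤ}

lemma clp_cl {N k : ℕ} (hk : k < N) {s : ℚ} (hs : 0 ≤ s) (hs' : s ≤ 1) :
    clp (cl N k s) = cl N k s :=
  clp_of_mem ((nd_nonneg _ _).trans (nd_le_cl hs)) ((cl_le_nd hs').trans (nd_le_one (by omega) hk))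

lemma clp_nd {N k : ℕ} (hN : 0 < N) (hk : k ≤ N) : clp (nd N k) = nd N k :=
  clp_of_mem (nd_nonneg _ _) (nd_le_one hN hk)

variable (D) in
/-- The root operators for a real index: `f_j^n` for `n ≥ 0` and `e_j^{-n}` for `n ≤ 0`. -/
noncomputable def G (j : I) (n : ℤ) (π : ℚ → V) (t : ℚ) : V :=
  π t - cc (D.hf j π) n (clp t) • D.α j

open Classical in
lemma sub_eq_pth (hN : 0 < N) {c : ℚ → ℚ} (hc : c 0 = 0) {K : ℕ → Prop}
    (h : ∀ k < N, (¬ K k ∧ ∀ s, 0 ≤ s → s ≤ 1 → c (cl N k s) = c (nd N k)) ∨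
      (K k ∧ ∀ s, 0 ≤ s → s ≤ 1 → c (cl N k s) - D.hf j (pth N d) (cl N k s) =
        c (nd N k) - D.hf j (pth N d) (nd N k))) :
    (fun t => pth N d t - c (clp t) • D.α j) =
      pth N fun k => if k < N ∧ K k then D.r j (d k) else d k := by
  refine eq_pth hN (fun t => by simp only [pth_clp, clp_clp]) ?_ fun k hk s hs hs' => ?_
  · simp only [pth_zero, clp_of_mem le_rfl zero_le_one, hc, zero_smul, sub_zero]
  · simp only [clp_cl hk hs hs', clp_nd hN hk.le, hk, true_and]
    rcases h k hk with ⟨hK, e⟩ | ⟨hK, e⟩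
    · rw [if_neg hK, e s hs hs', pth_cl' hk hs hs']; abel
    · rw [if_pos hK, r_apply]
      have e1 := e s hs hs'
      have e2 : D.hf j (pth N d) (cl N k s) =
          D.hf j (pth N d) (nd N k) + (s / N) * D.cr j (d k) := by
        rw [hf, pth_cl' hk hs hs', map_add, map_smul, smul_eq_mul, hf]
      have e3 : c (cl N k s) = c (nd N k) + (s / N) * D.cr j (d k) := by linarith
      rw [e3, pth_cl' hk hs hs']
      module

lemma one_sub_cl {N k : ℕ} (hk : k < N) (s : ℚ) : 1 - cl N k s = cl N (N - (k + 1)) (1 - s) := by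
  have hN : (N : ℚ) ≠ 0 := by
    have : 0 < N := by omega
    positivity
  unfold cl
  rw [Nat.cast_sub (by omega)]
  field_simp; push_cast; ring

lemma hf_zero (N : ℕ) (d : ℕ → V) (j : I) : D.hf j (pth N d) 0 = 0 := by
  simp [hf, pth_zero]

lemma Grd.G_mem (hlam : lam ∈ Pplus D.cr) (h : D.Grd lam N d) (hj : D.A j j = 2)
    (hf : D.Fine N d j) (hn : fm (D.hf j (pth N d)) 0 ≤ n) :
    D.G j n (pth N d) ∈ GLSset D.A D.α D.cr lam := by
  classical
  have H := h.finePL hlam hj hf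
  have hc0 : cc (D.hf j (pth N d)) n 0 = 0 := cc_at_zero H.toPL (by rw [hf_zero, zero_add]; exact hn)
  have hlt := fun k (hk : k < N) => h.hf_lt_iff hk j
  rcases le_or_gt 0 n with h0 | h0
  · have ec : ∀ t, cc (D.hf j (pth N d)) n t = cf (D.hf j (pth N d)) n t := fun t => by
      rw [cc, if_pos h0]
    let K : ℕ → Prop := fun k => cf (D.hf j (pth N d)) n (nd N (k + 1)) ≠
      cf (D.hf j (pth N d)) n (nd N k)
    have e := sub_eq_pth (D := D) (d := d) h.pos hc0 (K := K) fun k hk => by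
      simp only [ec, K]
      rcases H.cell_cases n hk with ⟨e1, e2⟩ | ⟨e1, e2, e3⟩
      · exact Or.inl ⟨fun h => h e1, e2⟩
      · refine Or.inr ⟨e2.ne', fun s hs hs' => ?_⟩
        have := (e3 0 le_rfl zero_le_one).2
        rw [cl_zero] at this
        rw [(e3 s hs hs').2, this]; ring
    change (fun t => _) ∈ _
    simp only [G]
    rw [e]
    refine
    (h.reflect_up hlam hj (fun k hk hK => ?_) (fun k hk hK hK' => ?_) fun k hk hK hK' => ?_).mem
    · rcases H.cell_cases n hk with ⟨e1, e2⟩ | ⟨e1, e2, e3⟩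
      · exact absurd e1 hK
      · exact (hlt k hk).1.1 e1
    · have := H.start n hk (not_not.1 hK) (Ne.symm hK')
      rwa [← not_lt, (hlt k (by omega)).1, not_lt] at this
    · rw [← h.node_int_iff hk.le]
      rcases H.leave n hk hK (not_not.1 hK') with h1 | h1
      · exact h1
      · rw [h.node_int_iff hk.le]
        rw [hf_succ hk] at h1
        have hN : (N : ℚ) ≠ 0 := by have := h.pos; positivity
        have : D.cr j (d (k + 1)) = 0 := by simpa [hN] using h1
        exact ⟨0, by rw [this]; simp⟩
  · set g := rev (D.hf j (pth N d)) with hg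
    have hgn : ∀ k ≤ N, g (nd N (N - k)) = D.hf j (pth N d) (nd N k) := fun k hk => by
      rw [hg, rev, nd_rev h.pos (by omega), Nat.sub_sub_self hk]
    have ec : ∀ t, cc (D.hf j (pth N d)) n t = cf g (-n : ℤ) (1 - t) + n := fun t => by
      rw [cc, if_neg (by omega)]
    let K : ℕ → Prop := fun k => cf g (-n : ℤ) (nd N (N - k)) ≠ cf g (-n : ℤ) (nd N (N - (k + 1)))
    have e := sub_eq_pth (D := D) (d := d) h.pos hc0 (K := K) fun k hk => by
      have hcell := H.rev.cell_cases (-n) (show N - (k + 1) < N by omega)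
      rw [show N - (k + 1) + 1 = N - k by omega] at hcell
      simp only [ec, K]
      have e4 : ∀ s, 1 - cl N k s = cl N (N - (k + 1)) (1 - s) := one_sub_cl hk
      have e5 : 1 - nd N k = nd N (N - k) := nd_rev h.pos hk.le
      rcases hcell with ⟨e1, e2⟩ | ⟨e1, e2, e3⟩
      · refine Or.inl ⟨fun h => h e1, fun s hs hs' => ?_⟩
        rw [e4, e5, e2 _ (by linarith) (by linarith), e1]
      · refine Or.inr ⟨e2.ne', fun s hs hs' => ?_⟩
        have h3 := (e3 1 zero_le_one le_rfl).2
        have h4 := (e3 (1 - s) (by linarith) (by linarith)).2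
        rw [cl_one, show N - (k + 1) + 1 = N - k by omega] at h3
        rw [← hg] at h3 h4
        rw [hgn k hk.le] at h3
        rw [e4, e5, h4, h3]
        have : g (cl N (N - (k + 1)) (1 - s)) = D.hf j (pth N d) (cl N k s) := by
          rw [hg, rev, ← e4, sub_sub_cancel]
        rw [this]; ring
    change (fun t => _) ∈ _
    simp only [G]
    rw [e]
    have hNk : ∀ k, k + 1 < N → N - (k + 2) + 1 = N - (k + 1) ∧ N -
    (k + 2) + 2 = N - k := fun k hk => by
      omega
    refine
    (h.reflect_dn hlam hj (fun k hk hK => ?_) (fun k hk hK hK' => ?_) fun k hk hK hK' => ?_).mem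
    · have hcell := H.rev.cell_cases (-n) (show N - (k + 1) < N by omega)
      rw [show N - (k + 1) + 1 = N - k by omega] at hcell
      rcases hcell with ⟨e1, e2⟩ | ⟨e1, e2, e3⟩
      · exact absurd e1 hK
      · rw [← hg, hgn k hk.le, hgn (k + 1) hk] at e1
        exact (hlt k hk).2.1 e1
    · have hst := H.rev.leave (-n) (k := N - (k + 2)) (by omega)
      rw [(hNk k hk).1, (hNk k hk).2] at hst
      rw [← h.node_int_iff hk.le, ← hgn (k + 1) hk.le]
      rcases hst hK' (not_not.1 hK) with h1 | h1
      · exact h1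
      · rw [hgn (k + 1) hk.le, h.node_int_iff hk.le]
        rw [← hg, hgn (k + 1) hk.le, hgn k (by omega), hf_succ (by omega)] at h1
        have hN : (N : ℚ) ≠ 0 := by have := h.pos; positivity
        have : D.cr j (d k) = 0 := by simpa [hN] using h1
        exact (R.int_iff (h.R k (by omega)) j).2 ⟨0, by rw [this]; simp⟩
    · have hst := H.rev.start (-n) (k := N - (k + 2)) (by omega)
      rw [(hNk k hk).1, (hNk k hk).2] at hst
      have := hst (not_not.1 hK').symm.symm (Ne.symm hK)
      rw [← hg, hgn (k + 1) hk.le, hgn (k + 2) hk, ← not_lt, (hlt _ hk).2, not_lt] at this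
      exact this

lemma hf_G (hj : D.A j j = 2) (t : ℚ) :
    D.hf j (D.G j n π) t = D.hf j π t - 2 * cc (D.hf j π) n (clp t) := by
  have : D.cr j (D.α j) = 2 := by rw [D.hpair, hj]; norm_num
  simp only [hf, G, map_sub, map_smul, smul_eq_mul, this]; ring

lemma G_G (hj : D.A j j = 2) (H : FinePL N (D.hf j π)) (h0 : D.hf j π 0 = 0)
    (hn : fm (D.hf j π) 0 ≤ n) (hn' : n ≤ D.hf j π 1 - fm (D.hf j π) 0) :
    D.G j (-n) (D.G j n π) = π := by
  funext t
  have h1 := clp_nonneg t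
  have h2 := clp_le_one t
  rw [G, cc_congr (h' := fun t => D.hf j π t - 2 * cc (D.hf j π) n t) _ h1 h2,
    H.cc_inv (by rw [h0, zero_add]; exact hn) hn' h1 h2, G]
  · simp
  · intro t h1 h2
    rw [hf_G hj, clp_of_mem h1 h2]

/-- The minimum of the weight function of a path. -/
noncomputable def mn (D : Datum I V) (j : I) (π : ℚ → V) : ℚ := fm (D.hf j π) 0

lemma path_finePL (hlam : lam ∈ Pplus D.cr) (hπ : π ∈ GLSset D.A D.α D.cr lam) (hj : D.A j j = 2) :
    ∃ N, FinePL N (D.hf j π) := by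
  obtain ⟨N, d, h1, h2, rfl⟩ := exists_fine hlam hπ j
  exact ⟨N, h1.finePL hlam hj h2⟩

lemma path_PL (hπ : π ∈ GLSset D.A D.α D.cr lam) (j : I) : ∃ N, PL N (D.hf j π) := by
  obtain ⟨N, d, h1, rfl⟩ := exists_grd hπ
  exact ⟨N, hf_PL h1.pos j d⟩

lemma path_zero (hπ : π ∈ GLSset D.A D.α D.cr lam) : π 0 = 0 := by
  obtain ⟨N, d, h1, rfl⟩ := exists_grd hπ
  exact pth_zero _ _

lemma path_sub_mem (hπ : π ∈ GLSset D.A D.α D.cr lam) : lam - π 1 ∈ Qplus D.α := by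
  obtain ⟨N, d, h1, rfl⟩ := exists_grd hπ
  exact h1.sub_one_mem

lemma path_one_int (hlam : lam ∈ Pplus D.cr) (hπ : π ∈ GLSset D.A D.α D.cr lam) (j : I) :
    ∃ z : ℤ, D.cr j (π 1) = z := by
  obtain ⟨N, d, h1, rfl⟩ := exists_grd hπ
  exact h1.one_int hlam j

lemma mn_le (hπ : π ∈ GLSset D.A D.α D.cr lam) {t : ℚ} (h0 : 0 ≤ t) (h1 : t ≤ 1) :
    D.mn j π ≤ D.cr j (π t) := by
  obtain ⟨N, h⟩ := path_PL (D := D) hπ j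
  exact h.fm_le le_rfl h0 h1

lemma mn_nonpos (hπ : π ∈ GLSset D.A D.α D.cr lam) : D.mn j π ≤ 0 := by
  have := mn_le (D := D) hπ (j := j) le_rfl zero_le_one
  rwa [path_zero hπ, map_zero] at this

lemma mn_att (hπ : π ∈ GLSset D.A D.α D.cr lam) (j : I) :
    ∃ t, 0 ≤ t ∧ t ≤ 1 ∧ D.cr j (π t) = D.mn j π := by
  obtain ⟨N, h⟩ := path_PL (D := D) hπ j
  exact h.fm_att le_rfl zero_le_one

lemma mn_int (hlam : lam ∈ Pplus D.cr) (hπ : π ∈ GLSset D.A D.α D.cr lam) (hj : D.A j j = 2) :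
    ∃ z : ℤ, D.mn j π = z := by
  obtain ⟨N, h⟩ := path_finePL hlam hπ hj
  exact h.fm_zero_int

lemma G_mem (hlam : lam ∈ Pplus D.cr) (hπ : π ∈ GLSset D.A D.α D.cr lam) (hj : D.A j j = 2)
    (hn : D.mn j π ≤ n) :
    D.G j n π ∈ GLSset D.A D.α D.cr lam := by
  obtain ⟨N, d, h1, h2, rfl⟩ := exists_fine hlam hπ j
  exact h1.G_mem hlam hj h2 hn

lemma G_neg (hlam : lam ∈ Pplus D.cr) (hπ : π ∈ GLSset D.A D.α D.cr lam) (hj : D.A j j = 2)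
    (hn : D.mn j π ≤ n) (hn' : n ≤ D.cr j (π 1) - D.mn j π) :
    D.G j (-n) (D.G j n π) = π := by
  obtain ⟨N, h⟩ := path_finePL hlam hπ hj
  exact G_G hj h (by simp [hf, path_zero hπ]) hn hn'

lemma G_one (hπ : π ∈ GLSset D.A D.α D.cr lam) (hn' : n ≤ D.cr j (π 1) - D.mn j π) :
    D.G j n π 1 = π 1 - (n : ℚ) • D.α j := by
  obtain ⟨N, h⟩ := path_PL (D := D) hπ j
  rw [G, clp_one, cc_at_one h hn']

lemma first_hit (hlam : lam ∈ Pplus D.cr) (hπ : π ∈ GLSset D.A D.α D.cr lam) (hj : D.A j j = 2)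
    {a : ℕ} (hm : D.mn j π ≤ -(a : ℚ)) :
    ∃ t, 0 ≤ t ∧ t ≤ 1 ∧ D.cr j (π t) = -(a : ℚ) ∧ ∀ u, 0 ≤ u → u < t →
      -(a : ℚ) < D.cr j (π u) := by
  obtain ⟨N, h⟩ := path_finePL hlam hπ hj
  have := h.first_hit (z := -(a : ℤ)) (by push_cast; exact hm) (by simp [hf, path_zero hπ])
  push_cast at this
  exact this

variable (D) in
/-- The reflection-type involution on paths whose `j`-weight reaches `-a`. -/
noncomputable def Top (j : I) (a : ℕ) (π : ℚ → V) : ℚ → V :=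
  D.G j (⌊D.cr j (π 1)⌋ + a) π

section Top

variable {a : ℕ}

lemma Top_range (hlam : lam ∈ Pplus D.cr) (hπ : π ∈ GLSset D.A D.α D.cr lam)
    (ha : D.mn j π ≤ -(a : ℚ)) : D.mn j π ≤ (⌊D.cr j (π 1)⌋ + a : ℤ) ∧
    ((⌊D.cr j (π 1)⌋ + a : ℤ) : ℚ) ≤ D.cr j (π 1) - D.mn j π ∧
    (⌊D.cr j (π 1)⌋ : ℚ) = D.cr j (π 1) := by
  obtain ⟨z, hz⟩ := path_one_int hlam hπ j
  have h1 := mn_le (D := D) hπ (j := j) zero_le_one le_rfl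
  rw [hz] at h1 ⊢
  rw [Int.floor_intCast]
  push_cast
  have : (0 : ℚ) ≤ a := by positivity
  refine ⟨by linarith, by linarith, rfl⟩

lemma Top_mem (hlam : lam ∈ Pplus D.cr) (hπ : π ∈ GLSset D.A D.α D.cr lam) (hj : D.A j j = 2)
    (ha : D.mn j π ≤ -(a : ℚ)) : D.Top j a π ∈ GLSset D.A D.α D.cr lam :=
  G_mem hlam hπ hj (Top_range hlam hπ ha).1

lemma Top_one (hlam : lam ∈ Pplus D.cr) (hπ : π ∈ GLSset D.A D.α D.cr lam)
    (ha : D.mn j π ≤ -(a : ℚ)) : D.Top j a π 1 = D.r j (π 1) - (a : ℚ) • D.α j := by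
  rw [Top, G_one hπ (Top_range hlam hπ ha).2.1, r_apply]
  push_cast
  rw [(Top_range hlam hπ ha).2.2]
  module

lemma Top_eq (hlam : lam ∈ Pplus D.cr) (hπ : π ∈ GLSset D.A D.α D.cr lam) (ha : D.mn j π ≤ -(a : ℚ))
    {t : ℚ} (h0 : 0 ≤ t) (h1 : t ≤ 1) (h2 : ∀ u, 0 ≤ u → u < t → -(a : ℚ) < D.cr j (π u))
    (h3 : -(a : ℚ) ≤ D.cr j (π t)) : D.Top j a π t = π t := by
  obtain ⟨N, h⟩ := path_PL (D := D) hπ j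
  rw [Top, G, clp_of_mem h0 h1, h.cc_eq_zero (a := a) _ ha h0 h1 h2 h3, zero_smul, sub_zero]
  push_cast
  rw [(Top_range hlam hπ ha).2.2]; rfl

lemma Top_Top (hlam : lam ∈ Pplus D.cr) (hπ : π ∈ GLSset D.A D.α D.cr lam) (hj : D.A j j = 2)
    (ha : D.mn j π ≤ -(a : ℚ)) : D.Top j a (D.Top j a π) = π := by
  have e : ⌊D.cr j (D.Top j a π 1)⌋ + (a : ℤ) = -(⌊D.cr j (π 1)⌋ + a) := by
    obtain ⟨z, hz⟩ := path_one_int hlam hπ j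
    have h2 : D.cr j (D.α j) = 2 := by rw [D.hpair, hj]; norm_num
    have : D.cr j (D.Top j a π 1) = (-z - 2 * a : ℤ) := by
      rw [Top_one hlam hπ ha, map_sub, D.cr_r hj, map_smul, h2, hz]
      push_cast [smul_eq_mul]; ring
    rw [this, hz, Int.floor_intCast, Int.floor_intCast]; ring
  rw [Top, e]
  exact G_neg hlam hπ hj (Top_range hlam hπ ha).1 (Top_range hlam hπ ha).2.1

end Top

end Datum
end GKM

namespace GKM
namespace Datum

variable {I V : Type*} [AddCommGroup V] [Module ℚ V] {D : Datum I V} {i j k l : I}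
variable {lam x y z : V} {N M : ℕ} {d e : ℕ → V} {π σ : ℚ → V}

variable (D) in
/-- The root operator for an imaginary index. -/
noncomputable def fi (i : I) (π : ℚ → V) (t : ℚ) : V := π t - min 1 (D.cr i (π t)) • D.α i

lemma cr_fi (l i : I) (π : ℚ → V) (t : ℚ) :
    D.cr l (D.fi i π t) = D.cr l (π t) - min 1 (D.cr i (π t)) * D.A l i := by
  rw [fi, map_sub, map_smul, D.hpair, smul_eq_mul]

lemma cr_fi_of_zero (h : D.A l i = 0) (π : ℚ → V) (t : ℚ) :
    D.cr l (D.fi i π t) = D.cr l (π t) := by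
  rw [cr_fi, h]; simp

lemma fi_comm (h : D.A i k = 0) (h' : D.A k i = 0) (π : ℚ → V) :
    D.fi i (D.fi k π) = D.fi k (D.fi i π) := by
  funext t
  rw [fi, cr_fi_of_zero h, fi, fi, cr_fi_of_zero h', fi]; abel

lemma fi_inj (hi : D.A i i ≠ 2) (h : D.fi i π = D.fi i σ) : π = σ := by
  funext t
  have h1 := congrFun h t
  have h2 : D.cr i (D.fi i π t) = D.cr i (D.fi i σ t) := by rw [h1]
  rw [cr_fi, cr_fi] at h2
  have hA : (D.A i i : ℚ) ≤ 0 := by exact_mod_cast A_nonpos hi i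
  have h3 : D.cr i (π t) = D.cr i (σ t) := by
    rcases lt_trichotomy (D.cr i (π t)) (D.cr i (σ t)) with h3 | h3 | h3
    · have := min_le_min_left 1 h3.le
      nlinarith
    · exact h3
    · have := min_le_min_left 1 h3.le
      nlinarith
  rw [fi, fi, h3] at h1
  exact sub_left_injective h1

lemma Grd.cr_succ_le (h : D.Grd lam N d) (hi : D.A i i ≠ 2) (k : ℕ) :
    D.cr i (d (k + 1)) ≤ D.cr i (d k) := by
  rcases lt_or_ge k N with hk | hk
  · have := h.pos
    exact R.cr_le (by positivity) (h.R k hk) hi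
  · rw [h.ge k hk, h.ge (k + 1) (by omega)]

lemma Grd.cr_anti (h : D.Grd lam N d) (hi : D.A i i ≠ 2) : Antitone fun k => D.cr i (d k) :=
  antitone_nat_of_succ_le (h.cr_succ_le hi)

lemma Grd.exists_nat (hlam : lam ∈ Pplus D.cr) (h : D.Grd lam N d) (hi : D.A i i ≠ 2) (k : ℕ) :
    ∃ C : ℕ, D.cr i (d k) = C :=
  exists_nat_of_int ((h.T k).int hlam i) ((h.T k).imag_nonneg hlam hi)

lemma Grd.one_pos_iff (hlam : lam ∈ Pplus D.cr) (h : D.Grd lam N d) (hi : D.A i i ≠ 2) :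
    0 < D.cr i (pth N d 1) ↔ 0 < D.cr i (d 0) := by
  have hN : (0 : ℚ) < N := by have := h.pos; positivity
  rw [pth_one h.pos, map_smul, map_sum, smul_eq_mul]
  have h0 := fun k => (h.T k).imag_nonneg hlam hi
  have h1 := fun k => h.cr_anti hi (Nat.zero_le k)
  constructor
  · intro h2
    by_contra! h3
    rw [Finset.sum_eq_zero fun k _ => le_antisymm ((h1 k).trans h3) (h0 k)] at h2
    simp at h2
  · intro h2
    refine mul_pos (by positivity) (Finset.sum_pos' (fun k _ => h0 k) ⟨0, ?_, h2⟩)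
    exact Finset.mem_range.2 h.pos

lemma Grd.of_T (hN : 0 < N) (hge : ∀ k, N ≤ k → d k = lam)
    (hR : ∀ k < N, D.T lam (d (k + 1)) → D.R lam (((k + 1 : ℕ) : ℚ) / N) (d (k + 1)) (d k)) :
    D.Grd lam N d := by
  have hT : ∀ m ≤ N, D.T lam (d (N - m)) := by
    intro m
    induction m with
    | zero => intro _; rw [hge _ (by omega)]; exact T.self D
    | succ m ih =>
      intro hm
      have := hR (N - (m + 1)) (by omega)
      rw [show N - (m + 1) + 1 = N - m by omega] at this
      exact R.T_right (this (ih (by omega))) (ih (by omega))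
  refine ⟨hN, hge, fun k hk => hR k hk ?_⟩
  have := hT (N - (k + 1)) (by omega)
  rwa [show N - (N - (k + 1)) = k + 1 by omega] at this

section lower

variable {C q : ℕ}

lemma Grd.lower_pos (h : D.Grd lam N d) (hq : C * q = N) : 0 < C ∧ 0 < q ∧ q ≤ N ∧
    (N : ℚ) = C * q := by
  have := h.pos
  rw [← hq] at this
  have h1 := Nat.pos_of_mul_pos_right this
  have h2 := Nat.pos_of_mul_pos_left this
  exact ⟨h1, h2, by nlinarith, by rw [← hq]; push_cast; ring⟩

lemma Grd.imag_orth (hlam : lam ∈ Pplus D.cr) (h : D.Grd lam N d) (hi : D.A i i ≠ 2)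
    (hC : D.cr i (d 0) = C) (hq : C * q = N) {k : ℕ} (hk : k + 1 < q) : D.Orth i
    (d (k + 1) - d k) := by
  obtain ⟨h1, h2, h3, h4⟩ := h.lower_pos hq
  have hN := h.pos
  refine R.orth hlam (by positivity) (h.R k (by omega)) hi ?_
  have h5 := h.cr_anti hi (Nat.zero_le k)
  simp only [hC] at h5
  have hN : (0 : ℚ) < N := by positivity
  have h6 : ((k + 1 : ℕ) : ℚ) < q := by exact_mod_cast hk
  have h7 : (0 : ℚ) < C := by exact_mod_cast h1
  rw [div_mul_eq_mul_div, div_lt_one hN, h4]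
  have := (h.T k).imag_nonneg hlam hi
  have h8 : (0 : ℚ) ≤ ((k + 1 : ℕ) : ℚ) := by positivity
  nlinarith

lemma Grd.imag_const (hlam : lam ∈ Pplus D.cr) (h : D.Grd lam N d) (hi : D.A i i ≠ 2)
    (hC : D.cr i (d 0) = C) (hq : C * q = N) {k : ℕ} (hk : k < q) : D.cr i (d k) = C := by
  induction k with
  | zero => exact hC
  | succ k ih =>
    have := (h.imag_orth hlam hi hC hq hk).2
    rw [map_sub, ih (by omega)] at this
    linarith

lemma Grd.lower (hlam : lam ∈ Pplus D.cr) (h : D.Grd lam N d) (hi : D.A i i ≠ 2)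
    (hC : D.cr i (d 0) = C) (hq : C * q = N) : D.Grd lam N fun k => if k < q then D.r i
    (d k) else d k := by
  obtain ⟨h1, h2, h3, h4⟩ := h.lower_pos hq
  have hN := h.pos
  have hN' : (0 : ℚ) < N := by positivity
  refine ⟨hN, fun k hk => by rw [if_neg (by omega), h.ge k hk], fun k hk => ?_⟩
  have ha : (0 : ℚ) < ((k + 1 : ℕ) : ℚ) / N := by positivity
  have hR := h.R k hk
  rcases lt_trichotomy (k + 1) q with h5 | h5 | h5
  · rw [if_pos h5, if_pos (by omega), r_apply, r_apply, h.imag_const hlam hi hC hq h5,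
      h.imag_const hlam hi hC hq (by omega), sub_eq_add_neg, sub_eq_add_neg, ← neg_smul]
    refine hR.shift hlam ha (h.imag_orth hlam hi hC hq h5) ?_
    have := (h.T (k + 1)).r i
    rwa [r_apply, h.imag_const hlam hi hC hq h5, sub_eq_add_neg, ← neg_smul] at this
  · rw [if_neg (by omega), if_pos (by omega)]
    have hc := h.imag_const hlam hi hC hq (k := k) (by omega)
    have h1' : (0 : ℚ) < C := by exact_mod_cast h1
    refine hR.tail ⟨i, _, _, Cov.simple hlam (h.T k) (by rw [hc]; exact h1'),
      fun hi' => absurd hi' hi, fun _ => ?_⟩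
    rw [hc, h5, h4]
    have : (q : ℚ) ≠ 0 := by positivity
    field_simp
  · rw [if_neg (by omega), if_neg (by omega)]; exact hR

lemma Grd.fi_eq (hlam : lam ∈ Pplus D.cr) (h : D.Grd lam N d) (hi : D.A i i ≠ 2)
    (hC : D.cr i (d 0) = C) (hq : C * q = N) : D.fi i (pth N d) = pth N fun k => if k < q then D.r i
    (d k) else d k := by
  obtain ⟨h1, h2, h3, h4⟩ := h.lower_pos hq
  have hN := h.pos
  have hN' : (0 : ℚ) < N := by positivity
  have h1' : (0 : ℚ) < C := by exact_mod_cast h1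
  have h2' : (0 : ℚ) < q := by exact_mod_cast h2
  have e1 : ∀ k ≤ q, D.cr i (pth N d (nd N k)) = C * k / N := by
    intro k hk
    induction k with
    | zero => rw [nd_zero, pth_zero]; simp
    | succ k ih =>
      rw [pth_succ (by omega), map_add, map_smul, ih (by omega),
        h.imag_const hlam hi hC hq (by omega), smul_eq_mul]
      push_cast; ring
  have e2 : ∀ k, q ≤ k → k ≤ N → 1 ≤ D.cr i (pth N d (nd N k)) := by
    intro k hk hk'
    induction k, hk using Nat.le_induction with
    | base => rw [e1 q le_rfl, h4, div_self (by positivity)]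
    | succ k hk ih =>
      rw [pth_succ (by omega), map_add, map_smul, smul_eq_mul]
      have := ih (by omega)
      have h6 := (h.T k).imag_nonneg hlam hi
      have : 0 ≤ 1 / (N : ℚ) * D.cr i (d k) := by positivity
      linarith
  refine eq_pth hN (fun t => by simp only [fi, pth_clp]) ?_ fun k hk s hs hs' => ?_
  · simp [fi, pth_zero]
  · simp only [fi]
    rw [pth_cl' hk hs hs', map_add, map_smul, smul_eq_mul]
    rcases lt_or_ge k q with h5 | h5
    · rw [if_pos h5, r_apply, h.imag_const hlam hi hC hq h5, e1 k h5.le, min_eq_right, min_eq_right]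
      · module
      · rw [h4, div_le_one (by positivity)]
        have : (k : ℚ) ≤ q := by exact_mod_cast h5.le
        nlinarith
      · have : C * (k : ℚ) / N + s / N * C = C * (k + s) / N := by ring
        rw [this, h4, div_le_one (by positivity)]
        have : (k : ℚ) + 1 ≤ q := by exact_mod_cast h5
        nlinarith
    · rw [if_neg (by omega), min_eq_left, min_eq_left (e2 k h5 hk.le)]
      · abel
      · have := e2 k h5 hk.le
        have h6 := (h.T k).imag_nonneg hlam hi
        have : 0 ≤ s / (N : ℚ) * D.cr i (d k) := by positivity
        linarith

end lower

/-- A grid adapted to the imaginary index `i`. -/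
lemma Grd.refine_imag (h : D.Grd lam N d) {C : ℕ} (hM : 0 < M) (hC : D.cr i (d 0) = C)
    (hCM : C ∣ M) :
    D.Grd lam (N * M) (fun k => d (k / M)) ∧ D.cr i ((fun k => d (k / M)) 0) = C ∧
      ∃ q, C * q = N * M := by
  refine ⟨h.refine hM, by simpa using hC, ?_⟩
  obtain ⟨m, rfl⟩ := hCM
  exact ⟨N * m, by ring⟩

lemma fi_mem (hlam : lam ∈ Pplus D.cr) (hπ : π ∈ GLSset D.A D.α D.cr lam) (hi : D.A i i ≠ 2)
    (h : 0 < D.cr i (π 1)) : D.fi i π ∈ GLSset D.A D.α D.cr lam := by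
  obtain ⟨N, d, hd, rfl⟩ := exists_grd hπ
  rw [hd.one_pos_iff hlam hi] at h
  obtain ⟨C, hC⟩ := hd.exists_nat hlam hi 0
  have hC0 : 0 < C := by rw [hC] at h; exact_mod_cast h
  obtain ⟨h1, h2, q, hq⟩ := hd.refine_imag hC0 hC dvd_rfl
  rw [← pth_refine hd.pos hC0, h1.fi_eq hlam hi h2 hq]
  exact (h1.lower hlam hi h2 hq).mem

lemma one_le_of_pos (hlam : lam ∈ Pplus D.cr) (hπ : π ∈ GLSset D.A D.α D.cr lam)
    (h : 0 < D.cr i (π 1)) : 1 ≤ D.cr i (π 1) := by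
  obtain ⟨z, hz⟩ := path_one_int (D := D) hlam hπ i
  rw [hz] at h ⊢
  exact_mod_cast (by exact_mod_cast h : (0 : ℤ) < z)

lemma fi_one (hlam : lam ∈ Pplus D.cr) (hπ : π ∈ GLSset D.A D.α D.cr lam)
    (h : 0 < D.cr i (π 1)) : D.fi i π 1 = π 1 - D.α i := by
  rw [fi, min_eq_left (one_le_of_pos hlam hπ h), one_smul]

end Datum
end GKM

namespace GKM
namespace Datum

variable {I V : Type*} [AddCommGroup V] [Module ℚ V] {D : Datum I V} {i j k l : I}
variable {lam x y z : V} {N M : ℕ} {d e : ℕ → V} {π σ : ℚ → V} {a : ℚ}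

/-- A path with real-dominant initial direction, not equal to the straight path, is in the image of
a lowering operator for an imaginary index. -/
lemma Grd.exists_raise (hlam : lam ∈ Pplus D.cr) (h : D.Grd lam N d)
    (hdom : ∀ j, D.A j j = 2 → 0 ≤ D.cr j (d 0)) (hne : ∃ k, d k ≠ lam) :
    ∃ i, D.A i i ≠ 2 ∧ ∃ σ ∈ GLSset D.A D.α D.cr lam, 0 < D.cr i (σ 1) ∧ D.fi i σ = pth N d := by
  classical
  have hN := h.pos
  have hN' : (0 : ℚ) < N := by positivity
  have hex : ∃ p, d (p + 1) ≠ d p := by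
    by_contra! hcon
    have : ∀ k, d k = d 0 := fun k => by
      induction k with
      | zero => rfl
      | succ k ih => rw [hcon, ih]
    obtain ⟨k, hk⟩ := hne
    exact hk (by rw [this, ← this N, h.ge N le_rfl])
  set p := Nat.find hex with hp
  have hp1 : d (p + 1) ≠ d p := Nat.find_spec hex
  have hp2 : ∀ k ≤ p, d k = d 0 := fun k hk => by
    induction k with
    | zero => rfl
    | succ k ih =>
      rw [← ih (by omega)]
      have := Nat.find_min hex (m := k) (by omega)
      exact not_not.1 this
  clear_value p
  have hpN : p < N := by
    by_contra! hcon
    exact hp1 (by rw [h.ge p hcon, h.ge (p + 1) (by omega)])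
  have hR := h.R p hpN
  set b : ℚ := ((p + 1 : ℕ) : ℚ) / N with hb
  have hb0 : 0 < b := by positivity
  rcases hR.cases_tail with h1 | ⟨x, hx, hstep⟩
  · exact absurd h1.symm hp1
  obtain ⟨k, β, βv, hc, hA⟩ := hstep
  rw [hp2 p le_rfl] at hc
  have hk : D.A k k ≠ 2 := by
    intro hk
    have e1 : βv (d 0) = - βv x := by
      rw [hc.eq, map_sub, map_smul, hc.pair.self, hk, smul_eq_mul]; push_cast; ring
    obtain ⟨c, c', e2, e3, e4⟩ := hc.pair.pos hc.mem
    have e5 : 0 ≤ βv (d 0) := by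
      rw [e3, cs, Finsupp.sum, LinearMap.sum_apply]
      refine Finset.sum_nonneg fun l _ => ?_
      rw [LinearMap.smul_apply, smul_eq_mul]
      refine mul_nonneg (by positivity) ?_
      by_cases hl : D.A l l = 2
      · exact hdom l hl
      · exact (h.T 0).imag_nonneg hlam hl
    linarith [hc.pos]
  obtain ⟨e1, e2⟩ : β = D.α k ∧ βv = D.cr k := by
    rcases hc.pair.imag_cases hk with h1 | ⟨j, hj, h1⟩
    · exact h1
    · exact absurd (hdom j hj) (not_le.2 (hc.imag_neg hlam hk hj h1).2)
  subst e1 e2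
  have hCb := hA.2 hk
  have hd0 : d 0 = D.r k x := by rw [hc.eq, r_apply]
  have hge : D.Grd lam N fun l => if l < p + 1 then x else d l := by
    refine ⟨hN, fun l hl => by rw [if_neg (by omega), h.ge l hl], fun l hl => ?_⟩
    rcases lt_trichotomy l p with h1 | h1 | h1
    · rw [if_pos (by omega), if_pos (by omega)]
    · rw [if_neg (by omega), if_pos (by omega), h1]; exact hx
    · rw [if_neg (by omega), if_neg (by omega)]; exact h.R l hl
  obtain ⟨C, hC⟩ := hge.exists_nat hlam hk 0
  simp only [Nat.zero_lt_succ, if_true] at hC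
  have hq : C * (p + 1) = N := by
    rw [hC, hb] at hCb
    field_simp at hCb
    exact_mod_cast (by linarith : (C : ℚ) * ((p + 1 : ℕ) : ℚ) = N)
  refine ⟨k, hk, _, hge.mem, ?_, ?_⟩
  · rw [hge.one_pos_iff hlam hk]; simpa using hc.pos
  · rw [hge.fi_eq hlam hk (by simpa using hC) hq]
    refine pth_congr fun l hl => ?_
    split_ifs with h1
    · rw [hp2 l (by omega), hd0]
    · rfl

/-- Two elements of the image of a lowering operator on a common adapted grid. -/
lemma exists_common {i k : I} (hlam : lam ∈ Pplus D.cr) (hπ : π ∈ GLSset D.A D.α D.cr lam)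
    (hσ : σ ∈ GLSset D.A D.α D.cr lam) (hi : D.A i i ≠ 2) (hk : D.A k k ≠ 2)
    (h : 0 < D.cr i (π 1)) (h' : 0 < D.cr k (σ 1)) :
    ∃ N d e C q C' q', D.Grd lam N d ∧ D.Grd lam N e ∧ π = pth N d ∧ σ = pth N e ∧
      D.cr i (d 0) = (C : ℕ) ∧ D.cr k (e 0) = (C' : ℕ) ∧ C * q = N ∧ C' * q' = N := by
  obtain ⟨N, d, hd, rfl⟩ := exists_grd hπ
  obtain ⟨M, e, he, rfl⟩ := exists_grd hσ
  rw [hd.one_pos_iff hlam hi] at h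
  rw [he.one_pos_iff hlam hk] at h'
  obtain ⟨C, hC⟩ := hd.exists_nat hlam hi 0
  obtain ⟨C', hC'⟩ := he.exists_nat hlam hk 0
  have hC0 : 0 < C := by rw [hC] at h; exact_mod_cast h
  have hC0' : 0 < C' := by rw [hC'] at h'; exact_mod_cast h'
  have hN := hd.pos
  have hM := he.pos
  obtain ⟨h1, h2, q, hq⟩ := hd.refine_imag (M := C * (C' * M)) (by positivity) hC (dvd_mul_right _ _)
  obtain ⟨h1', h2', q', hq'⟩ := he.refine_imag (M := C' * (C * N)) (by positivity) hC'
    (dvd_mul_right _ _)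
  have e1 : N * (C * (C' * M)) = M * (C' * (C * N)) := by ring
  refine ⟨N * (C * (C' * M)), _, _, C, q, C', q', h1, e1 ▸ h1', ?_, ?_, h2, h2', hq, by rw [hq', e1]⟩
  · rw [pth_refine hN (by positivity)]
  · rw [e1, pth_refine hM (by positivity)]

lemma R.first_cov (hlam : lam ∈ Pplus D.cr) (ha : 0 < a) (hi : D.A i i ≠ 2) (hk : D.A k k ≠ 2)
    (h : D.R lam a x y) (h0 : (D.crd (lam - x) i = 0 ∧ D.crd (lam - x) k = 0) ∨ ∃ z, D.T lam z ∧
      D.Cone (z - x) ∧ D.crd (lam - z) i = 0 ∧ D.crd (lam - z) k = 0 ∧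
      (0 < D.cr i z ∨ 0 < D.cr k z)) :
    (D.crd (lam - y) i = 0 ∧ D.crd (lam - y) k = 0) ∨ ∃ z, D.T lam z ∧
      D.Cone (z - y) ∧ D.crd (lam - z) i = 0 ∧ D.crd (lam - z) k = 0 ∧
      (0 < D.cr i z ∨ 0 < D.cr k z) := by
  induction h with
  | refl => exact h0
  | @tail y y' h1 h2 ih =>
    have hcone := h2.cone ha
    rcases ih with ⟨h3, h4⟩ | ⟨z, h3, h4, h5⟩
    · obtain ⟨l, β, βv, hc, -⟩ := h2
      have key : ∀ m, D.A m m ≠ 2 → D.crd (lam - y) m = 0 →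
          D.crd (lam - y') m = 0 ∨ 0 < D.cr m y := by
        intro m hm h5
        by_cases hlm : l = m
        · subst hlm
          exact Or.inr (hc.pos.trans_le (hc.imag_ge hlam hm))
        · left
          have : D.crd (y - y') m = 0 := by
            rw [hc.sub_eq, map_smul, Finsupp.smul_apply, hc.pair.crd_imag hm, if_neg hlm, smul_zero]
          rw [← sub_add_sub_cancel lam y y', map_add, Finsupp.add_apply, h5, this, add_zero]
      rcases key i hi h3 with h5 | h5
      · rcases key k hk h4 with h6 | h6
        · exact Or.inl ⟨h5, h6⟩
        · exact Or.inr ⟨y, hc.T, hcone, h3, h4, Or.inr h6⟩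
      · exact Or.inr ⟨y, hc.T, hcone, h3, h4, Or.inl h5⟩
    · refine Or.inr ⟨z, h3, ?_, h5⟩
      rw [← sub_add_sub_cancel z y y']
      exact h4.add hcone

lemma Grd.first_cov (hlam : lam ∈ Pplus D.cr) (h : D.Grd lam N d) (hi : D.A i i ≠ 2)
    (hk : D.A k k ≠ 2) (n : ℕ) :
    (D.crd (lam - d n) i = 0 ∧ D.crd (lam - d n) k = 0) ∨ ∃ z, D.T lam z ∧
      D.Cone (z - d n) ∧ D.crd (lam - z) i = 0 ∧ D.crd (lam - z) k = 0 ∧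
      (0 < D.cr i z ∨ 0 < D.cr k z) := by
  rcases le_or_gt N n with hn | hn
  · rw [h.ge n hn]; simp
  · obtain ⟨m, hm⟩ := Nat.exists_eq_add_of_le hn.le
    clear hn
    induction m generalizing n with
    | zero => rw [h.ge n (by omega)]; simp
    | succ m ih =>
      have := h.pos
      exact (h.R n (by omega)).first_cov hlam (by positivity) hi hk (ih (n + 1) (by omega))

lemma Cone.cr_imag_two {z : V} (h : D.Cone z) (hi : D.A i i ≠ 2) (hik : i ≠ k) :
    D.cr i z ≤ D.A i i * D.crd z i + D.A i k * D.crd z k := by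
  classical
  have h1 : D.Cone (z - D.crd z k • D.α k) := by
    refine ⟨(D.crd z).erase k, fun l => ?_, ?_⟩
    · rw [Finsupp.erase_apply]; split_ifs
      · exact le_rfl
      · exact h.crd_nonneg l
    · conv_lhs => rw [h.eq, crd_linearCombination]
      rw [← Finsupp.erase_add_single k (D.crd z), map_add]
      simp
  have h2 := h1.cr_imag hi i
  rw [map_sub, map_smul, D.hpair, map_sub, map_smul, Finsupp.sub_apply, Finsupp.smul_apply,
    D.crd_α_ne (Ne.symm hik), smul_eq_mul, smul_zero, sub_zero] at h2
  linarith

/-- Distinct imaginary indices whose lowering operators have a common value are orthogonal. -/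
lemma fi_perp (hlam : lam ∈ Pplus D.cr) (hπ : π ∈ GLSset D.A D.α D.cr lam)
    (hσ : σ ∈ GLSset D.A D.α D.cr lam) (hi : D.A i i ≠ 2) (hk : D.A k k ≠ 2)
    (h : 0 < D.cr i (π 1)) (h' : 0 < D.cr k (σ 1)) (hik : i ≠ k) (he : D.fi i π = D.fi k σ) :
    D.A i k = 0 := by
  obtain ⟨N, d, e, C, q, C', q', hd, hde, rfl, rfl, hC, hC', hq, hq'⟩ :=
    exists_common hlam hπ hσ hi hk h h'
  have hl := hd.lower hlam hi hC hq
  have hl' := hde.lower hlam hk hC' hq'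
  rw [hd.fi_eq hlam hi hC hq, hde.fi_eq hlam hk hC' hq'] at he
  have h0 := eq_of_pth_eq he hd.pos
  obtain ⟨p1, p2, -, -⟩ := hd.lower_pos hq
  obtain ⟨p1', p2', -, -⟩ := hde.lower_pos hq'
  simp only [p2, p2', if_true] at h0
  set ν := D.r i (d 0) with hν
  have e1 : d 0 = ν + (C : ℚ) • D.α i := by rw [hν, r_apply, hC]; abel
  have e2 : e 0 = ν + (C' : ℚ) • D.α k := by rw [h0, r_apply, hC']; abel
  have hci : (C : ℚ) ≤ D.crd (lam - ν) i := by
    have := (Cone.of_Qplus ((hd.T 0).sub_mem hlam)).crd_nonneg i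
    rw
    [e1, ← sub_sub, map_sub, map_smul, Finsupp.sub_apply, Finsupp.smul_apply, D.crd_α_self] at this
    simp at this ⊢
    linarith
  have hck : (C' : ℚ) ≤ D.crd (lam - ν) k := by
    have := (Cone.of_Qplus ((hde.T 0).sub_mem hlam)).crd_nonneg k
    rw
    [e2, ← sub_sub, map_sub, map_smul, Finsupp.sub_apply, Finsupp.smul_apply, D.crd_α_self] at this
    simp at this ⊢
    linarith
  have hvi : D.cr i ν = C - C * D.A i i := by
    rw [hν, r_apply, map_sub, map_smul, D.hpair, hC, smul_eq_mul]
  have hvk : D.cr k ν = C' - C' * D.A k k := by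
    rw [h0, r_apply, map_sub, map_smul, D.hpair, hC', smul_eq_mul]
  have p1q : (0 : ℚ) < C := by exact_mod_cast p1
  have p1q' : (0 : ℚ) < C' := by exact_mod_cast p1'
  have a1 : (D.A i i : ℚ) ≤ 0 := by exact_mod_cast A_nonpos hi i
  have a2 : (D.A k k : ℚ) ≤ 0 := by exact_mod_cast A_nonpos hk k
  have hfc := hl.first_cov hlam hi hk 0
  simp only [p2, if_true, ← hν] at hfc
  rcases hfc with ⟨h3, -⟩ | ⟨z, hz, hcone, hzi, hzk, hpos⟩
  · linarith
  have ci : D.crd (z - ν) i = D.crd (lam - ν) i := by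
    rw [← sub_add_sub_cancel lam z ν, map_add, Finsupp.add_apply, hzi, zero_add]
  have ck : D.crd (z - ν) k = D.crd (lam - ν) k := by
    rw [← sub_add_sub_cancel lam z ν, map_add, Finsupp.add_apply, hzk, zero_add]
  have b1 := hcone.cr_imag_two hi hik
  have b2 := hcone.cr_imag_two hk hik.symm
  rw [map_sub, ci, ck] at b1
  rw [map_sub, ci, ck] at b2
  have n1 := hz.imag_nonneg hlam hi
  have n2 := hz.imag_nonneg hlam hk
  by_contra hne
  have hne' : D.A k i ≠ 0 := fun h => hne ((D.hzero i k).2 h)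
  have a3 : (D.A i k : ℚ) ≤ -1 := by
    have := A_nonpos hi k
    exact_mod_cast (show D.A i k ≤ -1 by omega)
  have a4 : (D.A k i : ℚ) ≤ -1 := by
    have := A_nonpos hk i
    exact_mod_cast (show D.A k i ≤ -1 by omega)
  have m1 := mul_le_mul_of_nonpos_left hci a1
  have m2 := mul_le_mul_of_nonpos_left hck a2
  have m3 : (D.A i k : ℚ) * D.crd (lam - ν) k ≤ - C' := by nlinarith
  have m4 : (D.A k i : ℚ) * D.crd (lam - ν) i ≤ - C := by nlinarith
  rcases hpos with hpos | hpos <;> linarith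

/-- Simultaneous values of two commuting lowering operators come from their composition. -/
lemma fi_image (hlam : lam ∈ Pplus D.cr) (hπ : π ∈ GLSset D.A D.α D.cr lam)
    (hσ : σ ∈ GLSset D.A D.α D.cr lam) (hi : D.A i i ≠ 2) (hk : D.A k k ≠ 2)
    (h : 0 < D.cr i (π 1)) (h' : 0 < D.cr k (σ 1)) (hik : i ≠ k) (he : D.fi i π = D.fi k σ) :
    ∃ τ ∈ GLSset D.A D.α D.cr lam, 0 < D.cr k (τ 1) ∧ D.fi k τ = π := by
  have hA := fi_perp hlam hπ hσ hi hk h h' hik he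
  have hA' : D.A k i = 0 := (D.hzero i k).1 hA
  obtain ⟨N, d, e, C, q, C', q', hd, hde, rfl, rfl, hC, hC', hq, hq'⟩ :=
    exists_common hlam hπ hσ hi hk h h'
  rw [hd.fi_eq hlam hi hC hq, hde.fi_eq hlam hk hC' hq'] at he
  obtain ⟨p1, p2, p3, p4⟩ := hd.lower_pos hq
  obtain ⟨p1', p2', p3', p4'⟩ := hde.lower_pos hq'
  have p1q : (0 : ℚ) < C := by exact_mod_cast p1
  have p1q' : (0 : ℚ) < C' := by exact_mod_cast p1'
  have hN := hd.pos
  have hN' : (0 : ℚ) < N := by positivity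
  have oki : D.Orth k (D.α i) := ⟨D.crd_α_ne hik, by rw [D.hpair, hA']; simp⟩
  have oik : D.Orth i (D.α k) := ⟨D.crd_α_ne hik.symm, by rw [D.hpair, hA]; simp⟩
  have hcomp : ∀ l < N, d l - (if l < q then (C : ℚ) else 0) • D.α i =
      e l - (if l < q' then (C' : ℚ) else 0) • D.α k := by
    intro l hl
    have := eq_of_pth_eq he hl
    have c1 := fun hl => hd.imag_const hlam hi hC hq (k := l) hl
    have c2 := fun hl => hde.imag_const hlam hk hC' hq' (k := l) hl
    split_ifs at this ⊢ with h1 h2 h2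
    · rwa [r_apply, r_apply, c1 h1, c2 h2] at this
    · rw [zero_smul, sub_zero]; rwa [r_apply, c1 h1] at this
    · rw [zero_smul, sub_zero]; rwa [r_apply, c2 h2] at this
    · rwa [zero_smul, zero_smul, sub_zero, sub_zero]
  have hde' : ∀ l < N, d l = e l - (if l < q' then (C' : ℚ) else 0) • D.α k +
      (if l < q then (C : ℚ) else 0) • D.α i := fun l hl => by
    rw [← hcomp l hl]; abel
  have hed' : ∀ l < N, e l = d l - (if l < q then (C : ℚ) else 0) • D.α i +
      (if l < q' then (C' : ℚ) else 0) • D.α k := fun l hl => by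
    rw [hcomp l hl]; abel
  have hcrk : ∀ l < q', D.cr k (d l) = (1 - D.A k k) * C' := fun l hl => by
    rw [hde' l (by omega), if_pos hl]
    simp only [map_sub, map_add, map_smul, D.hpair, hA', smul_eq_mul]
    rw [hde.imag_const hlam hk hC' hq' hl]; push_cast; ring
  have hcri : ∀ l < q, D.cr i (e l) = (1 - D.A i i) * C := fun l hl => by
    rw [hed' l (by omega), if_pos hl]
    simp only [map_sub, map_add, map_smul, D.hpair, hA, smul_eq_mul]
    rw [hd.imag_const hlam hi hC hq hl]; push_cast; ring
  let f : ℕ → V := fun l => if l < q' then d l + (C' : ℚ) • D.α k else d l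
  have hf : D.Grd lam N f := by
    refine Grd.of_T hN (fun l hl => by simp only [f]; rw [if_neg (by omega), hd.ge l hl]) ?_
    intro l hl hT
    have ha : (0 : ℚ) < ((l + 1 : ℕ) : ℚ) / N := by positivity
    rcases lt_trichotomy (l + 1) q' with h1 | h1 | h1
    · simp only [f] at hT ⊢
      rw [if_pos h1] at hT
      rw [if_pos h1, if_pos (by omega)]
      refine (hd.R l hl).shift hlam ha ?_ hT
      have o1 := hde.imag_orth hlam hk hC' hq' h1
      have : d (l + 1) - d l = (e (l + 1) - e l) +
          ((if l + 1 < q then (C : ℚ) else 0) - (if l < q then (C : ℚ) else 0)) • D.α i := by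
        rw [hde' (l + 1) (by omega), hde' l hl, if_pos h1, if_pos (show l < q' by omega)]
        module
      rw [this]
      exact o1.add (oki.smul _)
    · simp only [f]
      rw [if_neg (by omega), if_pos (by omega)]
      have hl' : l < q' := by omega
      rcases lt_trichotomy q q' with h2 | h2 | h2
      · have e1 : d l + (C' : ℚ) • D.α k = e l := by
          rw [hed' l hl, if_neg (by omega), if_pos hl']; module
        have e2 : d (l + 1) = e (l + 1) := by
          rcases lt_or_ge (l + 1) N with h3 | h3
          · rw [hed' _ h3, if_neg (by omega), if_neg (by omega)]; module
          · rw [hd.ge _ h3, hde.ge _ h3]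
        rw [e1, e2]
        exact hde.R l hl
      · refine (hd.R l hl).imag_extract hlam (hd.T _) ha ?_ hk ?_ (hcrk l hl')
        · rw [h1, p4']
          have : (q' : ℚ) ≠ 0 := by positivity
          field_simp
        · have e2 : d (l + 1) = e (l + 1) := by
            rcases lt_or_ge (l + 1) N with h3 | h3
            · rw [hed' _ h3, if_neg (by omega), if_neg (by omega)]; module
            · rw [hd.ge _ h3, hde.ge _ h3]
          have e3 : d (l + 1) - d l = (e (l + 1) - e l) + (C' : ℚ) • D.α k - (C : ℚ) • D.α i := by
            rw [e2, hde' l hl, if_pos hl', if_pos (by omega)]; module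
          have := (R.cone ha (hde.R l hl)).crd_nonneg k
          rw [e3]
          simp only [map_sub, map_add, map_smul, Finsupp.sub_apply, Finsupp.add_apply,
            Finsupp.smul_apply, D.crd_α_self, D.crd_α_ne hik, smul_eq_mul, mul_zero, mul_one] at this ⊢
          linarith
      · have e1 : d l + (C' : ℚ) • D.α k = e l + (C : ℚ) • D.α i := by
          rw [hed' l hl, if_pos (by omega), if_pos hl']; module
        have e2 : d (l + 1) = e (l + 1) + (C : ℚ) • D.α i := by
          rw [hed' (l + 1) (by omega), if_pos (by omega), if_neg (by omega)]; module
        rw [e1, e2]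
        refine (hde.R l hl).shift hlam ha ?_ (e2 ▸ hd.T _)
        have o1 := hd.imag_orth hlam hi hC hq (k := l) (by omega)
        have : e (l + 1) - e l = (d (l + 1) - d l) + (-C' : ℚ) • D.α k := by
          rw [hed' (l + 1) (by omega), hed' l hl, if_pos (show l + 1 < q by omega),
            if_pos (show l < q by omega), if_neg (show ¬ l + 1 < q' by omega), if_pos hl']
          module
        rw [this]
        exact o1.add (oik.smul _)
    · simp only [f]
      rw [if_neg (by omega), if_neg (by omega)]
      exact hd.R l hl
  have hfk : ∀ l < q', D.cr k (f l) = C' := fun l hl => by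
    simp only [f]
    rw [if_pos hl, map_add, map_smul, D.hpair, hcrk l hl, smul_eq_mul]; ring
  refine ⟨_, hf.mem, ?_, ?_⟩
  · rw [hf.one_pos_iff hlam hk, hfk 0 p2']; exact p1q'
  · rw [hf.fi_eq hlam hk (hfk 0 p2') hq']
    refine pth_congr fun l hl => ?_
    split_ifs with h1
    · rw [r_apply, hfk l h1]; simp only [f]; rw [if_pos h1]; abel
    · simp only [f]; rw [if_neg h1]

end Datum
end GKM

/-! ### Finiteness -/

namespace GKM
namespace Datum

variable {I V : Type*} [AddCommGroup V] [Module ℚ V] {D : Datum I V} {i j k l : I}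
variable {lam ρ x y z : V} {N M : ℕ} {d e : ℕ → V} {π σ : ℚ → V} {a : ℚ}

lemma pth_const (hN : 0 < N) (x : V) : pth N (fun _ => x) = pth 1 fun _ => x := by
  simpa using pth_refine (d := fun _ => x) one_pos hN

lemma str_mem (lam : V) : (pth 1 fun _ => lam) ∈ GLSset D.A D.α D.cr lam :=
  Grd.mem ⟨one_pos, fun _ _ => rfl, fun _ _ => Relation.ReflTransGen.refl⟩

lemma str_apply (x : V) (t : ℚ) : pth 1 (fun _ => x) t = clp t • x := by
  rw [← pth_clp, pth]
  have h1 := clp_nonneg t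
  have h2 := clp_le_one t
  simp [h1, h2]

lemma str_one (x : V) : pth 1 (fun _ => x) 1 = x := by
  rw [str_apply, clp_one, one_smul]

/-- Every path is straight, or raisable by a real or an imaginary operator. -/
lemma path_cases (hlam : lam ∈ Pplus D.cr) (hπ : π ∈ GLSset D.A D.α D.cr lam)
    (hdom : ∀ j, D.A j j = 2 → 0 ≤ D.mn j π) : π = pth 1 (fun _ => lam) ∨
    ∃ i, D.A i i ≠ 2 ∧ ∃ σ ∈ GLSset D.A D.α D.cr lam, 0 < D.cr i (σ 1) ∧ D.fi i σ = π := by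
  obtain ⟨N, d, h, rfl⟩ := exists_grd hπ
  have hN := h.pos
  have hN' : (0 : ℚ) < N := by positivity
  by_cases hne : ∃ k, d k ≠ lam
  · right
    refine h.exists_raise hlam (fun j hj => ?_) hne
    have h1 := mn_le (D := D) hπ (j := j) (nd_nonneg N 1) (nd_le_one hN hN)
    rw [pth_nd hN hN, Finset.sum_range_one, map_smul, smul_eq_mul] at h1
    have h2 := (hdom j hj).trans h1
    exact (mul_nonneg_iff_of_pos_left (by positivity)).1 h2
  · left
    push Not at hne
    rw [← pth_const hN]
    congr 1
    exact funext hne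

lemma eq_add_single {c : I →₀ ℕ} (hx : x ∈ Qplus D.α) (h : D.rs c = x + D.α i) :
    c i ≠ 0 ∧ x = D.rs (c - Finsupp.single i 1) := by
  obtain ⟨c', rfl⟩ := mem_Qplus_iff.1 hx
  have : c = c' + Finsupp.single i 1 := by
    apply D.rs_injective; rw [h, D.rs_add, D.rs_single, Nat.cast_one, one_smul]
  subst this
  constructor
  · simp
  · rw [add_tsub_cancel_right]

lemma paths_subset (hlam : lam ∈ Pplus D.cr) (c : I →₀ ℕ) :
    {π | π ∈ GLSset D.A D.α D.cr lam ∧ lam - π 1 = D.rs c} ⊆ {pth 1 fun _ => lam} ∪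
      ⋃ i ∈ c.support,
        (D.fi i '' {π | π ∈ GLSset D.A D.α D.cr lam ∧ lam - π 1 = D.rs (c - Finsupp.single i 1)} ∪
        D.G i 1 '' {π | π ∈ GLSset D.A D.α D.cr lam ∧
          lam - π 1 = D.rs (c - Finsupp.single i 1)}) := by
  rintro π ⟨hπ, hc⟩
  by_cases hdom : ∀ j, D.A j j = 2 → 0 ≤ D.mn j π
  · rcases path_cases hlam hπ hdom with h | ⟨i, hi, σ, hσ, h, rfl⟩
    · exact Or.inl h
    · right
      obtain ⟨h1, h2⟩ := eq_add_single (D := D) (c := c) (i := i) (path_sub_mem hσ)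
        (by rw [← hc, fi_one hlam hσ h]; abel)
      simp only [Set.mem_iUnion]
      exact ⟨i, Finsupp.mem_support_iff.2 h1, Or.inl ⟨σ, ⟨hσ, h2⟩, rfl⟩⟩
  · right
    push Not at hdom
    obtain ⟨j, hj, hneg⟩ := hdom
    obtain ⟨z, hz⟩ := mn_int hlam hπ hj
    have h1 : D.mn j π ≤ (-1 : ℤ) := by
      rw [hz] at hneg ⊢
      have : z < 0 := by exact_mod_cast hneg
      exact_mod_cast (by omega : z ≤ -1)
    have h2 : ((-1 : ℤ) : ℚ) ≤ D.cr j (π 1) - D.mn j π := by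
      have := mn_le (D := D) hπ (j := j) zero_le_one le_rfl
      push_cast; linarith
    have hσ := G_mem hlam hπ hj h1
    obtain ⟨h3, h4⟩ := eq_add_single (D := D) (c := c) (i := j) (path_sub_mem hσ) (by
      rw [← hc, G_one hπ h2]; push_cast; module)
    simp only [Set.mem_iUnion]
    exact ⟨j, Finsupp.mem_support_iff.2 h3, Or.inr ⟨_, ⟨hσ, h4⟩, G_neg hlam hπ hj h1 h2⟩⟩

lemma finite_paths (hlam : lam ∈ Pplus D.cr) (c : I →₀ ℕ) :
    {π | π ∈ GLSset D.A D.α D.cr lam ∧ lam - π 1 = D.rs c}.Finite := by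
  classical
  induction hm : c.degree generalizing c with
  | zero =>
    rw [Finsupp.degree_eq_zero_iff] at hm
    subst hm
    exact Set.Finite.subset (by simp) (paths_subset hlam 0)
  | succ m ih =>
    refine Set.Finite.subset ?_ (paths_subset hlam c)
    refine (Set.finite_singleton _).union (Set.Finite.biUnion c.support.finite_toSet fun i hi => ?_)
    have : (c - Finsupp.single i 1).degree = m := by
      have h1 : c = (c - Finsupp.single i 1) + Finsupp.single i 1 := by
        rw [tsub_add_cancel_of_le]
        rw [Finsupp.single_le_iff]
        exact Nat.one_le_iff_ne_zero.2 (Finsupp.mem_support_iff.1 hi)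
      have h2 := congrArg Finsupp.degree h1
      rw [map_add, Finsupp.degree_single, hm] at h2
      omega
    exact ((ih _ this).image _).union ((ih _ this).image _)

lemma crd_wd_of_notMem {l : List I} (hi : i ∉ l) (x : V) : D.crd (D.wd l x) i = D.crd x i := by
  induction l with
  | nil => simp
  | cons j l ih =>
    rw [List.mem_cons, not_or] at hi
    rw [wd_cons, Module.End.mul_apply, r_apply, map_sub, map_smul, Finsupp.sub_apply,
      Finsupp.smul_apply, D.crd_α_ne (Ne.symm hi.1), smul_zero, sub_zero, ih hi.2]

lemma Red.sub_wd (hρ : ∀ i, D.A i i = 2 → D.cr i ρ = 1) {l : List I} (hl : D.Red l) :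
    ∃ c, ρ - D.wd l ρ = D.rs c ∧ (∀ m ∈ l, c m ≠ 0) ∧ l.length ≤ c.degree := by
  induction l using List.reverseRecOn with
  | nil => exact ⟨0, by simp⟩
  | append_singleton l i ih =>
    obtain ⟨c, h1, h2, h3⟩ := ih hl.left
    obtain ⟨b, b', hb, -, -⟩ := hl.pos
    have hi : D.A i i = 2 := hl.1 i (by simp)
    refine ⟨c + b, ?_, fun m hm => ?_, ?_⟩
    · rw [D.rs_add, ← h1, ← hb, wd_append, wd_singleton, Module.End.mul_apply, r_apply, hρ i hi,
        one_smul, map_sub]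
      abel
    · rcases List.mem_append.1 hm with hm | hm
      · have := h2 m hm
        simp [this]
      · rw [List.mem_singleton] at hm
        subst hm
        by_cases hml : m ∈ l
        · have := h2 m hml
          simp [this]
        · have := D.crd_rs b m
          rw [← hb, crd_wd_of_notMem hml, D.crd_α_self] at this
          have : b m = 1 := by exact_mod_cast this.symm
          simp [this]
    · have hb0 : b ≠ 0 := by
        rintro rfl
        rw [D.rs_zero, ← map_zero (D.wd l)] at hb
        exact D.α_ne_zero i (D.wd_injective hl.left.1 hb)
      have : b.degree ≠ 0 := by rwa [Ne, Finsupp.degree_eq_zero_iff]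
      rw [map_add, List.length_append, List.length_singleton]
      omega

lemma mem_Wmon_iff {w : Module.End ℚ V} : w ∈ Wmon D.A D.α D.cr ↔ ∃ l, D.RW l ∧ D.wd l = w := by
  constructor
  · intro h
    induction h using Submonoid.closure_induction with
    | mem x h =>
      obtain ⟨i, hi, rfl⟩ := h
      exact ⟨[i], RW.singleton hi, D.wd_singleton i⟩
    | one => exact ⟨[], RW.nil, D.wd_nil⟩
    | mul x y _ _ hx hy =>
      obtain ⟨l, h1, rfl⟩ := hx
      obtain ⟨l', h2, rfl⟩ := hy
      exact ⟨l ++ l', h1.append h2, D.wd_append l l'⟩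
  · rintro ⟨l, hl, rfl⟩
    exact Submonoid.list_prod_mem _ fun x hx => by
      obtain ⟨i, hi, rfl⟩ := List.mem_map.1 hx
      exact Submonoid.subset_closure ⟨i, hl i hi, rfl⟩

lemma exists_red_of_mem {w : Module.End ℚ V} (h : w ∈ Wmon D.A D.α D.cr) :
    ∃ l, D.Red l ∧ D.wd l = w := by
  obtain ⟨l, hl, rfl⟩ := mem_Wmon_iff.1 h
  exact D.exists_red hl

lemma Red.lenW_eq {l : List I} (hl : D.Red l) : lenW D.A D.α D.cr (D.wd l) = l.length := by
  apply le_antisymm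
  · exact Nat.sInf_le ⟨l, hl.1, rfl, rfl⟩
  · obtain ⟨l', h1, h2, h3⟩ := Nat.sInf_mem (s := {n | ∃ l' : List I, (∀ m ∈ l', D.A m m = 2) ∧
      l'.length = n ∧ (l'.map (srefl D.α D.cr)).prod = D.wd l}) ⟨_, l, hl.1, rfl, rfl⟩
    unfold lenW
    rw [← h2]
    exact hl.2 l' h1 h3

lemma mul_r_mem {w : Module.End ℚ V} (h : w ∈ Wmon D.A D.α D.cr) (hj : D.A j j = 2) :
    w * D.r j ∈ Wmon D.A D.α D.cr :=
  mul_mem h (Submonoid.subset_closure ⟨j, hj, rfl⟩)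

lemma sign_mul_r {w : Module.End ℚ V} (h : w ∈ Wmon D.A D.α D.cr) (hj : D.A j j = 2) (n : ℕ) :
    (-1 : ℤ) ^ (lenW D.A D.α D.cr w + n) + (-1) ^ (lenW D.A D.α D.cr (w * D.r j) + n) = 0 := by
  obtain ⟨l', hl', e'⟩ := exists_red_of_mem (mul_r_mem h hj)
  obtain ⟨l, hl, rfl⟩ := exists_red_of_mem h
  rw [← e', hl.lenW_eq, hl'.lenW_eq]
  rcases D.red_length_append hl hl' hj (by rw [e', wd_append, wd_singleton]) with h1 | h1 <;>
    rw [h1] <;> ring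

lemma Red.sub_wd_sub (hρ : ∀ i, D.A i i = 2 → D.cr i ρ = 1) {l : List I} (hl : D.Red l)
    {F : Finset I} (hF : ∀ i ∈ F, D.A i i ≠ 2) :
    ∃ c, ρ - D.wd l (ρ - ∑ i ∈ F, D.α i) = D.rs c ∧ (∀ m ∈ l, c m ≠ 0) ∧ (∀ m ∈ F, c m ≠ 0) ∧
      l.length ≤ c.degree := by
  classical
  induction F using Finset.induction_on with
  | empty => simpa using hl.sub_wd hρ
  | insert i F hi ih =>
    obtain ⟨c, h1, h2, h3, h4⟩ := ih fun m hm => hF m (Finset.mem_insert_of_mem hm)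
    have hii := hF i (Finset.mem_insert_self _ _)
    obtain ⟨b, b', hb, -, -⟩ := D.pos_imag_word hii hl
    refine ⟨c + b, ?_, fun m hm => ?_, fun m hm => ?_, ?_⟩
    · rw [Finset.sum_insert hi, D.rs_add, ← h1, ← hb, ← sub_sub, sub_right_comm, map_sub]
      abel
    · have := h2 m hm
      simp [this]
    · rcases Finset.mem_insert.1 hm with rfl | hm
      · have := D.crd_rs b m
        rw [← hb, D.crd_wd hl.1 hii, D.crd_α_self] at this
        have : b m = 1 := by exact_mod_cast this.symm
        simp [this]
      · have := h3 m hm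
        simp [this]
    · rw [map_add]; omega

/-- The indices contributing to the product side of the character formula are finitely many. -/
lemma finite_triples (hlam : lam ∈ Pplus D.cr) (hρ : ∀ i, D.cr i ρ = (D.A i i : ℚ) / 2) (μ : V) :
    {x : Module.End ℚ V × Finset I × (ℚ → V) | x.1 ∈ Wmon D.A D.α D.cr ∧ PImSet D.A x.2.1 ∧
      x.2.2 ∈ GLSset D.A D.α D.cr lam ∧ x.1 (ρ - ∑ i ∈ x.2.1, D.α i) + x.2.2 1 = μ}.Finite := by
  classical
  have hρ' : ∀ i, D.A i i = 2 → D.cr i ρ = 1 := fun i hi => by rw [hρ, hi]; norm_num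
  have key : ∀ w F π, w ∈ Wmon D.A D.α D.cr → PImSet D.A F → π ∈ GLSset D.A D.α D.cr lam →
      w (ρ - ∑ i ∈ F, D.α i) + π 1 = μ → ∃ l c c', D.wd l = w ∧ (∀ m ∈ l, c m ≠ 0) ∧
      (∀ m ∈ F, c m ≠ 0) ∧ l.length ≤ c.degree ∧ lam - π 1 = D.rs c' ∧
      lam + ρ - μ = D.rs (c + c') := by
    intro w F π hw hF hπ he
    obtain ⟨l, hl, rfl⟩ := exists_red_of_mem hw
    obtain ⟨c, h1, h2, h3, h4⟩ := hl.sub_wd_sub hρ' hF.1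
    obtain ⟨c', hc'⟩ := mem_Qplus_iff.1 (path_sub_mem hπ)
    refine ⟨l, c, c', rfl, h2, h3, h4, hc', ?_⟩
    rw [D.rs_add, ← hc', ← h1, ← he]
    abel
  by_cases hc : ∃ c, lam + ρ - μ = D.rs c
  swap
  · refine Set.finite_empty.subset ?_
    rintro ⟨w, F, π⟩ ⟨hw, hF, hπ, he⟩
    obtain ⟨l, c, c', -, -, -, -, -, h⟩ := key w F π hw hF hπ he
    exact hc ⟨_, h⟩
  obtain ⟨c, hc⟩ := hc
  have hl : {l : List I | (∀ m ∈ l, m ∈ c.support) ∧ l.length ≤ c.degree}.Finite := by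
    have h1 := List.finite_length_le c.support c.degree
    refine (h1.image (List.map Subtype.val)).subset ?_
    rintro l ⟨h2, h3⟩
    lift l to List c.support using h2
    exact ⟨l, by simpa using h3, rfl⟩
  have hF : {F : Finset I | F ⊆ c.support}.Finite := by
    refine (Finset.finite_toSet c.support.powerset).subset fun F hF => ?_
    simpa using hF
  have hπ : (⋃ c' ∈ Set.Iic c, {π | π ∈ GLSset D.A D.α D.cr lam ∧ lam - π 1 = D.rs c'}).Finite :=
    (Set.finite_Iic c).biUnion fun c' _ => finite_paths hlam c'
  refine ((hl.image D.wd).prod (hF.prod hπ)).subset ?_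
  rintro ⟨w, F, π⟩ ⟨hw, hF, hπ, he⟩
  obtain ⟨l, c1, c2, h1, h2, h3, h4, h5, h6⟩ := key w F π hw hF hπ he
  have h7 : c = c1 + c2 := D.rs_injective (hc ▸ h6)
  refine ⟨⟨l, ⟨fun m hm => ?_, ?_⟩, h1⟩, fun m hm => ?_, ?_⟩
  · have := h2 m hm
    simp [h7, this]
  · rw [h7, map_add]; omega
  · have := h3 m hm
    simp [h7, this]
  · simp only [Set.mem_iUnion]
    exact ⟨c2, by simp [h7], hπ, h5⟩

end Datum
end GKM

/-! ### The Weyl group symmetry and the first sign-reversing involution -/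

namespace GKM
namespace Datum

variable {I V : Type*} [AddCommGroup V] [Module ℚ V] {D : Datum I V} {i j k l : I}
variable {lam ρ x y z : V} {N M : ℕ} {d e : ℕ → V} {π σ : ℚ → V} {a : I → ℕ} {s t : ℚ}

lemma path_cone (hlam : lam ∈ Pplus D.cr) (hπ : π ∈ GLSset D.A D.α D.cr lam) (h0 : 0 ≤ s)
    (hst : s ≤ t)
    (h1 : t ≤ 1) : D.Cone ((t - s) • lam - (π t - π s)) := by
  obtain ⟨N, d, h, rfl⟩ := exists_grd hπ
  have e : ∀ u, 0 ≤ u → u ≤ 1 → u • lam = pth N (fun _ => lam) u := fun u h0 h1 => by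
    rw [pth_const h.pos, str_apply, clp_of_mem h0 h1]
  rw [sub_smul, e t (h0.trans hst) h1, e s h0 (hst.trans h1), sub_sub_sub_comm]
  simp only [pth, ← Finset.sum_sub_distrib, ← smul_sub, ← sub_smul]
  refine Finset.sum_induction _ D.Cone (fun _ _ => Cone.add) Cone.zero fun k hk => ?_
  refine Cone.smul ?_ (Cone.of_Qplus ((h.T k).sub_mem hlam))
  have : (k : ℚ) / N ≤ ((k + 1 : ℕ) : ℚ) / N := by gcongr; omega
  rw [sub_nonneg]
  rcases le_total t ((k : ℚ) / N) with h3 | h3 <;> rcases le_total t (((k + 1 : ℕ) : ℚ) / N) with h4 | h4 <;>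
  rcases le_total s ((k : ℚ) / N) with h5 | h5 <;> rcases le_total s (((k + 1 : ℕ) : ℚ) / N) with h6 | h6 <;>
    simp only [min_eq_left, min_eq_right, *] <;> linarith

lemma path_cone_zero (hlam : lam ∈ Pplus D.cr) (hπ : π ∈ GLSset D.A D.α D.cr lam) (h0 : 0 ≤ t)
    (h1 : t ≤ 1) : D.Cone (t • lam - π t) := by
  simpa [path_zero hπ] using path_cone hlam hπ le_rfl h0 h1

/-- For each `w ∈ W` there is a bijection of the set of paths intertwining the end points. -/
lemma exists_weyl (hlam : lam ∈ Pplus D.cr) {w : Module.End ℚ V} (hw : w ∈ Wmon D.A D.α D.cr) :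
    ∃ B B' : (ℚ → V) → ℚ → V, ∀ π ∈ GLSset D.A D.α D.cr lam,
      B π ∈ GLSset D.A D.α D.cr lam ∧ B' π ∈ GLSset D.A D.α D.cr lam ∧ B' (B π) = π ∧
      B (B' π) = π ∧ w (B π 1) = π 1 := by
  obtain ⟨l, hl, rfl⟩ := mem_Wmon_iff.1 hw
  clear hw
  induction l with
  | nil => exact ⟨id, id, fun π hπ => ⟨hπ, hπ, rfl, rfl, by simp⟩⟩
  | cons j l ih =>
    obtain ⟨B, B', h⟩ := ih hl.tail
    have hj := hl.head
    have hm : ∀ π ∈ GLSset D.A D.α D.cr lam, D.mn j π ≤ -((0 : ℕ) : ℚ) := fun π hπ => by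
      simpa using mn_nonpos hπ
    refine ⟨fun π => B (D.Top j 0 π), fun π => D.Top j 0 (B' π), fun π hπ => ?_⟩
    have hT := Top_mem hlam hπ hj (hm π hπ)
    obtain ⟨h1, h2, h3, h4, h5⟩ := h _ hT
    obtain ⟨g1, g2, g3, g4, g5⟩ := h _ hπ
    refine ⟨h1, Top_mem hlam g2 hj (hm _ g2), ?_, ?_, ?_⟩
    · simp only [h3, Top_Top hlam hπ hj (hm π hπ)]
    · simp only [Top_Top hlam g2 hj (hm _ g2), g4]
    · rw [wd_cons, Module.End.mul_apply, h5, Top_one hlam hπ (hm π hπ), Nat.cast_zero, zero_smul,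
        sub_zero, D.r_r hj]

variable (D) in
/-- The times at which a path first reaches the level `-a_j` for some real `j`. -/
def Hit (a : I → ℕ) (π : ℚ → V) : Set ℚ :=
  {t | 0 ≤ t ∧ t ≤ 1 ∧ ∃ j, D.A j j = 2 ∧ D.cr j (π t) = -(a j : ℚ)}

variable (D) in
/-- The real indices whose level `-a_j` is reached first. -/
def HitIdx (a : I → ℕ) (π : ℚ → V) : Set I :=
  {j | D.A j j = 2 ∧ ∃ t, IsLeast (D.Hit a π) t ∧ D.cr j (π t) = -(a j : ℚ)}

lemma mn_le_of_hitIdx (hπ : π ∈ GLSset D.A D.α D.cr lam) (h : j ∈ D.HitIdx a π) :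
    D.mn j π ≤ -(a j : ℚ) := by
  obtain ⟨-, t, ht, h⟩ := h
  rw [← h]
  exact Datum.mn_le hπ ht.1.1 ht.1.2.1

lemma mn_nonneg_of_crd (hlam : lam ∈ Pplus D.cr) (hπ : π ∈ GLSset D.A D.α D.cr lam)
    (h0 : D.crd (lam - π 1) k = 0) : 0 ≤ D.mn k π := by
  obtain ⟨t, h1, h2, h3⟩ := mn_att (D := D) hπ k
  have c1 := path_cone_zero hlam hπ h1 h2
  have c2 := path_cone hlam hπ h1 h2 le_rfl
  have e : D.crd (t • lam - π t) k = 0 := by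
    apply le_antisymm _ (c1.crd_nonneg k)
    have : lam - π 1 = (t • lam - π t) + ((1 - t) • lam - (π 1 - π t)) := by module
    rw [this, map_add, Finsupp.add_apply] at h0
    linarith [c2.crd_nonneg k]
  have h4 := c1.cr_offsupp e
  rw [map_sub, map_smul, smul_eq_mul, h3] at h4
  have h5 := mul_nonneg h1 (hlam.2 k)
  linarith

lemma hitIdx_nonempty (hlam : lam ∈ Pplus D.cr) (hπ : π ∈ GLSset D.A D.α D.cr lam)
    (ha : ∀ j, D.A j j = 2 → 0 < a j) (hj : D.A j j = 2) (h : D.mn j π ≤ -(a j : ℚ)) :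
    (D.HitIdx a π).Nonempty := by
  classical
  set S := (D.crd (lam - π 1)).support
  have hS : ∀ k, D.A k k = 2 → D.mn k π ≤ -(a k : ℚ) → k ∈ S := fun k hk hm => by
    by_contra hkS
    have h5 := mn_nonneg_of_crd hlam hπ (Finsupp.notMem_support_iff.1 hkS)
    have h6 : (0 : ℚ) < a k := by exact_mod_cast ha k hk
    linarith
  have hfirst : ∀ k, ∃ t, D.A k k = 2 → D.mn k π ≤ -(a k : ℚ) → 0 ≤ t ∧ t ≤ 1 ∧
      D.cr k (π t) = -(a k : ℚ) ∧ ∀ u, 0 ≤ u → u < t → -(a k : ℚ) < D.cr k (π u) := fun k => by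
    by_cases hk : D.A k k = 2 ∧ D.mn k π ≤ -(a k : ℚ)
    · obtain ⟨t, ht⟩ := first_hit hlam hπ hk.1 hk.2
      exact ⟨t, fun _ _ => ht⟩
    · exact ⟨0, fun h1 h2 => absurd ⟨h1, h2⟩ hk⟩
  choose τ hτ using hfirst
  obtain ⟨k, hk, hmin⟩ := Finset.exists_min_image
    (S.filter fun k => D.A k k = 2 ∧ D.mn k π ≤ -(a k : ℚ)) τ
    ⟨j, Finset.mem_filter.2 ⟨hS j hj h, hj, h⟩⟩
  obtain ⟨-, hk1, hk2⟩ := Finset.mem_filter.1 hk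
  obtain ⟨h1, h2, h3, h4⟩ := hτ k hk1 hk2
  refine ⟨k, hk1, τ k, ⟨⟨h1, h2, k, hk1, h3⟩, ?_⟩, h3⟩
  rintro t ⟨g1, g2, m, hm, g3⟩
  have hmm : D.mn m π ≤ -(a m : ℚ) := by rw [← g3]; exact Datum.mn_le hπ g1 g2
  refine (hmin m (Finset.mem_filter.2 ⟨hS m hm hmm, hm, hmm⟩)).trans ?_
  by_contra! hlt
  exact ((hτ m hm hmm).2.2.2 t g1 hlt).ne' g3

lemma hitIdx_Top (hlam : lam ∈ Pplus D.cr) (hπ : π ∈ GLSset D.A D.α D.cr lam)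
    (h : j ∈ D.HitIdx a π) : D.HitIdx a (D.Top j (a j) π) = D.HitIdx a π := by
  have hm := mn_le_of_hitIdx hπ h
  obtain ⟨hj, t, ht, hjt⟩ := h
  have heq : ∀ u, 0 ≤ u → u ≤ t → D.Top j (a j) π u = π u := by
    obtain ⟨t', g1, g2, g3, g4⟩ := first_hit hlam hπ hj hm
    have htt : t' = t := by
      apply le_antisymm
      · by_contra! hlt
        exact (g4 t ht.1.1 hlt).ne' hjt
      · exact ht.2 ⟨g1, g2, j, hj, g3⟩
    subst htt
    intro u hu hut
    refine Top_eq hlam hπ hm hu (hut.trans g2) (fun v hv hvu => g4 v hv (hvu.trans_le hut)) ?_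
    rcases hut.lt_or_eq with h1 | rfl
    · exact (g4 u hu h1).le
    · exact g3.ge
  have hleast : IsLeast (D.Hit a (D.Top j (a j) π)) t := by
    refine ⟨⟨ht.1.1, ht.1.2.1, j, hj, by rw [heq t ht.1.1 le_rfl, hjt]⟩, ?_⟩
    rintro u ⟨g1, g2, m, hm, g3⟩
    by_contra! hlt
    rw [heq u g1 hlt.le] at g3
    exact not_lt.2 (ht.2 ⟨g1, g2, m, hm, g3⟩) hlt
  ext m
  constructor
  · rintro ⟨hm, u, hu, hmu⟩
    obtain rfl := hu.unique hleast
    exact ⟨hm, u, ht, by rwa [heq u ht.1.1 le_rfl] at hmu⟩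
  · rintro ⟨hm, u, hu, hmu⟩
    obtain rfl := hu.unique ht
    exact ⟨hm, u, hleast, by rwa [heq u ht.1.1 le_rfl]⟩

end Datum
end GKM

/-! ### Toggling an imaginary index -/

namespace GKM
namespace Datum

variable {I V : Type*} [AddCommGroup V] [Module ℚ V] {D : Datum I V} {i j k l : I}
variable {lam ρ x y z : V} {π σ : ℚ → V} {F : Finset I} {s t : ℚ}

variable (D) in
/-- The path stays above the walls shifted by `F`. -/
def Above (F : Finset I) (π : ℚ → V) : Prop :=
  ∀ j, D.A j j = 2 → ((∑ k ∈ F, D.A j k : ℤ) : ℚ) ≤ D.mn j π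

variable (D) in
/-- The imaginary indices that can be moved between the path and the set `F`. -/
def Movable (lam : V) (F : Finset I) (π : ℚ → V) : Set I :=
  {m | D.A m m ≠ 2 ∧ ((m ∈ F ∧ 0 < D.cr m (π 1)) ∨ (m ∉ F ∧ (∀ k ∈ F, D.A m k = 0) ∧
    ∃ σ ∈ GLSset D.A D.α D.cr lam, 0 < D.cr m (σ 1) ∧ D.fi m σ = π))}

lemma movable_fi [DecidableEq I] (hlam : lam ∈ Pplus D.cr) (hπ : π ∈ GLSset D.A D.α D.cr lam)
    (hF : PImSet D.A F)
    (hi : i ∈ F) (h : 0 < D.cr i (π 1)) :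
    D.Movable lam (F.erase i) (D.fi i π) = D.Movable lam F π := by
  have hii := hF.1 i hi
  ext m
  refine and_congr_right fun hm => ?_
  by_cases hmi : m = i
  · subst hmi
    constructor
    · exact fun _ => Or.inl ⟨hi, h⟩
    · refine fun _ => Or.inr ⟨Finset.notMem_erase _ _, fun k hk => ?_, π, hπ, h, rfl⟩
      exact hF.2 m hi k (Finset.mem_of_mem_erase hk) (Finset.ne_of_mem_erase hk).symm
  by_cases hmF : m ∈ F
  · have h0 : D.A m i = 0 := hF.2 m hmF i hi hmi
    rw [cr_fi_of_zero h0]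
    simp [hmF, hmi]
  · simp only [hmF, Finset.mem_erase, and_false, false_and, false_or, not_false_eq_true, true_and]
    constructor
    · rintro ⟨h1, σ, hσ, h2, h3⟩
      have h4 := fi_perp hlam hπ hσ hii hm h h2 (Ne.symm hmi) h3.symm
      refine ⟨fun k hk => ?_, fi_image hlam hπ hσ hii hm h h2 (Ne.symm hmi) h3.symm⟩
      by_cases hki : k = i
      · rw [hki]; exact (D.hzero _ _).1 h4
      · exact h1 k ⟨hki, hk⟩
    · rintro ⟨h1, σ, hσ, h2, rfl⟩
      have h3 := h1 i hi
      have h4 := (D.hzero _ _).1 h3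
      refine ⟨fun k hk => h1 k hk.2, D.fi i σ, fi_mem hlam hσ hii ?_, ?_, fi_comm h3 h4 σ⟩
      · rwa [cr_fi_of_zero h4] at h
      · rwa [cr_fi_of_zero h3]

lemma above_fi [DecidableEq I] (hlam : lam ∈ Pplus D.cr) (hπ : π ∈ GLSset D.A D.α D.cr lam)
    (hF : PImSet D.A F)
    (hi : i ∈ F) (h : 0 < D.cr i (π 1)) : D.Above (F.erase i) (D.fi i π) ↔ D.Above F π := by
  have hii := hF.1 i hi
  have hfi := fi_mem hlam hπ hii h
  refine forall_congr' fun j => forall_congr' fun hj => ?_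
  have hne : j ≠ i := by rintro rfl; exact hii hj
  have hA : (D.A j i : ℚ) ≤ 0 := by exact_mod_cast D.hoff j i hne
  have hA' : (D.A i j : ℚ) ≤ 0 := by exact_mod_cast D.hoff i j hne.symm
  have hsum : (∑ k ∈ F, D.A j k) = (∑ k ∈ F.erase i, D.A j k) + D.A j i :=
    (Finset.sum_erase_add _ _ hi).symm
  have hle : (∑ k ∈ F.erase i, D.A j k) ≤ 0 := Finset.sum_nonpos fun k hk => D.hoff j k (by
    rintro rfl; exact hF.1 _ (Finset.mem_of_mem_erase hk) hj)
  rw [hsum]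
  set b := ∑ k ∈ F.erase i, D.A j k
  constructor
  · intro hb
    obtain ⟨t, h0, h1, ht⟩ := mn_att (D := D) hπ j
    have h2 := mn_le (D := D) hfi (j := j) h0 h1
    rw [cr_fi, ht] at h2
    have h3 : min 1 (D.cr i (π t)) ≤ 1 := min_le_left _ _
    push_cast
    nlinarith
  · intro hb
    obtain ⟨t, h0, h1, ht⟩ := mn_att (D := D) hfi j
    have h2 := hb.trans (mn_le (D := D) hπ (j := j) h0 h1)
    obtain ⟨z, hz⟩ := mn_int hlam hfi hj
    suffices hgt : (b : ℚ) - 1 < D.mn j (D.fi i π) by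
      rw [hz] at hgt ⊢
      have : b - 1 < z := by exact_mod_cast hgt
      exact_mod_cast (by omega : b ≤ z)
    rw [← ht, cr_fi]
    push_cast at h2
    rcases le_or_gt 1 (D.cr i (π t)) with h3 | h3
    · rw [min_eq_left h3]; linarith
    rw [min_eq_right h3.le]
    by_cases h4 : D.A j i = 0
    · rw [h4] at h2 ⊢; push_cast at h2 ⊢; linarith
    have hc := path_cone_zero hlam hπ h0 h1
    have c1 := hc.cr_real hj
    have c2 := hc.cr_imag hii j
    have c3 := hc.crd_nonneg j
    have c4 := mul_nonneg h0 (hlam.2 j)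
    have c5 := mul_nonneg h0 (hlam.2 i)
    simp only [map_sub (D.cr _), map_smul (D.cr _), smul_eq_mul] at c1 c2
    have c6 : (D.A j i : ℚ) ≤ -1 := by
      have := D.hoff j i hne
      exact_mod_cast (by omega : D.A j i ≤ -1)
    have c7 : (D.A i j : ℚ) ≤ -1 := by
      have := D.hoff i j hne.symm
      have : D.A i j ≠ 0 := fun h => h4 ((D.hzero _ _).2 h)
      exact_mod_cast (by omega : D.A i j ≤ -1)
    have hb0 : (b : ℚ) ≤ 0 := by exact_mod_cast hle
    have c8 := mul_nonneg (neg_nonneg.2 hA) (sub_nonneg.2 c2)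
    set n := D.crd (t • lam - π t) j
    have c9 : n ≤ D.cr i (π t) := by nlinarith
    nlinarith

lemma wt_fi [DecidableEq I] (hlam : lam ∈ Pplus D.cr) (hπ : π ∈ GLSset D.A D.α D.cr lam)
    (hi : i ∈ F)
    (h : 0 < D.cr i (π 1)) :
    ρ - ∑ k ∈ F.erase i, D.α k + D.fi i π 1 = ρ - ∑ k ∈ F, D.α k + π 1 := by
  rw [fi_one hlam hπ h, ← Finset.sum_erase_add _ _ hi]; abel

variable (D) in
open Classical in
/-- Move the imaginary index `i` between the set `F` and the path `π`. -/
noncomputable def tog [DecidableEq I] (lam : V) (i : I) (F : Finset I) (π : ℚ → V) :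
    Finset I × (ℚ → V) :=
  if i ∈ F then (F.erase i, D.fi i π)
  else (insert i F, if h : ∃ σ ∈ GLSset D.A D.α D.cr lam, 0 < D.cr i (σ 1) ∧ D.fi i σ = π then
    h.choose else π)

lemma tog_of_mem [DecidableEq I] (hi : i ∈ F) : D.tog lam i F π = (F.erase i, D.fi i π) := by
  rw [tog, if_pos hi]

lemma tog_of_notMem [DecidableEq I] (hi : i ∉ F) (hii : D.A i i ≠ 2)
    (hσ : σ ∈ GLSset D.A D.α D.cr lam)
    (h : 0 < D.cr i (σ 1)) (he : D.fi i σ = π) : D.tog lam i F π = (insert i F, σ) := by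
  have hex : ∃ σ ∈ GLSset D.A D.α D.cr lam, 0 < D.cr i (σ 1) ∧ D.fi i σ = π := ⟨σ, hσ, h, he⟩
  rw [tog, if_neg hi, dif_pos hex]
  congr
  exact fi_inj hii (hex.choose_spec.2.2.trans he.symm)

lemma PImSet.erase [DecidableEq I] (hF : PImSet D.A F) (i : I) : PImSet D.A (F.erase i) :=
  ⟨fun k hk => hF.1 k (Finset.mem_of_mem_erase hk), fun k hk l hl =>
    hF.2 k (Finset.mem_of_mem_erase hk) l (Finset.mem_of_mem_erase hl)⟩

lemma PImSet.insert [DecidableEq I] (hF : PImSet D.A F) (hii : D.A i i ≠ 2)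
    (h : ∀ k ∈ F, D.A i k = 0) :
    PImSet D.A (insert i F) := by
  constructor
  · intro k hk
    rcases Finset.mem_insert.1 hk with rfl | hk
    exacts [hii, hF.1 k hk]
  · intro k hk l hl hkl
    rcases Finset.mem_insert.1 hk with rfl | hk' <;> rcases Finset.mem_insert.1 hl with rfl | hl'
    · exact absurd rfl hkl
    · exact h l hl'
    · exact (D.hzero _ _).1 (h k hk')
    · exact hF.2 k hk' l hl' hkl

lemma sign_erase [DecidableEq I] (hi : i ∈ F) (n : ℕ) :
    (-1 : ℤ) ^ (n + F.card) + (-1) ^ (n + (F.erase i).card) = 0 := by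
  rw [← Finset.card_erase_add_one hi]; ring

lemma tog_spec [DecidableEq I] (hlam : lam ∈ Pplus D.cr) (hπ : π ∈ GLSset D.A D.α D.cr lam)
    (hF : PImSet D.A F) (hi : i ∈ D.Movable lam F π) :
    PImSet D.A (D.tog lam i F π).1 ∧ (D.tog lam i F π).2 ∈ GLSset D.A D.α D.cr lam ∧
      D.Movable lam (D.tog lam i F π).1 (D.tog lam i F π).2 = D.Movable lam F π ∧
      (D.Above (D.tog lam i F π).1 (D.tog lam i F π).2 ↔ D.Above F π) ∧
      (∀ ρ : V, ρ - ∑ k ∈ (D.tog lam i F π).1, D.α k + (D.tog lam i F π).2 1 =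
        ρ - ∑ k ∈ F, D.α k + π 1) ∧
      (∀ n : ℕ, (-1 : ℤ) ^ (n + F.card) + (-1) ^ (n + (D.tog lam i F π).1.card) = 0) ∧
      D.tog lam i (D.tog lam i F π).1 (D.tog lam i F π).2 = (F, π) := by
  obtain ⟨hii, ⟨hiF, h⟩ | ⟨hiF, horth, σ, hσ, h, rfl⟩⟩ := hi
  · rw [tog_of_mem hiF]
    refine ⟨PImSet.erase hF i, fi_mem hlam hπ hii h, movable_fi hlam hπ hF hiF h,
      above_fi hlam hπ hF hiF h, fun ρ => wt_fi hlam hπ hiF h, sign_erase hiF, ?_⟩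
    rw [tog_of_notMem (Finset.notMem_erase _ _) hii hπ h rfl, Finset.insert_erase hiF]
  · rw [tog_of_notMem hiF hii hσ h rfl]
    have hF' := PImSet.insert hF hii horth
    have hi' := Finset.mem_insert_self i F
    have e : (insert i F).erase i = F := Finset.erase_insert hiF
    refine ⟨hF', hσ, ?_, ?_, fun ρ => ?_, fun n => ?_, ?_⟩
    · have := movable_fi hlam hσ hF' hi' h
      rw [e] at this; exact this.symm
    · have := above_fi hlam hσ hF' hi' h
      rw [e] at this; exact this.symm
    · have := wt_fi (ρ := ρ) hlam hσ hi' h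
      rw [e] at this; exact this.symm
    · have := sign_erase hi' n
      rw [e] at this; rw [add_comm]; exact this
    · rw [tog_of_mem hi', e]

lemma above_of_mn_nonneg (hF : PImSet D.A F) (h : ∀ j, D.A j j = 2 → 0 ≤ D.mn j π) :
    D.Above F π := fun j hj => by
  refine le_trans ?_ (h j hj)
  exact_mod_cast Finset.sum_nonpos fun k hk => D.hoff j k (by rintro rfl; exact hF.1 _ hk hj)

/-- The configurations surviving both cancellations. -/
lemma movable_eq_empty_iff (hlam : lam ∈ Pplus D.cr) (hπ : π ∈ GLSset D.A D.α D.cr lam)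
    (hF : PImSet D.A F) : (D.Above F π ∧ D.Movable lam F π = ∅) ↔
      π = (pth 1 fun _ => lam) ∧ ∀ i ∈ F, D.cr i lam = 0 := by
  constructor
  · rintro ⟨hab, hmov⟩
    have hno : ∀ i, i ∉ D.Movable lam F π := fun i hi => by rw [hmov] at hi; exact hi
    have hc := Cone.of_Qplus (path_sub_mem hπ)
    have h0 : ∀ i ∈ F, D.cr i (π 1) = 0 ∧ D.cr i lam = 0 ∧
        ∀ l, (D.A i l : ℚ) * D.crd (lam - π 1) l = 0 := fun i hi => by
      have h1 : D.cr i (π 1) ≤ 0 := not_lt.1 fun h => hno i ⟨hF.1 i hi, Or.inl ⟨hi, h⟩⟩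
      have h2 := hc.cr_imag (hF.1 i hi)
      have h3 := hlam.2 i
      have h4 := hc.cr_nonpos (hF.1 i hi)
      simp only [map_sub (D.cr _)] at h2 h4
      have e1 : D.cr i (π 1) = 0 := by linarith
      have e2 : D.cr i lam = 0 := by linarith
      refine ⟨e1, e2, fun l => le_antisymm ?_ ?_⟩
      · exact mul_nonpos_of_nonpos_of_nonneg (by exact_mod_cast D.A_nonpos (hF.1 i hi) l)
          (hc.crd_nonneg l)
      · have := h2 l
        rwa [e1, e2, sub_zero] at this
    refine ⟨?_, fun i hi => (h0 i hi).2.1⟩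
    have hz : ∀ l, D.crd (lam - π 1) l ≠ 0 → ∀ i ∈ F, D.A l i = 0 := fun l hl i hi => by
      have := (mul_eq_zero.1 ((h0 i hi).2.2 l)).resolve_right hl
      exact (D.hzero _ _).1 (by exact_mod_cast this)
    have hdom : ∀ j, D.A j j = 2 → 0 ≤ D.mn j π := fun j hj => by
      by_cases hl : D.crd (lam - π 1) j = 0
      · exact mn_nonneg_of_crd hlam hπ hl
      · have := hab j hj
        rwa [Finset.sum_eq_zero (hz j hl), Int.cast_zero] at this
    rcases path_cases hlam hπ hdom with h | ⟨i, hi, σ, hσ, h, rfl⟩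
    · exact h
    · exfalso
      have h1 := fi_one hlam hσ h
      have hl : D.crd (lam - D.fi i σ 1) i ≠ 0 := by
        have h2 := (Cone.of_Qplus (path_sub_mem hσ)).crd_nonneg i
        rw [h1, sub_sub_eq_add_sub, add_sub_right_comm, map_add, Finsupp.add_apply, D.crd_α_self]
        linarith
      refine hno i ⟨hi, Or.inr ⟨fun hiF => ?_, hz i hl, σ, hσ, h, rfl⟩⟩
      have h2 := (h0 i hiF).1
      have h3 : (D.A i i : ℚ) ≤ 0 := by exact_mod_cast D.A_nonpos hi i
      rw [h1, map_sub, D.hpair] at h2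
      linarith
  · rintro ⟨rfl, h⟩
    constructor
    · refine above_of_mn_nonneg hF fun j _ => mn_nonneg_of_crd hlam hπ ?_
      rw [str_one, sub_self, map_zero, Finsupp.zero_apply]
    · refine Set.eq_empty_of_forall_notMem fun i hi => ?_
      rcases hi with ⟨hii, ⟨hiF, h1⟩ | ⟨-, -, σ, hσ, h1, h2⟩⟩
      · rw [str_one, h i hiF] at h1
        exact lt_irrefl _ h1
      · have h3 := fi_one hlam hσ h1
        have h4 := (Cone.of_Qplus (path_sub_mem hσ)).crd_nonneg i
        rw [h2, str_one] at h3
        rw [h3, sub_right_comm, sub_self, zero_sub, map_neg, Finsupp.neg_apply, D.crd_α_self] at h4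
        linarith

end Datum
end GKM

/-! ### The alternating sum -/

namespace GKM
namespace Datum

variable {I V : Type*} [AddCommGroup V] [Module ℚ V] {D : Datum I V} {i j k : I}
variable {lam ρ μ : V} {π : ℚ → V} {F : Finset I} {w : Module.End ℚ V}

variable (D) in
/-- The depth at which the walls shifted by `F` are strictly crossed. -/
def level (F : Finset I) (j : I) : ℕ := (1 - ∑ k ∈ F, D.A j k).toNat

lemma sum_nonpos_of_real (hF : PImSet D.A F) (hj : D.A j j = 2) : ∑ k ∈ F, D.A j k ≤ 0 :=
  Finset.sum_nonpos fun k hk => D.hoff j k fun e => hF.1 k hk (e ▸ hj)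

lemma level_cast (hF : PImSet D.A F) (hj : D.A j j = 2) :
    (D.level F j : ℤ) = 1 - ∑ k ∈ F, D.A j k := by
  have := sum_nonpos_of_real hF hj
  rw [level, Int.toNat_of_nonneg (by omega)]

lemma level_pos (hF : PImSet D.A F) (hj : D.A j j = 2) : 0 < D.level F j := by
  have := sum_nonpos_of_real hF hj
  have := level_cast hF hj
  omega

lemma not_above_iff (hlam : lam ∈ Pplus D.cr) (hπ : π ∈ GLSset D.A D.α D.cr lam)
    (hF : PImSet D.A F) : ¬ D.Above F π ↔ (D.HitIdx (D.level F) π).Nonempty := by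
  constructor
  · intro h
    simp only [Above, not_forall, not_le] at h
    obtain ⟨j, hj, h⟩ := h
    refine hitIdx_nonempty hlam hπ (fun k hk => level_pos hF hk) hj ?_
    obtain ⟨z, hz⟩ := mn_int hlam hπ hj
    have hl := level_cast hF hj
    rw [hz] at h ⊢
    have h' : z < ∑ k ∈ F, D.A j k := by exact_mod_cast h
    have : z ≤ -(D.level F j : ℤ) := by omega
    exact_mod_cast this
  · rintro ⟨j, hj⟩ h
    have h1 := h j hj.1
    have h2 := mn_le_of_hitIdx hπ hj
    have hl := level_cast hF hj.1
    have : (∑ k ∈ F, D.A j k : ℤ) ≤ -(D.level F j : ℤ) := by exact_mod_cast h1.trans h2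
    omega

lemma r_wt_Top (hlam : lam ∈ Pplus D.cr) (hρ : D.cr j ρ = 1)
    (hπ : π ∈ GLSset D.A D.α D.cr lam) (hF : PImSet D.A F) (hj : D.A j j = 2)
    (ha : D.mn j π ≤ -(D.level F j : ℚ)) :
    D.r j (ρ - ∑ k ∈ F, D.α k + D.Top j (D.level F j) π 1) = ρ - ∑ k ∈ F, D.α k + π 1 := by
  have hl : (D.level F j : ℚ) = 1 - ∑ k ∈ F, (D.A j k : ℚ) := by
    exact_mod_cast congrArg (Int.cast : ℤ → ℚ) (level_cast hF hj)
  have h : D.cr j (ρ - ∑ k ∈ F, D.α k) = D.level F j := by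
    simp only [map_sub, map_sum, D.hpair, hρ, hl]
  have h2 : D.cr j (D.α j) = 2 := by rw [D.hpair, hj]; norm_num
  rw [Top_one hlam hπ ha, map_add, map_sub (D.r j) (D.r j (π 1)), D.r_r hj, map_smul,
    D.r_apply j (ρ - _), h, D.r_apply j (D.α j), h2]
  module

lemma some_congr {S T : Set I} (h : S = T) (hS : S.Nonempty) (hT : T.Nonempty) :
    hT.some = hS.some := by
  subst h; rfl

/-- A sign reversing involution makes a sum vanish. -/
lemma sum_eq_zero_of_involution {X : Type*} (s : Finset X) (f : X → ℤ) (g : X → X)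
    (h : ∀ x ∈ s, f x + f (g x) = 0 ∧ g x ∈ s ∧ g (g x) = x) : ∑ x ∈ s, f x = 0 :=
  Finset.sum_involution (fun x _ => g x) (fun x hx => (h x hx).1)
    (fun x hx hne e => hne (by have := (h x hx).1; rw [e] at this; omega))
    (fun x hx => (h x hx).2.1) fun x hx => (h x hx).2.2

variable (D) in
/-- The index set of the alternating sum after twisting the paths by the Weyl group. -/
def Triples (lam ρ μ : V) : Set (Module.End ℚ V × Finset I × (ℚ → V)) :=
  {x | x.1 ∈ Wmon D.A D.α D.cr ∧ PImSet D.A x.2.1 ∧ x.2.2 ∈ GLSset D.A D.α D.cr lam ∧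
    x.1 (ρ - ∑ i ∈ x.2.1, D.α i + x.2.2 1) = μ}

variable (D) in
/-- The sign of a triple. -/
noncomputable def sgn (x : Module.End ℚ V × Finset I × (ℚ → V)) : ℤ :=
  (-1) ^ (lenW D.A D.α D.cr x.1 + x.2.1.card)

open Classical in
variable (D) in
/-- Reflect the path at the first wall it crosses. -/
noncomputable def flip (x : Module.End ℚ V × Finset I × (ℚ → V)) :
    Module.End ℚ V × Finset I × (ℚ → V) :=
  if h : (D.HitIdx (D.level x.2.1) x.2.2).Nonempty then
    (x.1 * D.r h.some, x.2.1, D.Top h.some (D.level x.2.1 h.some) x.2.2) else x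

open Classical in
variable (D) in
/-- Move an imaginary index between the path and the subset. -/
noncomputable def move (lam : V) (x : Module.End ℚ V × Finset I × (ℚ → V)) :
    Module.End ℚ V × Finset I × (ℚ → V) :=
  if h : (D.Movable lam x.2.1 x.2.2).Nonempty then (x.1, D.tog lam h.some x.2.1 x.2.2) else x

lemma flip_spec (hlam : lam ∈ Pplus D.cr) (hρ : ∀ j, D.A j j = 2 → D.cr j ρ = 1)
    {x : Module.End ℚ V × Finset I × (ℚ → V)} (hx : x ∈ D.Triples lam ρ μ)
    (h : ¬ D.Above x.2.1 x.2.2) :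
    D.sgn x + D.sgn (D.flip x) = 0 ∧
      (D.flip x ∈ D.Triples lam ρ μ ∧ ¬ D.Above (D.flip x).2.1 (D.flip x).2.2) ∧
      D.flip (D.flip x) = x := by
  obtain ⟨w, F, π⟩ := x
  obtain ⟨hw, hF, hπ, hμ⟩ := hx
  dsimp only at hw hF hπ hμ h
  have hne := (not_above_iff hlam hπ hF).1 h
  have hmem : hne.some ∈ D.HitIdx (D.level F) π := hne.some_mem
  have hfl : D.flip (w, F, π) =
      (w * D.r hne.some, F, D.Top hne.some (D.level F hne.some) π) := dif_pos hne
  have hS := hitIdx_Top hlam hπ hmem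
  have hne' := hS.symm ▸ hne
  have hso := some_congr hS.symm hne hne'
  rw [hfl]
  have hj := hmem.1
  have ha := mn_le_of_hitIdx hπ hmem
  have hT := Top_mem hlam hπ hj ha
  refine ⟨sign_mul_r hw hj _, ⟨⟨mul_r_mem hw hj, hF, hT, ?_⟩, ?_⟩, ?_⟩
  · dsimp only
    rw [Module.End.mul_apply, r_wt_Top hlam (hρ _ hj) hπ hF hj ha, hμ]
  · exact (not_above_iff hlam hT hF).2 hne'
  · refine (dif_pos hne').trans ?_
    dsimp only
    rw [hso, mul_assoc, D.r_mul_r hj, mul_one, Top_Top hlam hπ hj ha]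

lemma move_spec (hlam : lam ∈ Pplus D.cr)
    {x : Module.End ℚ V × Finset I × (ℚ → V)} (hx : x ∈ D.Triples lam ρ μ)
    (h : D.Above x.2.1 x.2.2) (hne : D.Movable lam x.2.1 x.2.2 ≠ ∅) :
    D.sgn x + D.sgn (D.move lam x) = 0 ∧
      (D.move lam x ∈ D.Triples lam ρ μ ∧ D.Above (D.move lam x).2.1 (D.move lam x).2.2 ∧
        D.Movable lam (D.move lam x).2.1 (D.move lam x).2.2 ≠ ∅) ∧
      D.move lam (D.move lam x) = x := by
  classical
  obtain ⟨w, F, π⟩ := x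
  obtain ⟨hw, hF, hπ, hμ⟩ := hx
  dsimp only at hw hF hπ hμ h hne
  replace hne := Set.nonempty_iff_ne_empty.2 hne
  obtain ⟨t1, t2, t3, t4, t5, t6, t7⟩ := tog_spec hlam hπ hF hne.some_mem
  have hne' := t3.symm ▸ hne
  have hso := some_congr t3.symm hne hne'
  have hmv : D.move lam (w, F, π) = (w, D.tog lam hne.some F π) := by
    refine (dif_pos hne).trans ?_
    congr
  rw [hmv]
  refine ⟨t6 _, ⟨⟨hw, t1, t2, ?_⟩, t4.2 h, hne'.ne_empty⟩, ?_⟩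
  · dsimp only
    rw [t5, hμ]
  · refine (dif_pos hne').trans (Prod.ext rfl (Eq.trans ?_ t7))
    dsimp only
    rw [hso]

variable (D) in
/-- The index set of the right-hand side. -/
def Pairs (lam ρ μ : V) : Set (Module.End ℚ V × Finset I) :=
  {x | x.1 ∈ Wmon D.A D.α D.cr ∧ PImSet D.A x.2 ∧ (∀ i ∈ x.2, D.cr i lam = 0) ∧
    x.1 (lam + ρ - ∑ i ∈ x.2, D.α i) = μ}

lemma mem_pairs_iff : (w, F) ∈ D.Pairs lam ρ μ ↔
    (w, F, pth 1 fun _ => lam) ∈ D.Triples lam ρ μ ∧ ∀ i ∈ F, D.cr i lam = 0 := by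
  have e : ρ - ∑ i ∈ F, D.α i + lam = lam + ρ - ∑ i ∈ F, D.α i := by abel
  simp only [Pairs, Triples, Set.mem_ofPred_eq, str_one, e, str_mem, true_and]
  tauto

lemma finite_pairs (h : (D.Triples lam ρ μ).Finite) : (D.Pairs lam ρ μ).Finite :=
  Set.Finite.of_injOn (f := fun x => (x.1, x.2, pth 1 fun _ => lam))
    (fun _ hx => (mem_pairs_iff.1 hx).1)
    (fun x _ y _ e => by simpa [Prod.ext_iff] using e) h

lemma sum_triples (hlam : lam ∈ Pplus D.cr) (hρ : ∀ j, D.A j j = 2 → D.cr j ρ = 1)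
    (h : (D.Triples lam ρ μ).Finite) (h' : (D.Pairs lam ρ μ).Finite) :
    ∑ x ∈ h.toFinset, D.sgn x =
      ∑ x ∈ h'.toFinset, (-1 : ℤ) ^ (lenW D.A D.α D.cr x.1 + x.2.card) := by
  classical
  rw [← Finset.sum_filter_add_sum_filter_not _ fun x => D.Above x.2.1 x.2.2,
    sum_eq_zero_of_involution (h.toFinset.filter fun x => ¬ D.Above x.2.1 x.2.2) D.sgn D.flip,
    add_zero, ← Finset.sum_filter_add_sum_filter_not _ fun x => D.Movable lam x.2.1 x.2.2 = ∅,
    sum_eq_zero_of_involution (Finset.filter (fun x => ¬ D.Movable lam x.2.1 x.2.2 = ∅) _) D.sgn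
      (D.move lam), add_zero]
  · symm
    refine Finset.sum_bij (fun x _ => (x.1, x.2, pth 1 fun _ => lam)) ?_ ?_ ?_ fun _ _ => rfl
    · rintro ⟨w, F⟩ hx
      rw [Set.Finite.mem_toFinset, mem_pairs_iff] at hx
      have := (movable_eq_empty_iff hlam hx.1.2.2.1 hx.1.2.1).2 ⟨rfl, hx.2⟩
      simp only [Finset.mem_filter, Set.Finite.mem_toFinset]
      exact ⟨⟨hx.1, this.1⟩, this.2⟩
    · intro x _ y _ e
      simpa [Prod.ext_iff] using e
    · rintro ⟨w, F, π⟩ hx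
      simp only [Finset.mem_filter, Set.Finite.mem_toFinset] at hx
      obtain ⟨⟨hx, h1⟩, h2⟩ := hx
      obtain ⟨rfl, h3⟩ := (movable_eq_empty_iff hlam hx.2.2.1 hx.2.1).1 ⟨h1, h2⟩
      exact ⟨(w, F), (Set.Finite.mem_toFinset _).2 (mem_pairs_iff.2 ⟨hx, h3⟩), rfl⟩
  · intro x hx
    simp only [Finset.mem_filter, Set.Finite.mem_toFinset] at hx ⊢
    obtain ⟨h1, ⟨h2, h3, h4⟩, h5⟩ := move_spec hlam hx.1.1 hx.1.2 hx.2
    exact ⟨h1, ⟨⟨h2, h3⟩, h4⟩, h5⟩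
  · intro x hx
    simp only [Finset.mem_filter, Set.Finite.mem_toFinset] at hx ⊢
    exact flip_spec hlam hρ hx.1 hx.2

theorem character_formula (hlam : lam ∈ Pplus D.cr)
    (hρ : ∀ i, D.cr i ρ = (D.A i i : ℚ) / 2) (μ : V) :
    ∃ (h1 : {x : Module.End ℚ V × Finset I × (ℚ → V) | x.1 ∈ Wmon D.A D.α D.cr ∧
          PImSet D.A x.2.1 ∧ x.2.2 ∈ GLSset D.A D.α D.cr lam ∧
          x.1 (ρ - ∑ i ∈ x.2.1, D.α i) + x.2.2 1 = μ}.Finite)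
      (h2 : (D.Pairs lam ρ μ).Finite),
      ∑ x ∈ h1.toFinset, D.sgn x =
        ∑ x ∈ h2.toFinset, (-1 : ℤ) ^ (lenW D.A D.α D.cr x.1 + x.2.card) := by
  have hρ' : ∀ j, D.A j j = 2 → D.cr j ρ = 1 := fun j hj => by rw [hρ, hj]; norm_num
  have h1 := finite_triples hlam hρ μ
  have hex : ∀ w : Module.End ℚ V, ∃ B B' : (ℚ → V) → ℚ → V, w ∈ Wmon D.A D.α D.cr →
      ∀ π ∈ GLSset D.A D.α D.cr lam, B π ∈ GLSset D.A D.α D.cr lam ∧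
        B' π ∈ GLSset D.A D.α D.cr lam ∧ B' (B π) = π ∧ B (B' π) = π ∧ w (B π 1) = π 1 := by
    intro w
    by_cases hw : w ∈ Wmon D.A D.α D.cr
    · obtain ⟨B, B', h⟩ := exists_weyl hlam hw
      exact ⟨B, B', fun _ => h⟩
    · exact ⟨id, id, fun h => absurd h hw⟩
  choose B B' hB using hex
  have m1 : ∀ x ∈ h1.toFinset, (x.1, x.2.1, B x.1 x.2.2) ∈ D.Triples lam ρ μ := by
    intro x hx
    rw [Set.Finite.mem_toFinset] at hx
    obtain ⟨hw, hF, hπ, hμ⟩ := hx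
    obtain ⟨b1, b2, b3, b4, b5⟩ := hB x.1 hw _ hπ
    exact ⟨hw, hF, b1, by dsimp only; rw [map_add, b5, hμ]⟩
  have m2 : ∀ x ∈ D.Triples lam ρ μ, (x.1, x.2.1, B' x.1 x.2.2) ∈ h1.toFinset := by
    rintro x ⟨hw, hF, hπ, hμ⟩
    obtain ⟨b1, b2, b3, b4, b5⟩ := hB x.1 hw _ hπ
    have b6 := (hB x.1 hw _ b2).2.2.2.2
    rw [b4] at b6
    rw [Set.Finite.mem_toFinset]
    exact ⟨hw, hF, b2, by dsimp only; rw [← b6, ← map_add, hμ]⟩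
  have hT : (D.Triples lam ρ μ).Finite := by
    refine Set.Finite.of_injOn (f := fun x => (x.1, x.2.1, B' x.1 x.2.2))
      (fun x hx => (Set.Finite.mem_toFinset h1).1 (m2 x hx)) ?_ h1
    rintro ⟨w, F, π⟩ hx ⟨w', F', π'⟩ hy e
    simp only [Prod.mk.injEq] at e
    obtain ⟨rfl, rfl, e⟩ := e
    have e' : π = π' := by
      rw [← (hB w hx.1 π hx.2.2.1).2.2.2.1, ← (hB w hx.1 π' hy.2.2.1).2.2.2.1, e]
    rw [e']
  refine ⟨h1, finite_pairs hT, ?_⟩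
  rw [← sum_triples hlam hρ' hT]
  refine Finset.sum_bij' (fun x _ => (x.1, x.2.1, B x.1 x.2.2))
    (fun x _ => (x.1, x.2.1, B' x.1 x.2.2)) (fun x hx => hT.mem_toFinset.2 (m1 x hx))
    (fun x hx => m2 x (hT.mem_toFinset.1 hx)) ?_ ?_ fun _ _ => rfl
  · rintro ⟨w, F, π⟩ hx
    rw [Set.Finite.mem_toFinset] at hx
    dsimp only
    rw [(hB w hx.1 _ hx.2.2.1).2.2.1]
  · rintro ⟨w, F, π⟩ hx
    rw [Set.Finite.mem_toFinset] at hx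
    dsimp only
    rw [(hB w hx.1 _ hx.2.2.1).2.2.2.1]

end Datum
end GKM

open GKM in
/-- The Weyl–Kac–Borcherds character formula for `ℙ_λ` (no symmetrizability
assumption): for every integral weight `μ`, the sets
`S(μ) = {(w, F, π) : w(ρ - s(F)) + π(1) = μ}` and
`S'(μ) = {(w, F) : F ∈ 𝒫(Π_im)^λ, w(λ + ρ - s(F)) = μ}` are finite and the
corresponding alternating sums `Σ (-1)^{ℓ(w) + |F|}` coincide. -/
theorem stmt19 {I V : Type*} [Countable I] [AddCommGroup V] [Module ℚ V]
    (A : I → I → ℤ) (α : I → V) (coroot : I → (V →ₗ[ℚ] ℚ))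
    (hind : LinearIndependent ℚ α)
    (hpair : ∀ i j, coroot i (α j) = (A i j : ℚ))
    (hdiag : ∀ i, A i i = 2 ∨ A i i ≤ 0)
    (hoff : ∀ i j, i ≠ j → A i j ≤ 0)
    (hzero : ∀ i j, A i j = 0 ↔ A j i = 0)
    (ρ : V) (hρ : ∀ i, coroot i ρ = (A i i : ℚ) / 2)
    (lam : V) (hlam : lam ∈ Pplus coroot) :
    ∀ μ ∈ Pint coroot,
      ∃ (h1 : {x : Module.End ℚ V × Finset I × (ℚ → V) |
            x.1 ∈ Wmon A α coroot ∧ PImSet A x.2.1 ∧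
            x.2.2 ∈ GLSset A α coroot lam ∧
            x.1 (ρ - ∑ i ∈ x.2.1, α i) + x.2.2 1 = μ}.Finite)
        (h2 : {x : Module.End ℚ V × Finset I |
            x.1 ∈ Wmon A α coroot ∧ PImSet A x.2 ∧
            (∀ i ∈ x.2, coroot i lam = 0) ∧
            x.1 (lam + ρ - ∑ i ∈ x.2, α i) = μ}.Finite),
        (∑ x ∈ h1.toFinset,
            ((-1 : ℤ) ^ (lenW A α coroot x.1 + x.2.1.card))) =
        (∑ x ∈ h2.toFinset,
            ((-1 : ℤ) ^ (lenW A α coroot x.1 + x.2.card))) := by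
  intro μ _
  let D : Datum I V := ⟨A, α, coroot, hind, hpair, hdiag, hoff, hzero⟩
  exact Datum.character_formula (D := D) hlam hρ μ
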